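/- arXiv:2203.12523 — 14 statements merged into one kernel-verified Lean document; each statement's English description precedes it below -/
import Mathlib

section
/- Let μ be a probability measure on ℝ with ∫_{[0,∞)} x dμ(x) < ∞, let Y be a random variable with distribution μ, and let t ∈ ℝ. Then for every function φ in E_t (i.e. φ: ℝ → ℝ nonnegative, convex, strictly increasing on [t,∞), with φ(t) ≠ 0) there exists a ∈ (0,∞) such that, with φ_{t,a}(x) = max{0, a(x−t) + 1}, one has 𝔼 φ_{t,a}(Y) / φ_{t,a}(t) ≤ 𝔼 φ(Y) / φ(t). -/
open MeasureTheory Set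

/-- If `μ` is a probability measure on `ℝ` with `∫_{[0,∞)} x dμ < ∞` and
`φ ∈ E_t` (nonnegative, convex, strictly increasing on `[t,∞)`, `φ t ≠ 0`), then there is
`a ∈ (0,∞)` such that, with `φ_{t,a} x = max 0 (a(x-t)+1)`,
`𝔼 φ_{t,a}(Y) / φ_{t,a}(t) ≤ 𝔼 φ(Y) / φ(t)` (expectations valued in `[0,∞]`). -/
theorem stmt_0 (μ : Measure ℝ) [IsProbabilityMeasure μ]
    (hμint : ∫⁻ x in Ici (0 : ℝ), ENNReal.ofReal x ∂μ < ⊤)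
    (t : ℝ) (φ : ℝ → ℝ) (hφ0 : ∀ x, 0 ≤ φ x)
    (hconv : ConvexOn ℝ Set.univ φ)
    (hmono : StrictMonoOn φ (Ici t)) (hφt : φ t ≠ 0) :
    ∃ a : ℝ, 0 < a ∧
      (∫⁻ x, ENNReal.ofReal (max 0 (a * (x - t) + 1)) ∂μ) /
          ENNReal.ofReal (max 0 (a * (t - t) + 1)) ≤
        (∫⁻ x, ENNReal.ofReal (φ x) ∂μ) / ENNReal.ofReal (φ t) := by
  have hc : 0 < φ t := lt_of_le_of_ne (hφ0 t) (Ne.symm hφt)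
  have hcont : Continuous φ := by
    have := hconv.continuousOn isOpen_univ
    exact continuousOn_univ.mp this
  have hmeas : Measurable φ := hcont.measurable
  have hR : (∫⁻ x, ENNReal.ofReal (φ x) ∂μ) / ENNReal.ofReal (φ t)
      = ∫⁻ x, ENNReal.ofReal (φ x / φ t) ∂μ := by
    rw [div_eq_mul_inv, ← lintegral_mul_const _ hmeas.ennreal_ofReal]
    refine lintegral_congr fun x => ?_
    rw [ENNReal.ofReal_div_of_pos hc, div_eq_mul_inv]
  rw [hR]
  simp only [sub_self, mul_zero, zero_add, zero_le_one, max_eq_right, ENNReal.ofReal_one, div_one]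
  by_cases hA : ∀ x, φ t ≤ φ x
  · have h1 : ∀ x, 1 ≤ φ x / φ t := fun x => (one_le_div hc).2 (hA x)
    by_cases h0 : μ (Ioi t) = 0
    · refine ⟨1, one_pos, lintegral_mono_ae ?_⟩
      have : ∀ᵐ x ∂μ, x ∉ Ioi t := measure_eq_zero_iff_ae_notMem.mp h0
      filter_upwards [this] with x hx
      apply ENNReal.ofReal_le_ofReal
      have hx' : x ≤ t := not_lt.mp hx
      exact le_trans (max_le zero_le_one (by linarith)) (h1 x)
    · set D := ∫⁻ x, ENNReal.ofReal (φ x / φ t - 1) ∂μ with hD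
      set I := ∫⁻ x, ENNReal.ofReal (x - t) ∂μ with hI
      have hDm : Measurable fun x => ENNReal.ofReal (φ x / φ t - 1) :=
        ((hmeas.div_const _).sub_const _).ennreal_ofReal
      have hD0 : D ≠ 0 := by
        intro h
        rw [hD, lintegral_eq_zero_iff hDm] at h
        apply h0
        rw [measure_eq_zero_iff_ae_notMem]
        filter_upwards [h] with x hx hxt
        have h2 : φ t < φ x := hmono self_mem_Ici (mem_Ici.2 (le_of_lt hxt)) hxt
        have h3 : 1 < φ x / φ t := (one_lt_div hc).2 h2
        have h4 := ENNReal.ofReal_eq_zero.1 hx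
        linarith
      have hIt : I ≠ ⊤ := by
        have hle : I ≤ (∫⁻ x in Ici (0 : ℝ), ENNReal.ofReal x ∂μ) + ENNReal.ofReal |t| := by
          rw [← lintegral_indicator measurableSet_Ici]
          calc I ≤ ∫⁻ x, ((Ici (0:ℝ)).indicator (fun x => ENNReal.ofReal x) x
                + ENNReal.ofReal |t|) ∂μ := by
                refine lintegral_mono fun x => ?_
                have e : (Ici (0:ℝ)).indicator (fun x => ENNReal.ofReal x) x
                    = ENNReal.ofReal x := by
                  by_cases hx : 0 ≤ x
                  · exact indicator_of_mem (mem_Ici.2 hx) _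
                  · rw [indicator_of_notMem (by simpa using hx),
                      ENNReal.ofReal_of_nonpos (le_of_not_ge hx)]
                rw [e]
                refine le_trans (ENNReal.ofReal_le_ofReal ?_) ENNReal.ofReal_add_le
                linarith [neg_abs_le t]
            _ = _ := by
                rw [lintegral_add_right _ measurable_const]
                simp
        exact ne_top_of_le_ne_top (ENNReal.add_ne_top.2 ⟨hμint.ne, ENNReal.ofReal_ne_top⟩) hle
      have hJ : ∫⁻ x, ENNReal.ofReal (φ x / φ t) ∂μ = 1 + D := by
        have : (1 : ENNReal) = ∫⁻ _, 1 ∂μ := by simp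
        rw [this, hD, ← lintegral_add_left measurable_const]
        refine lintegral_congr fun x => ?_
        rw [← ENNReal.ofReal_one, ← ENNReal.ofReal_add zero_le_one (by linarith [h1 x])]
        congr 1; ring
      have hDm1 : min D 1 ≠ ⊤ := ne_top_of_le_ne_top ENNReal.one_ne_top (min_le_right _ _)
      have hDp : 0 < (min D 1).toReal :=
        ENNReal.toReal_pos (by simp [hD0, min_eq_iff]) hDm1
      have hIp : 0 ≤ I.toReal := ENNReal.toReal_nonneg
      have hap : 0 < (min D 1).toReal / (I.toReal + 1) := by positivity
      refine ⟨(min D 1).toReal / (I.toReal + 1), hap, ?_⟩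
      set a := (min D 1).toReal / (I.toReal + 1) with ha
      have haI : ENNReal.ofReal a * I ≤ D := by
        refine le_trans ?_ (min_le_left D 1)
        rw [← ENNReal.ofReal_toReal hIt, ← ENNReal.ofReal_mul hap.le]
        conv_rhs => rw [← ENNReal.ofReal_toReal hDm1]
        apply ENNReal.ofReal_le_ofReal
        rw [ha, div_mul_eq_mul_div, div_le_iff₀ (by positivity)]
        nlinarith
      rw [hJ]
      calc _ ≤ ∫⁻ x, (1 + ENNReal.ofReal a * ENNReal.ofReal (x - t)) ∂μ := by
            refine lintegral_mono fun x => ?_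
            rw [← ENNReal.ofReal_mul hap.le, ENNReal.ofReal_max, ENNReal.ofReal_zero]
            refine max_le zero_le ?_
            refine le_trans ENNReal.ofReal_add_le ?_
            rw [ENNReal.ofReal_one, add_comm]
        _ = 1 + ENNReal.ofReal a * I := by
            rw [lintegral_add_left measurable_const,
              lintegral_const_mul _ (by fun_prop)]
            simp [hI]
        _ ≤ _ := by gcongr
  · push Not at hA
    obtain ⟨y, hy⟩ := hA
    have hyt : y < t := by
      by_contra h
      have := hmono.monotoneOn self_mem_Ici (mem_Ici.2 (not_lt.mp h)) (not_lt.mp h)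
      linarith
    let S : Set ℝ := (fun u => (φ t - φ u) / (t - u)) '' Iio t
    have hub : ∀ z, t < z → ∀ s ∈ S, s ≤ (φ z - φ t) / (z - t) := by
      rintro z hz _ ⟨u, hu, rfl⟩
      exact hconv.slope_mono_adjacent (mem_univ u) (mem_univ z) hu hz
    have hbdd : BddAbove S := ⟨_, hub (t+1) (by linarith)⟩
    have hne : S.Nonempty := ⟨_, y, hyt, rfl⟩
    have hm : 0 < sSup S := lt_of_lt_of_le (div_pos (by linarith) (by linarith))
      (le_csSup hbdd ⟨y, hyt, rfl⟩)
    have key : ∀ x, φ t + sSup S * (x - t) ≤ φ x := by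
      intro x
      rcases lt_trichotomy x t with h | h | h
      · have : (φ t - φ x) / (t - x) ≤ sSup S := le_csSup hbdd ⟨x, h, rfl⟩
        rw [div_le_iff₀ (by linarith)] at this
        linarith
      · subst h; simp
      · have := csSup_le hne (hub x h)
        rw [le_div_iff₀ (by linarith)] at this
        linarith
    refine ⟨sSup S / φ t, div_pos hm hc, lintegral_mono fun x => ENNReal.ofReal_le_ofReal ?_⟩
    refine max_le (div_nonneg (hφ0 x) hc.le) ?_
    rw [le_div_iff₀ hc]
    have := key x
    have e : (sSup S / φ t * (x - t) + 1) * φ t = φ t + sSup S * (x - t) := by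
      field_simp; ring
    linarith
end

section
/- Let μ be a non-atomic probability measure on ℝ with ∫_{[0,∞)} x dμ(x) < ∞, let Y be a random variable with distribution μ, and let t ∈ ℝ satisfy t > 𝔼Y and μ((t,∞)) > 0. Then the function φ ↦ 𝔼 φ(Y)/φ(t), defined on E_t with values in [0,∞], achieves a global minimum at some φ_{t,a} with a ∈ (0,∞) satisfying ∫_{t−a^{-1}}^{∞} (x−t) dμ(x) = 0. At least one such a exists, any such a defines a minimizer, and the corresponding minimum value equals 𝔼 φ_{t,a}(Y)/φ_{t,a}(t) = ℙ{Y > t − a^{-1}}. -/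
open MeasureTheory Set Filter Topology

lemma aux_ofReal_integral_le {α : Type*} [MeasurableSpace α] {ν : Measure α} {f : α → ℝ}
    (hf : Integrable f ν) : ENNReal.ofReal (∫ x, f x ∂ν) ≤ ∫⁻ x, ENNReal.ofReal (f x) ∂ν := by
  have h1 : ENNReal.ofReal (∫ x, max (f x) 0 ∂ν) = ∫⁻ x, ENNReal.ofReal (max (f x) 0) ∂ν :=
    ofReal_integral_eq_lintegral_ofReal hf.pos_part (ae_of_all _ fun x => le_max_right _ _)
  have h2 : ∀ x, ENNReal.ofReal (max (f x) 0) = ENNReal.ofReal (f x) := by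
    intro x
    simp [ENNReal.ofReal, Real.toNNReal]
  simp_rw [h2] at h1
  rw [← h1]
  exact ENNReal.ofReal_le_ofReal (integral_mono hf hf.pos_part fun x => le_max_left _ _)

lemma aux_support {φ : ℝ → ℝ} (h : ConvexOn ℝ Set.univ φ) (t : ℝ) :
    ∃ b : ℝ, ∀ x, φ t + b * (x - t) ≤ φ x := by
  have ht : t ∈ interior (Set.univ : Set ℝ) := by simp
  refine ⟨derivWithin φ (Ioi t) t, fun x => ?_⟩
  rcases lt_trichotomy x t with hx | hx | hx
  · have h1 := h.slope_le_leftDeriv_of_mem_interior (mem_univ x) ht hx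
    have h2 := h1.trans (h.leftDeriv_le_rightDeriv_of_mem_interior ht)
    rw [slope_def_field, div_le_iff₀ (by linarith)] at h2
    linarith
  · simp [hx]
  · have h2 := h.rightDeriv_le_slope_of_mem_interior ht (mem_univ x) hx
    rw [slope_def_field, le_div_iff₀ (by linarith)] at h2
    linarith

lemma aux_pos (μ : Measure ℝ) [IsProbabilityMeasure μ]
    (hμint : ∫⁻ x in Ici (0 : ℝ), ENNReal.ofReal x ∂μ < ⊤) :
    Integrable (fun x : ℝ => max x 0) μ := by
  have h : IntegrableOn (fun x : ℝ => x) (Ici 0) μ := by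
    refine ⟨by fun_prop, ?_⟩
    rw [hasFiniteIntegral_iff_ofReal]
    · exact hμint
    · exact (ae_restrict_iff' measurableSet_Ici).2 (ae_of_all _ fun x hx => hx)
  have h2 := (integrable_indicator_iff measurableSet_Ici).2 h
  refine h2.congr (ae_of_all _ fun x => ?_)
  by_cases hx : 0 ≤ x
  · simp [indicator, hx]
  · simp [indicator, hx, (not_le.1 hx).le]

lemma aux_int (μ : Measure ℝ) [IsProbabilityMeasure μ]
    (hμint : ∫⁻ x in Ici (0 : ℝ), ENNReal.ofReal x ∂μ < ⊤) (t s : ℝ) :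
    IntegrableOn (fun x : ℝ => x - t) (Ici s) μ := by
  have h := ((aux_pos μ hμint).add (integrable_const (|s| + |t|))).integrableOn (s := Ici s)
  refine Integrable.mono' h (by fun_prop) ?_
  refine (ae_restrict_iff' measurableSet_Ici).2 (ae_of_all _ fun x hx => ?_)
  have hx : s ≤ x := hx
  simp only [Pi.add_apply, Real.norm_eq_abs]
  grind

lemma aux_exists (μ : Measure ℝ) [IsProbabilityMeasure μ]
    (hμint : ∫⁻ x in Ici (0 : ℝ), ENNReal.ofReal x ∂μ < ⊤)
    (t : ℝ) (ht : ∫ x, x ∂μ < t) : ∃ s, s < t ∧ ∫ x in Ici s, (x - t) ∂μ ≤ 0 := by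
  by_contra! hcon
  have hcov : AECover μ atTop (fun n : ℕ => Ici (-(n : ℝ))) :=
    aecover_Ici (tendsto_neg_atTop_atBot.comp tendsto_natCast_atTop_atTop)
  have hev : ∀ᶠ n : ℕ in atTop, 0 < ∫ x in Ici (-(n : ℝ)), (x - t) ∂μ := by
    filter_upwards [(tendsto_neg_atTop_atBot.comp
      (tendsto_natCast_atTop_atTop (R := ℝ))).eventually_lt_atBot t] with n hn
    exact hcon _ hn
  have hp : Integrable (fun x : ℝ => (x - t)⁺) μ := by
    have h := (aux_pos μ hμint).add (integrable_const |t|)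
    refine Integrable.mono' h (by fun_prop) (ae_of_all _ fun x => ?_)
    simp only [Pi.add_apply, Real.norm_eq_abs, PosPart.posPart]
    grind
  have hi : Integrable (fun x : ℝ => x - t) μ := by
    refine hcov.integrable_of_integral_norm_bounded (2 * ∫ x, (x - t)⁺ ∂μ)
      (fun n => aux_int μ hμint t _) ?_
    filter_upwards [hev] with n hn
    simp only [Real.norm_eq_abs]
    rw [integral_abs_eq_two_mul_integral_posPart_sub_integral (aux_int μ hμint t _)]
    have := setIntegral_le_integral (s := Ici (-(n : ℝ))) hp
      (ae_of_all _ fun x => posPart_nonneg _)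
    linarith
  have hlim := hcov.integral_tendsto_of_countably_generated hi
  have h0 : 0 ≤ ∫ x, (x - t) ∂μ := ge_of_tendsto hlim (hev.mono fun n hn => hn.le)
  have hx : Integrable (fun x : ℝ => x) μ := by
    exact (hi.add (integrable_const t)).congr (ae_of_all _ fun x => by simp)
  rw [integral_sub hx (integrable_const t)] at h0
  simp at h0
  linarith

/-- For a non-atomic probability measure `μ` on `ℝ` with
`∫_{[0,∞)} x dμ < ∞`, `t > 𝔼Y` and `μ((t,∞)) > 0`, the functional `φ ↦ 𝔼 φ(Y)/φ(t)` on `E_t`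
achieves a global minimum at some `φ_{t,a}` with `a ∈ (0,∞)` satisfying
`∫_{t-a⁻¹}^∞ (x-t) dμ = 0`; at least one such `a` exists, any such `a` gives a minimizer,
and the minimum equals `ℙ{Y > t - a⁻¹}`. -/
theorem stmt_1 (μ : Measure ℝ) [IsProbabilityMeasure μ] [NullSingletonClass μ]
    (hμint : ∫⁻ x in Ici (0 : ℝ), ENNReal.ofReal x ∂μ < ⊤)
    (t : ℝ) (ht : ∫ x, x ∂μ < t) (hpos : 0 < μ (Ioi t)) :
    (∃ a : ℝ, 0 < a ∧ ∫ x in Ici (t - a⁻¹), (x - t) ∂μ = 0) ∧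
    ∀ a : ℝ, 0 < a → (∫ x in Ici (t - a⁻¹), (x - t) ∂μ = 0) →
      ((∀ φ : ℝ → ℝ, (∀ x, 0 ≤ φ x) → ConvexOn ℝ Set.univ φ →
          StrictMonoOn φ (Ici t) → φ t ≠ 0 →
          (∫⁻ x, ENNReal.ofReal (max 0 (a * (x - t) + 1)) ∂μ) /
              ENNReal.ofReal (max 0 (a * (t - t) + 1)) ≤
            (∫⁻ x, ENNReal.ofReal (φ x) ∂μ) / ENNReal.ofReal (φ t)) ∧
        (∫⁻ x, ENNReal.ofReal (max 0 (a * (x - t) + 1)) ∂μ) /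
            ENNReal.ofReal (max 0 (a * (t - t) + 1)) = μ (Ioi (t - a⁻¹))) := by
  constructor
  · obtain ⟨s, hst, hs⟩ := aux_exists μ hμint t ht
    have hc := (aux_int μ hμint t s).continuousOn_Ici_primitive_Ici
    have htpos : 0 < ∫ x in Ici t, (x - t) ∂μ := by
      rw [setIntegral_pos_iff_support_of_nonneg_ae _ (aux_int μ hμint t t)]
      · refine hpos.trans_le (measure_mono fun x hx => ?_)
        have hx : t < x := hx
        exact ⟨by simp only [Function.mem_support]; linarith, hx.le⟩
      · refine (ae_restrict_iff' measurableSet_Ici).2 (ae_of_all _ fun x hx => ?_)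
        exact sub_nonneg.2 hx
    obtain ⟨r, hr, hr0⟩ := intermediate_value_Icc hst.le (hc.mono Icc_subset_Ici_self)
      ⟨hs, htpos.le⟩
    have hrt : r < t := by
      refine lt_of_le_of_ne hr.2 ?_
      rintro rfl
      exact htpos.ne' hr0
    refine ⟨(t - r)⁻¹, inv_pos.2 (by linarith), ?_⟩
    simpa using hr0
  · intro a ha h0
    have hI := aux_int μ hμint t (t - a⁻¹)
    have hlin : ∀ b c : ℝ, ∫ x in Ici (t - a⁻¹), (c + b * (x - t)) ∂μ
        = c * μ.real (Ici (t - a⁻¹)) := by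
      intro b c
      rw [integral_add (integrable_const c) (hI.const_mul b), integral_const_mul, h0]
      simp [mul_comm]
    have hlinI : ∀ b c : ℝ, IntegrableOn (fun x => c + b * (x - t)) (Ici (t - a⁻¹)) μ :=
      fun b c => (integrable_const c).add (hI.const_mul b)
    have hden : ENNReal.ofReal (max 0 (a * (t - t) + 1)) = 1 := by simp
    have hval : ∫⁻ x, ENNReal.ofReal (max 0 (a * (x - t) + 1)) ∂μ = μ (Ici (t - a⁻¹)) := by
      have e1 : ∫⁻ x, ENNReal.ofReal (max 0 (a * (x - t) + 1)) ∂μ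
          = ∫⁻ x in Ici (t - a⁻¹), ENNReal.ofReal (1 + a * (x - t)) ∂μ := by
        rw [← lintegral_indicator measurableSet_Ici]
        refine lintegral_congr fun x => ?_
        have haa : a * a⁻¹ = 1 := mul_inv_cancel₀ ha.ne'
        by_cases hx : t - a⁻¹ ≤ x
        · have : 0 ≤ a * (x - (t - a⁻¹)) := mul_nonneg ha.le (by linarith)
          rw [indicator_of_mem (by exact hx), max_eq_right (by nlinarith), add_comm]
        · have : 0 ≤ a * ((t - a⁻¹) - x) := mul_nonneg ha.le (by linarith)
          rw [indicator_of_notMem (by exact hx), max_eq_left (by nlinarith)]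
          simp
      rw [e1, ← ofReal_integral_eq_lintegral_ofReal (hlinI a 1), hlin, one_mul, ofReal_measureReal]
      refine (ae_restrict_iff' measurableSet_Ici).2 (ae_of_all _ fun x hx => ?_)
      have hx : t - a⁻¹ ≤ x := hx
      have haa : a * a⁻¹ = 1 := mul_inv_cancel₀ ha.ne'
      have : 0 ≤ a * (x - (t - a⁻¹)) := mul_nonneg ha.le (by linarith)
      simp only [Pi.zero_apply]
      nlinarith
    rw [hden, div_one, hval]
    refine ⟨?_, (measure_congr Ioi_ae_eq_Ici).symm⟩
    intro φ hφ hconv _ hφt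
    have hpt : 0 < φ t := lt_of_le_of_ne (hφ t) (Ne.symm hφt)
    obtain ⟨b, hb⟩ := aux_support hconv t
    rw [ENNReal.le_div_iff_mul_le (Or.inl (by simpa using hpt)) (Or.inl ENNReal.ofReal_ne_top)]
    calc μ (Ici (t - a⁻¹)) * ENNReal.ofReal (φ t)
        = ENNReal.ofReal (∫ x in Ici (t - a⁻¹), (φ t + b * (x - t)) ∂μ) := by
          rw [hlin, ENNReal.ofReal_mul (hφ t), ofReal_measureReal, mul_comm]
      _ ≤ ∫⁻ x in Ici (t - a⁻¹), ENNReal.ofReal (φ t + b * (x - t)) ∂μ :=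
          aux_ofReal_integral_le (hlinI b (φ t))
      _ ≤ ∫⁻ x in Ici (t - a⁻¹), ENNReal.ofReal (φ x) ∂μ :=
          lintegral_mono fun x => ENNReal.ofReal_le_ofReal (hb x)
      _ ≤ ∫⁻ x, ENNReal.ofReal (φ x) ∂μ := setLIntegral_le_lintegral _ _
end

section
/- Let X and Y be real valued random variables such that 𝔼 max{0,Y} < ∞ and 𝔼 φ(X) ≤ 𝔼 φ(Y) for every function φ of the form φ(x) = max{0, a(x−t) + 1} with a ∈ (0,∞) and t ∈ ℝ. Let s ∈ ℝ. Then: (I) if ℙ{Y > s} = 0 then ℙ{X > s} = 0; (II) if ℙ{Y > s} ≠ 0 then ℙ{X ≥ 𝔼(Y | Y > s)} ≤ ℙ{Y > s}, where 𝔼(Y | Y > s) = 𝔼[Y·1_{(s,∞)}(Y)] / ℙ{Y > s}. -/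
open MeasureTheory Set

/-- If `𝔼 max{0,Y} < ∞` and `𝔼 φ(X) ≤ 𝔼 φ(Y)` for every
`φ(x) = max{0, a(x−t)+1}` with `a > 0`, `t ∈ ℝ`, then for any `s ∈ ℝ`:
(I) `ℙ{Y > s} = 0 → ℙ{X > s} = 0`;
(II) `ℙ{Y > s} ≠ 0 → ℙ{X ≥ 𝔼(Y | Y > s)} ≤ ℙ{Y > s}`. -/
theorem stmt_2 {Ω : Type*} [MeasurableSpace Ω] (μ : Measure Ω) [IsProbabilityMeasure μ]
    (X Y : Ω → ℝ) (hX : Measurable X) (hY : Measurable Y)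
    (hYint : ∫⁻ ω, ENNReal.ofReal (max 0 (Y ω)) ∂μ < ⊤)
    (hmaj : ∀ a t : ℝ, 0 < a →
      (∫⁻ ω, ENNReal.ofReal (max 0 (a * (X ω - t) + 1)) ∂μ) ≤
        ∫⁻ ω, ENNReal.ofReal (max 0 (a * (Y ω - t) + 1)) ∂μ)
    (s : ℝ) :
    (μ {ω | s < Y ω} = 0 → μ {ω | s < X ω} = 0) ∧
    (μ {ω | s < Y ω} ≠ 0 →
      μ {ω | (∫ ω' in {ω' | s < Y ω'}, Y ω' ∂μ) / (μ {ω' | s < Y ω'}).toReal ≤ X ω} ≤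
        μ {ω | s < Y ω}) := by
  have hA : MeasurableSet {ω | s < Y ω} := measurableSet_lt measurable_const hY
  constructor
  · intro h0
    have h1 := hmaj 1 (s + 1) one_pos
    have h2 : (∫⁻ ω, ENNReal.ofReal (max 0 (1 * (Y ω - (s + 1)) + 1)) ∂μ) = 0 := by
      rw [lintegral_eq_zero_iff (by fun_prop)]
      have h3 : ∀ᵐ ω ∂μ, ¬ s < Y ω := by
        rw [ae_iff]; simpa using h0
      filter_upwards [h3] with ω hω
      simp only [Pi.zero_apply, ENNReal.ofReal_eq_zero]
      exact max_le le_rfl (by linarith)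
    rw [h2, nonpos_iff_eq_zero, lintegral_eq_zero_iff (by fun_prop)] at h1
    have h4 : ∀ᵐ ω ∂μ, ¬ s < X ω := by
      filter_upwards [h1] with ω hω
      simp only [Pi.zero_apply, ENNReal.ofReal_eq_zero] at hω
      have := (le_max_right _ _).trans hω
      linarith
    rw [ae_iff] at h4
    simpa using h4
  · intro h0
    set A := {ω | s < Y ω} with hAdef
    have hmax : Integrable (fun ω => max 0 (Y ω)) μ := by
      refine ⟨by fun_prop, ?_⟩
      have hn : 0 ≤ᵐ[μ] fun ω => max 0 (Y ω) :=
        Filter.Eventually.of_forall fun ω => le_max_left _ _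
      rw [hasFiniteIntegral_iff_ofReal hn]
      exact hYint
    have hYA : IntegrableOn Y A μ := by
      refine Integrable.mono' ((hmax.add (integrable_const |s|)).integrableOn (s := A))
        hY.aestronglyMeasurable ?_
      filter_upwards [ae_restrict_mem hA] with ω hω
      have hω' : s < Y ω := hω
      simp only [Pi.add_apply, Real.norm_eq_abs]
      have a1 := le_max_left 0 (Y ω)
      have a2 := le_max_right 0 (Y ω)
      have a3 := neg_abs_le s
      have a4 := abs_nonneg s
      exact abs_le.2 ⟨by linarith, by linarith⟩
    have hYs : IntegrableOn (fun ω => Y ω - s) A μ := hYA.sub (integrable_const s)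
    set p := (μ A).toReal with hp
    have hp0 : 0 < p := ENNReal.toReal_pos h0 (measure_ne_top μ A)
    set I := ∫ ω in A, Y ω ∂μ with hI
    have hIs : ∫ ω in A, (Y ω - s) ∂μ = I - p * s := by
      rw [integral_sub hYA (integrable_const s)]
      simp [hp, hI, Measure.real]
    have hnn : 0 ≤ᵐ[μ.restrict A] fun ω => Y ω - s := by
      filter_upwards [ae_restrict_mem hA] with ω hω
      have hω' : s < Y ω := hω
      simp only [Pi.zero_apply]; linarith
    have hpos : 0 < I - p * s := by
      rw [← hIs, setIntegral_pos_iff_support_of_nonneg_ae hnn hYs]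
      have : Function.support (fun ω => Y ω - s) ∩ A = A := by
        apply inter_eq_right.2
        intro ω hω
        have hω' : s < Y ω := hω
        simp only [Function.mem_support]
        linarith
      rw [this]
      exact pos_iff_ne_zero.2 h0
    have hms : 0 < I / p - s := by
      rw [sub_pos, lt_div_iff₀ hp0]; linarith
    set m := I / p with hm
    have hIm : I = m * p := by rw [hm]; field_simp
    have ha : 0 < (m - s)⁻¹ := inv_pos.2 hms
    have key : ∀ x : ℝ, (m - s)⁻¹ * (x - m) + 1 = (m - s)⁻¹ * (x - s) := by
      intro x
      have := hms.ne'
      field_simp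
      ring
    have h1 := hmaj (m - s)⁻¹ m ha
    simp only [key] at h1
    have h2 : (∫⁻ ω, ENNReal.ofReal (max 0 ((m - s)⁻¹ * (Y ω - s))) ∂μ) = μ A := by
      have e1 : (fun ω => ENNReal.ofReal (max 0 ((m - s)⁻¹ * (Y ω - s)))) =
          A.indicator (fun ω => ENNReal.ofReal ((m - s)⁻¹ * (Y ω - s))) := by
        funext ω
        by_cases hω : ω ∈ A
        · have hω' : s < Y ω := hω
          rw [indicator_of_mem hω, max_eq_right]
          exact mul_nonneg ha.le (by linarith)
        · have hω' : ¬ s < Y ω := hω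
          rw [indicator_of_notMem hω, max_eq_left]
          · simp
          · exact mul_nonpos_of_nonneg_of_nonpos ha.le (by linarith)
      rw [e1, lintegral_indicator hA, ← ofReal_integral_eq_lintegral_ofReal (hYs.const_mul _),
        integral_const_mul, hIs, hIm]
      · have : (m - s)⁻¹ * (m * p - p * s) = p := by
          have := hms.ne'
          field_simp
        rw [this, hp, ENNReal.ofReal_toReal (measure_ne_top μ A)]
      · filter_upwards [hnn] with ω hω
        exact mul_nonneg ha.le hω
    rw [h2] at h1
    refine le_trans ?_ h1
    have hB : MeasurableSet {ω | m ≤ X ω} := measurableSet_le measurable_const hX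
    rw [← lintegral_indicator_one hB]
    refine lintegral_mono (indicator_le fun ω hω => ?_)
    have hω' : m ≤ X ω := hω
    simp only [Pi.one_apply]
    rw [ENNReal.one_le_ofReal]
    refine le_max_of_le_right ?_
    rw [inv_mul_eq_div, le_div_iff₀ hms]
    linarith
end

section
/- Let X and Y be real valued random variables such that 𝔼 max{0,Y} < ∞ and 𝔼 φ(X) ≤ 𝔼 φ(Y) for every function φ of the form φ(x) = max{0, a(x−t) + 1} with a ∈ (0,∞) and t ∈ ℝ. Then for all x ∈ (0,1) the quantile function of X satisfies H_X(x) ≤ (1/(1−x)) ∫_x^1 H_Y(u) du. -/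
open MeasureTheory Set

/-- The quantile function of a measure on `ℝ`:
`F⁻¹(s) = inf {t : F(t) ≥ s}` where `F(t) = μ((−∞,t])`. -/
noncomputable def quantile (ν : MeasureTheory.Measure ℝ) (s : ℝ) : ℝ :=
  sInf {t : ℝ | s ≤ (ν (Set.Iic t)).toReal}


lemma quantile_le_iff (ν : Measure ℝ) [IsProbabilityMeasure ν] {u : ℝ} (hu : u ∈ Ioo (0:ℝ) 1)
    (t : ℝ) : quantile ν u ≤ t ↔ u ≤ (ν (Iic t)).toReal := by
  have hc : ∀ t, (ν (Iic t)).toReal = ProbabilityTheory.cdf ν t := fun t => by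
    rw [ProbabilityTheory.cdf_eq_real]; rfl
  unfold quantile
  simp only [hc]
  have hne : {t : ℝ | u ≤ ProbabilityTheory.cdf ν t}.Nonempty := by
    obtain ⟨b, hb⟩ := ((ProbabilityTheory.tendsto_cdf_atTop ν).eventually
      (lt_mem_nhds hu.2)).exists
    exact ⟨b, le_of_lt hb⟩
  have hbd : BddBelow {t : ℝ | u ≤ ProbabilityTheory.cdf ν t} := by
    obtain ⟨b, hb⟩ := ((ProbabilityTheory.tendsto_cdf_atBot ν).eventually
      (gt_mem_nhds hu.1)).exists
    refine ⟨b, fun s hs => ?_⟩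
    by_contra h
    have h1 := ProbabilityTheory.monotone_cdf ν (le_of_lt (not_le.1 h))
    have h2 : u ≤ ProbabilityTheory.cdf ν s := hs
    linarith
  constructor
  · intro h
    have hr := (ProbabilityTheory.cdf ν).right_continuous t
    have hr' : Filter.Tendsto (ProbabilityTheory.cdf ν) (nhdsWithin t (Ioi t))
        (nhds (ProbabilityTheory.cdf ν t)) := hr.mono_left (nhdsWithin_mono _ Ioi_subset_Ici_self)
    refine ge_of_tendsto hr' ?_
    filter_upwards [self_mem_nhdsWithin] with s hs
    obtain ⟨r, hr1, hr2⟩ := exists_lt_of_csInf_lt hne (lt_of_le_of_lt h hs)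
    have h2 : u ≤ ProbabilityTheory.cdf ν r := hr1
    exact h2.trans (ProbabilityTheory.monotone_cdf ν hr2.le)
  · intro h
    exact csInf_le hbd h

lemma quantile_monoOn (ν : Measure ℝ) [IsProbabilityMeasure ν] :
    MonotoneOn (quantile ν) (Ioo (0:ℝ) 1) := by
  intro a ha b hb hab
  rw [quantile_le_iff ν ha]
  exact hab.trans ((quantile_le_iff ν hb _).1 le_rfl)

lemma quantile_aem (ν : Measure ℝ) [IsProbabilityMeasure ν] :
    AEMeasurable (quantile ν) (volume.restrict (Ioo (0:ℝ) 1)) :=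
  aemeasurable_restrict_of_monotoneOn measurableSet_Ioo (quantile_monoOn ν)

lemma quantile_map (ν : Measure ℝ) [IsProbabilityMeasure ν] :
    (volume.restrict (Ioo (0:ℝ) 1)).map (quantile ν) = ν := by
  haveI : IsFiniteMeasure ((volume.restrict (Ioo (0:ℝ) 1)).map (quantile ν)) := by
    infer_instance
  refine Measure.ext_of_Iic _ _ fun t => ?_
  rw [Measure.map_apply_of_aemeasurable (quantile_aem ν) measurableSet_Iic,
    Measure.restrict_apply' measurableSet_Ioo]
  have h : quantile ν ⁻¹' Iic t ∩ Ioo 0 1 = Iic (ν (Iic t)).toReal ∩ Ioo 0 1 := by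
    ext u
    simp only [mem_inter_iff, mem_preimage, mem_Iic, and_congr_left_iff]
    exact fun hu => quantile_le_iff ν hu t
  have h1 : (ν (Iic t)).toReal ≤ 1 := ENNReal.toReal_le_of_le_ofReal zero_le_one
    (by simpa using prob_le_one)
  rw [h]
  apply le_antisymm
  · calc _ ≤ volume (Ioc 0 (ν (Iic t)).toReal) := measure_mono fun u hu => ⟨hu.2.1, hu.1⟩
      _ = _ := by simp
  · calc ν (Iic t) = volume (Ioo 0 (ν (Iic t)).toReal) := by simp
      _ ≤ volume (Iic (ν (Iic t)).toReal ∩ Ioo 0 1) :=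
          measure_mono fun u hu => ⟨hu.2.le, hu.1, hu.2.trans_le h1⟩

lemma lint_quantile {Ω : Type*} [MeasurableSpace Ω] (μ : Measure Ω) [IsProbabilityMeasure μ]
    (X : Ω → ℝ) (hX : Measurable X) (c : ℝ) :
    ∫⁻ ω, ENNReal.ofReal (X ω - c) ∂μ
      = ∫⁻ u in Ioo (0:ℝ) 1, ENNReal.ofReal (quantile (μ.map X) u - c) := by
  haveI : IsProbabilityMeasure (μ.map X) := Measure.isProbabilityMeasure_map hX.aemeasurable
  have hm : Measurable fun y : ℝ => ENNReal.ofReal (y - c) := by fun_prop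
  rw [← lintegral_map hm hX, ← lintegral_map' hm.aemeasurable (quantile_aem _), quantile_map]

theorem stmt_4 {Ω : Type*} [MeasurableSpace Ω] (μ : Measure Ω) [IsProbabilityMeasure μ]
    (X Y : Ω → ℝ) (hX : Measurable X) (hY : Measurable Y)
    (hYint : ∫⁻ ω, ENNReal.ofReal (max 0 (Y ω)) ∂μ < ⊤)
    (hmaj : ∀ a t : ℝ, 0 < a →
      (∫⁻ ω, ENNReal.ofReal (max 0 (a * (X ω - t) + 1)) ∂μ) ≤
        ∫⁻ ω, ENNReal.ofReal (max 0 (a * (Y ω - t) + 1)) ∂μ) :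
    ∀ x ∈ Set.Ioo (0 : ℝ) 1,
      quantile (μ.map X) x ≤ (1 / (1 - x)) * ∫ u in x..(1 : ℝ), quantile (μ.map Y) u := by
  intro x hx
  haveI : IsProbabilityMeasure (μ.map X) := Measure.isProbabilityMeasure_map hX.aemeasurable
  haveI : IsProbabilityMeasure (μ.map Y) := Measure.isProbabilityMeasure_map hY.aemeasurable
  set c := quantile (μ.map Y) x with hc
  set q := quantile (μ.map X) x with hq
  have hsub : Ioo x 1 ⊆ Ioo (0:ℝ) 1 := Ioo_subset_Ioo_left hx.1.le
  have hx1 : 0 < 1 - x := by linarith [hx.2]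
  have hm := hmaj 1 (c + 1) one_pos
  have e : ∀ z : ℝ, ENNReal.ofReal (max 0 (1 * (z - (c + 1)) + 1)) = ENNReal.ofReal (z - c) := by
    intro z
    rw [ENNReal.ofReal_max, ENNReal.ofReal_zero, max_eq_right (zero_le)]
    congr 1; ring
  simp only [e] at hm
  have hfin : ∫⁻ ω, ENNReal.ofReal (Y ω - c) ∂μ < ⊤ := by
    calc _ ≤ ∫⁻ ω, (ENNReal.ofReal (max 0 (Y ω)) + ENNReal.ofReal |c|) ∂μ := by
          refine lintegral_mono fun ω => ?_
          rw [← ENNReal.ofReal_add (le_max_left _ _) (abs_nonneg _)]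
          apply ENNReal.ofReal_le_ofReal
          linarith [le_max_right 0 (Y ω), neg_abs_le c]
      _ < ⊤ := by
          rw [lintegral_add_right _ measurable_const]
          exact ENNReal.add_lt_top.2 ⟨hYint, by simp⟩
  rw [lint_quantile μ X hX c, lint_quantile μ Y hY c] at hm
  rw [lint_quantile μ Y hY c] at hfin
  have hY2 : ∫⁻ u in Ioo (0:ℝ) 1, ENNReal.ofReal (quantile (μ.map Y) u - c)
      = ∫⁻ u in Ioo x 1, ENNReal.ofReal (quantile (μ.map Y) u - c) := by
    rw [← lintegral_inter_add_diff _ (Ioo (0:ℝ) 1) (measurableSet_Ioo (a := x) (b := 1)),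
      inter_eq_right.2 hsub]
    convert add_zero _
    refine setLIntegral_eq_zero (measurableSet_Ioo.diff measurableSet_Ioo) ?_
    intro u hu
    have : u ≤ x := by
      by_contra h
      exact hu.2 ⟨not_le.1 h, hu.1.2⟩
    have := quantile_monoOn (μ.map Y) hu.1 hx this
    exact ENNReal.ofReal_of_nonpos (by linarith)
  have hX2 : ENNReal.ofReal ((q - c) * (1 - x)) ≤
      ∫⁻ u in Ioo (0:ℝ) 1, ENNReal.ofReal (quantile (μ.map X) u - c) := by
    calc _ = ∫⁻ u in Ioo x 1, ENNReal.ofReal (q - c) := by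
          rw [ENNReal.ofReal_mul' hx1.le]; simp
      _ ≤ ∫⁻ u in Ioo x 1, ENNReal.ofReal (quantile (μ.map X) u - c) := by
          refine setLIntegral_mono' measurableSet_Ioo fun u hu => ?_
          apply ENNReal.ofReal_le_ofReal
          linarith [quantile_monoOn (μ.map X) hx (hsub hu) hu.1.le]
      _ ≤ _ := lintegral_mono_set hsub
  rw [hY2] at hm hfin
  have hnn : 0 ≤ᵐ[volume.restrict (Ioo x 1)] fun u => quantile (μ.map Y) u - c := by
    filter_upwards [ae_restrict_mem measurableSet_Ioo] with u hu
    have := quantile_monoOn (μ.map Y) hx (hsub hu) hu.1.le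
    simp only [Pi.zero_apply]; linarith
  have haem : AEMeasurable (quantile (μ.map Y)) (volume.restrict (Ioo x 1)) :=
    (quantile_aem (μ.map Y)).mono_measure (Measure.restrict_mono_set _ hsub)
  have hint : Integrable (fun u => quantile (μ.map Y) u - c) (volume.restrict (Ioo x 1)) := by
    refine ⟨(haem.sub_const c).aestronglyMeasurable, ?_⟩
    rw [hasFiniteIntegral_iff_ofReal hnn]
    exact hfin
  have hint2 : Integrable (quantile (μ.map Y)) (volume.restrict (Ioo x 1)) := by
    have := hint.add (integrable_const c)
    refine this.congr (Filter.Eventually.of_forall fun u => ?_)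
    simp
  have hle := hX2.trans hm
  rw [← ofReal_integral_eq_lintegral_ofReal hint hnn,
    ENNReal.ofReal_le_ofReal_iff (integral_nonneg_of_ae hnn),
    integral_sub hint2 (integrable_const c)] at hle
  rw [intervalIntegral.integral_of_le hx.2.le, integral_Ioc_eq_integral_Ioo,
    div_mul_eq_mul_div, one_mul, le_div_iff₀ hx1]
  simp [hx.2.le] at hle
  linarith
end

section
/- Let X and Y be real valued random variables such that 𝔼 max{0,Y} < ∞ and 𝔼 φ(X) ≤ 𝔼 φ(Y) for every function φ of the form φ(x) = max{0, a(x−t) + 1} with a ∈ (0,∞) and t ∈ ℝ. Suppose H: (0,1) → (0,∞) satisfies H_Y(x) ≤ H(x) for all x ∈ (0,1), and suppose ω: (0,1) → (1,∞) is a non-increasing function with ∫_0^1 ω(u) du < ∞ such that H(1 − δ(1−x)) ≤ ω(δ) H(x) for all x, δ ∈ (0,1). Then for all x ∈ (0,1), H_X(x) ≤ H(x) ∫_0^1 ω(u) du. -/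
open MeasureTheory Set

/-- Under convex majorization of `X` by `Y` through the family
`φ(x) = max{0, a(x−t)+1}`, if `H_Y ≤ H` on `(0,1)` where `H : (0,1) → (0,∞)` satisfies
`H(1 − δ(1−x)) ≤ ω(δ) H(x)` for a non-increasing `ω : (0,1) → (1,∞)` with `∫₀¹ ω < ∞`,
then `H_X(x) ≤ H(x) ∫₀¹ ω(u) du` for all `x ∈ (0,1)`. -/
theorem stmt_5 {Ω : Type*} [MeasurableSpace Ω] (μ : Measure Ω) [IsProbabilityMeasure μ]
    (X Y : Ω → ℝ) (hX : Measurable X) (hY : Measurable Y)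
    (hYint : ∫⁻ ω, ENNReal.ofReal (max 0 (Y ω)) ∂μ < ⊤)
    (hmaj : ∀ a t : ℝ, 0 < a →
      (∫⁻ ω, ENNReal.ofReal (max 0 (a * (X ω - t) + 1)) ∂μ) ≤
        ∫⁻ ω, ENNReal.ofReal (max 0 (a * (Y ω - t) + 1)) ∂μ)
    (H w : ℝ → ℝ)
    (hH : ∀ x ∈ Set.Ioo (0 : ℝ) 1, quantile (μ.map Y) x ≤ H x)
    (hHpos : ∀ x ∈ Set.Ioo (0 : ℝ) 1, 0 < H x)
    (hw1 : ∀ u ∈ Set.Ioo (0 : ℝ) 1, 1 < w u)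
    (hwmono : AntitoneOn w (Set.Ioo (0 : ℝ) 1))
    (hwint : IntegrableOn w (Set.Ioo (0 : ℝ) 1))
    (hcomp : ∀ x ∈ Set.Ioo (0 : ℝ) 1, ∀ δ ∈ Set.Ioo (0 : ℝ) 1,
      H (1 - δ * (1 - x)) ≤ w δ * H x) :
    ∀ x ∈ Set.Ioo (0 : ℝ) 1,
      quantile (μ.map X) x ≤ H x * ∫ u in (0 : ℝ)..1, w u := by
  intro x hx
  obtain ⟨hx0, hx1⟩ := hx
  have hc := hHpos x ⟨hx0, hx1⟩
  have hqc := hH x ⟨hx0, hx1⟩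
  set c := H x with hcdef
  set W := ∫ u in (0 : ℝ)..1, w u with hW
  have hWset : W = ∫ u in Set.Ioo (0 : ℝ) 1, w u := by
    rw [hW, intervalIntegral.integral_of_le zero_le_one, integral_Ioc_eq_integral_Ioo]
  have hsub : ∫ u in Set.Ioo (0 : ℝ) 1, c * (w u - 1) = c * (W - 1) := by
    rw [integral_const_mul, integral_sub hwint (by simp), ← hWset]
    simp
  have hint : IntegrableOn (fun u => c * (w u - 1)) (Set.Ioo (0 : ℝ) 1) := by
    apply Integrable.const_mul
    exact Integrable.sub hwint (by simp)
  have hW1 : 0 ≤ c * (W - 1) := by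
    rw [← hsub]
    apply setIntegral_nonneg measurableSet_Ioo
    intro u hu
    have := hw1 u hu
    exact mul_nonneg hc.le (by linarith)
  have hp : 0 < 1 - x := by linarith
  have hmapY : ∀ t, ((μ.map Y) (Set.Iic t)).toReal = 1 - μ.real {ω | t < Y ω} := by
    intro t
    have h := probReal_compl_eq_one_sub (μ := μ) (measurableSet_lt (measurable_const (a := t)) hY)
    rw [Measure.map_apply hY measurableSet_Iic, ← h]
    congr 2
    ext ω; simp
  have hmapX : ∀ t, ((μ.map X) (Set.Iic t)).toReal = 1 - μ.real {ω | t < X ω} := by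
    intro t
    have h := probReal_compl_eq_one_sub (μ := μ) (measurableSet_lt (measurable_const (a := t)) hX)
    rw [Measure.map_apply hX measurableSet_Iic, ← h]
    congr 2
    ext ω; simp
  haveI : IsProbabilityMeasure (μ.map Y) := Measure.isProbabilityMeasure_map hY.aemeasurable
  have hne : ∀ s < (1 : ℝ), {t : ℝ | s ≤ ((μ.map Y) (Set.Iic t)).toReal}.Nonempty := by
    intro s hs
    have h := ProbabilityTheory.tendsto_cdf_atTop (μ.map Y)
    obtain ⟨t, ht⟩ := (h.eventually (lt_mem_nhds hs)).exists
    rw [ProbabilityTheory.cdf_eq_real] at ht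
    exact ⟨t, ht.le⟩
  by_contra hcon
  push Not at hcon
  obtain ⟨t, ht1, ht2⟩ := exists_between hcon
  have htc : c < t := by nlinarith
  have hXt : 1 - x < μ.real {ω | t < X ω} := by
    have hbdd : BddBelow {t : ℝ | x ≤ ((μ.map X) (Set.Iic t)).toReal} := by
      by_contra hb
      have h0 : quantile (μ.map X) x = 0 := Real.sInf_of_not_bddBelow hb
      linarith
    have h := notMem_of_lt_csInf ht2 hbdd
    simp only [mem_setOf_eq, not_le, hmapX] at h
    linarith
  have hmono : ∀ r s, r ≤ s → μ.real {ω | c + s < Y ω} ≤ μ.real {ω | c + r < Y ω} := by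
    intro r s hrs
    refine measureReal_mono ?_ (measure_ne_top _ _)
    intro ω hω
    simp only [mem_setOf_eq] at hω ⊢
    linarith
  have hm := hmaj 1 (c + 1) one_pos
  have e : ∀ y : ℝ, 1 * (y - (c + 1)) + 1 = y - c := fun y => by ring
  simp only [e] at hm
  have hlow : ENNReal.ofReal ((t - c) * μ.real {ω | t < X ω}) ≤
      ∫⁻ ω, ENNReal.ofReal (max 0 (X ω - c)) ∂μ := by
    rw [ENNReal.ofReal_mul (by linarith), ofReal_measureReal]
    refine le_trans ?_ (mul_meas_ge_le_lintegral (μ := μ) (f := fun ω => ENNReal.ofReal (max 0 (X ω - c))) (by fun_prop) (ENNReal.ofReal (t - c)))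
    gcongr
    rename_i ω
    intro h
    exact ENNReal.ofReal_le_ofReal (le_max_of_le_right (by linarith))
  have hup : ∫⁻ ω, ENNReal.ofReal (max 0 (Y ω - c)) ∂μ ≤
      ENNReal.ofReal ((1 - x) * (c * (W - 1))) := by
    rw [lintegral_eq_lintegral_meas_lt μ (f := fun ω => max 0 (Y ω - c)) (Filter.Eventually.of_forall fun ω => le_max_left _ _)
      (by fun_prop)]
    have h1 : ∀ r ∈ Set.Ioi (0 : ℝ), μ {ω | r < max 0 (Y ω - c)} =
        ENNReal.ofReal (1 - x) * ENNReal.ofReal (μ.real {ω | c + r < Y ω} / (1 - x)) := by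
      intro r hr
      rw [← ENNReal.ofReal_mul hp.le, mul_div_cancel₀ _ hp.ne', ofReal_measureReal]
      congr 1
      ext ω
      simp only [mem_setOf_eq, lt_max_iff]
      constructor
      · rintro (h | h)
        · exact absurd h (not_lt.2 (le_of_lt hr))
        · linarith
      · intro h; right; linarith
    have hDm : Measurable (fun r => μ.real {ω | c + r < Y ω} / (1 - x)) := by
      apply Measurable.div_const
      exact Antitone.measurable (fun r s h => hmono r s h)
    rw [setLIntegral_congr_fun measurableSet_Ioi h1,
      lintegral_const_mul _ hDm.ennreal_ofReal, ENNReal.ofReal_mul hp.le]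
    gcongr
    rw [lintegral_eq_lintegral_meas_lt _ (f := fun r => μ.real {ω | c + r < Y ω} / (1 - x)) (Filter.Eventually.of_forall fun r =>
      div_nonneg measureReal_nonneg hp.le) hDm.aemeasurable]
    have hD1 : ∀ r, 0 < r → μ.real {ω | c + r < Y ω} / (1 - x) ≤ 1 := by
      intro r hr
      have hlt : quantile (μ.map Y) x < c + r := by linarith
      obtain ⟨y, hy, hyr⟩ := exists_lt_of_csInf_lt (hne x hx1) hlt
      simp only [mem_setOf_eq, hmapY] at hy
      have h := hmono (y - c) r (by linarith)
      have e2 : c + (y - c) = y := by ring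
      rw [e2] at h
      rw [div_le_one hp]
      linarith
    have hkey : ∀ d ∈ Set.Ioi (0 : ℝ),
        (volume.restrict (Set.Ioi (0 : ℝ))) {r | d < μ.real {ω | c + r < Y ω} / (1 - x)} ≤
        (Set.Ioo (0 : ℝ) 1).indicator (fun u => ENNReal.ofReal (c * (w u - 1))) d := by
      intro d hd
      have hd0 : 0 < d := hd
      rw [Measure.restrict_apply (measurableSet_lt measurable_const hDm)]
      by_cases hd1 : d < 1
      · rw [indicator_of_mem (show d ∈ Set.Ioo (0 : ℝ) 1 from ⟨hd, hd1⟩)]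
        have hs : {r | d < μ.real {ω | c + r < Y ω} / (1 - x)} ∩ Set.Ioi 0 ⊆
            Set.Ioc 0 (c * (w d - 1)) := by
          rintro r ⟨hr, hr0⟩
          refine ⟨hr0, ?_⟩
          simp only [mem_setOf_eq] at hr
          rw [lt_div_iff₀ hp] at hr
          have hu : 1 - d * (1 - x) ∈ Set.Ioo (0 : ℝ) 1 := by
            constructor <;> nlinarith
          have hq : c + r ≤ quantile (μ.map Y) (1 - d * (1 - x)) := by
            apply le_csInf (hne _ hu.2)
            intro y hy
            simp only [mem_setOf_eq, hmapY] at hy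
            by_contra hlt
            have h := hmono (y - c) r (by linarith)
            have e2 : c + (y - c) = y := by ring
            rw [e2] at h
            linarith
          have h2 := hH _ hu
          have h3 := hcomp x ⟨hx0, hx1⟩ d ⟨hd, hd1⟩
          rw [← hcdef] at h3
          nlinarith
        refine (measure_mono hs).trans ?_
        rw [Real.volume_Ioc, sub_zero]
      · have hs : {r | d < μ.real {ω | c + r < Y ω} / (1 - x)} ∩ Set.Ioi 0 = ∅ := by
          ext r
          simp only [mem_inter_iff, mem_setOf_eq, mem_Ioi, mem_empty_iff_false, iff_false, not_and]
          intro h h'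
          have := hD1 r h'
          linarith
        rw [hs]; simp
    refine (setLIntegral_mono' measurableSet_Ioi hkey).trans ?_
    refine (setLIntegral_le_lintegral _ _).trans ?_
    rw [lintegral_indicator measurableSet_Ioo, ← hsub, ofReal_integral_eq_lintegral_ofReal hint]
    refine (ae_restrict_iff' measurableSet_Ioo).2 (Filter.Eventually.of_forall fun u hu => ?_)
    have := hw1 u hu
    exact mul_nonneg hc.le (by linarith)
  have hfin := (hlow.trans hm).trans hup
  rw [ENNReal.ofReal_le_ofReal_iff (mul_nonneg hp.le hW1)] at hfin
  have h5 : (t - c) * (1 - x) < (t - c) * μ.real {ω | t < X ω} :=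
    mul_lt_mul_of_pos_left hXt (by linarith)
  have h6 : c * (W - 1) < t - c := by linarith
  have h7 := mul_lt_mul_of_pos_left h6 hp
  linarith
end

section
/- Let X and Y be real valued random variables such that 𝔼 max{0,Y} < ∞ and 𝔼 φ(X) ≤ 𝔼 φ(Y) for every function φ of the form φ(x) = max{0, a(x−t) + 1} with a ∈ (0,∞) and t ∈ ℝ. Suppose T, γ ≥ 1, p > 1, and Q: (0,∞) → (0,∞) is a function satisfying Q(t)·exp(−t²/(2p)) ≤ T·Q(s)·exp(−s²/(2p)) for all 0 < s < t. If ℙ{Y > Q(t)} < γ·exp(−t²/2) for all t > 0, then ℙ{X > (pT/(p−1))·Q(t)} ≤ γ·exp(−t²/2) for all t > 0. -/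
open MeasureTheory Set

theorem aux_int_s6 (c p : ℝ) (hc : 0 < c) (hcp : c = p - 1) :
    ∫⁻ s in Ioi (0:ℝ), ENNReal.ofReal ((1 + s / c) ^ (-p)) = 1 := by
  have hd : ∀ x ∈ Ici (0:ℝ), HasDerivAt (fun s : ℝ => -((1 + s / c) ^ (-c))) ((1 + x / c) ^ (-p)) x := by
    intro x hx
    have hx0 : (0:ℝ) ≤ x := hx
    have h1 : 0 < 1 + x / c := by positivity
    have h2 : HasDerivAt (fun s : ℝ => 1 + s / c) (1 / c) x :=
      ((hasDerivAt_id x).div_const c).const_add 1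
    have h3 := (h2.rpow_const (p := -c) (Or.inl h1.ne')).neg
    have h4 : -(1 / c * -c * (1 + x / c) ^ (-c - 1)) = (1 + x / c) ^ (-p) := by
      rw [show -c - 1 = -p by rw [hcp]; ring]
      field_simp
    rw [h4] at h3
    exact h3
  have hnn : ∀ x ∈ Ioi (0:ℝ), 0 ≤ (1 + x / c) ^ (-p) := by
    intro x hx
    have hx0 : (0:ℝ) < x := hx
    positivity
  have ht : Filter.Tendsto (fun s : ℝ => -((1 + s / c) ^ (-c))) Filter.atTop (nhds 0) := by
    have h1 : Filter.Tendsto (fun s : ℝ => 1 + s / c) Filter.atTop Filter.atTop :=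
      Filter.tendsto_atTop_add_const_left _ _ (Filter.tendsto_id.atTop_div_const hc)
    have := ((tendsto_rpow_neg_atTop hc).comp h1).neg
    simpa [Function.comp_def] using this
  have hI := integrableOn_Ioi_deriv_of_nonneg' hd hnn ht
  have hV := integral_Ioi_of_hasDerivAt_of_nonneg' hd hnn ht
  rw [← ofReal_integral_eq_lintegral_ofReal hI, hV]
  · simp
  · exact (ae_restrict_iff' measurableSet_Ioi).2 (Filter.Eventually.of_forall hnn)

/-- Under convex majorization of `X` by `Y` through the family
`φ(x) = max{0, a(x−t)+1}` and `𝔼 max{0,Y} < ∞`: if `T, γ ≥ 1`, `p > 1` and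
`Q : (0,∞) → (0,∞)` satisfies `Q(t)·exp(−t²/(2p)) ≤ T·Q(s)·exp(−s²/(2p))` for `0 < s < t`,
and `ℙ{Y > Q(t)} < γ·exp(−t²/2)` for all `t > 0`, then
`ℙ{X > (pT/(p−1))·Q(t)} ≤ γ·exp(−t²/2)` for all `t > 0`. -/
theorem stmt_6 {Ω : Type*} [MeasurableSpace Ω] (μ : Measure Ω) [IsProbabilityMeasure μ]
    (X Y : Ω → ℝ) (hX : Measurable X) (hY : Measurable Y)
    (hYint : ∫⁻ ω, ENNReal.ofReal (max 0 (Y ω)) ∂μ < ⊤)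
    (hmaj : ∀ a t : ℝ, 0 < a →
      (∫⁻ ω, ENNReal.ofReal (max 0 (a * (X ω - t) + 1)) ∂μ) ≤
        ∫⁻ ω, ENNReal.ofReal (max 0 (a * (Y ω - t) + 1)) ∂μ)
    (T γ p : ℝ) (hT : 1 ≤ T) (hγ : 1 ≤ γ) (hp : 1 < p)
    (Q : ℝ → ℝ) (hQpos : ∀ t : ℝ, 0 < t → 0 < Q t)
    (hQ : ∀ s t : ℝ, 0 < s → s < t →
      Q t * Real.exp (-t ^ 2 / (2 * p)) ≤ T * Q s * Real.exp (-s ^ 2 / (2 * p)))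
    (hYtail : ∀ t : ℝ, 0 < t →
      μ {ω | Q t < Y ω} < ENNReal.ofReal (γ * Real.exp (-t ^ 2 / 2))) :
    ∀ t : ℝ, 0 < t →
      μ {ω | p * T / (p - 1) * Q t < X ω} ≤ ENNReal.ofReal (γ * Real.exp (-t ^ 2 / 2)) := by
  intro t ht
  obtain ⟨c, hcp⟩ : ∃ c, c = p - 1 := ⟨_, rfl⟩
  have hc : 0 < c := by linarith
  have hp0 : 0 < p := by linarith
  have hq := hQpos t ht
  obtain ⟨m, hm⟩ : ∃ m, m = T * Q t := ⟨_, rfl⟩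
  have hm0 : 0 < m := by rw [hm]; positivity
  have hx : p * T / (p - 1) * Q t = m + m / c := by
    rw [← hcp, hm]
    field_simp
    rw [hcp]; ring
  rw [hx]
  have hac : ∀ z : ℝ, c / m * (z - (m + m / c)) + 1 = c / m * (z - m) := by
    intro z
    field_simp
    ring
  have hM := hmaj (c / m) (m + m / c) (by positivity)
  simp only [hac] at hM
  have hL : μ {ω | m + m / c < X ω} ≤ ∫⁻ ω, ENNReal.ofReal (max 0 (c / m * (X ω - m))) ∂μ := by
    have hms : MeasurableSet {ω | m + m / c < X ω} := measurableSet_lt measurable_const hX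
    rw [← lintegral_indicator_one hms]
    apply lintegral_mono
    intro ω
    by_cases h : m + m / c < X ω
    · have : 1 ≤ c / m * (X ω - m) := by
        have h2 : m / c ≤ X ω - m := by linarith
        calc (1:ℝ) = c / m * (m / c) := by field_simp
          _ ≤ _ := by gcongr
      simp only [indicator, mem_ofPred_eq, h, if_true, Pi.one_apply]
      rw [← ENNReal.ofReal_one]
      exact ENNReal.ofReal_le_ofReal (this.trans (le_max_right _ _))
    · simp [indicator, h]
  refine hL.trans (hM.trans ?_)
  rw [lintegral_eq_lintegral_meas_lt μ (f := fun ω => max 0 (c / m * (Y ω - m)))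
    (Filter.Eventually.of_forall fun ω => le_max_left _ _)
    (by fun_prop)]
  have hδ : 0 ≤ γ * Real.exp (-t ^ 2 / 2) := by positivity
  calc _ ≤ ∫⁻ s in Ioi (0:ℝ), ENNReal.ofReal (γ * Real.exp (-t ^ 2 / 2)) *
          ENNReal.ofReal ((1 + s / c) ^ (-p)) := by
        apply setLIntegral_mono' measurableSet_Ioi
        intro s hs
        have hs0 : (0:ℝ) < s := hs
        have h1 : 1 < 1 + s / c := by
          have : 0 < s / c := by positivity
          linarith
        have hlog := Real.log_pos h1
        have hexp := Real.exp_log (zero_lt_one.trans h1)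
        obtain ⟨L, hLd⟩ : ∃ L, L = Real.log (1 + s / c) := ⟨_, rfl⟩
        rw [← hLd] at hlog hexp
        obtain ⟨r, hr⟩ : ∃ r, r = Real.sqrt (t ^ 2 + 2 * p * L) := ⟨_, rfl⟩
        have hr2 : r ^ 2 = t ^ 2 + 2 * p * L := by
          rw [hr]; exact Real.sq_sqrt (by positivity)
        have htr : t < r := by
          rw [hr]
          apply Real.lt_sqrt_of_sq_lt
          have : 0 < 2 * p * L := by positivity
          linarith
        have hQr : Q r ≤ m * (1 + s / c) := by
          have h := hQ t r ht htr
          rw [← hm] at h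
          have e : Real.exp (-t ^ 2 / (2 * p)) = (1 + s / c) * Real.exp (-r ^ 2 / (2 * p)) := by
            rw [← hexp, ← Real.exp_add, hr2]
            congr 1
            field_simp
            ring
          rw [e, ← mul_assoc] at h
          exact le_of_mul_le_mul_right h (Real.exp_pos _)
        have e2 : Real.exp (-r ^ 2 / 2) = Real.exp (-t ^ 2 / 2) * (1 + s / c) ^ (-p) := by
          rw [Real.rpow_def_of_pos (zero_lt_one.trans h1), ← hLd, ← Real.exp_add, hr2]
          congr 1
          ring
        rw [← ENNReal.ofReal_mul hδ, mul_assoc, ← e2]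
        refine le_trans (measure_mono ?_) (hYtail r (ht.trans htr)).le
        intro ω hω
        have hω' : s < max 0 (c / m * (Y ω - m)) := hω
        have h3 : s < c / m * (Y ω - m) := by
          rcases lt_max_iff.1 hω' with h | h
          · linarith
          · exact h
        refine lt_of_le_of_lt hQr ?_
        have h4 : s * m < c * (Y ω - m) := by
          rw [div_mul_eq_mul_div, lt_div_iff₀ hm0] at h3
          exact h3
        have h5 : m * (1 + s / c) = m + s * m / c := by field_simp
        have h6 : s * m / c < Y ω - m := by
          rw [div_lt_iff₀ hc]; linarith
        linarith
    _ = _ := by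
        rw [lintegral_const_mul' _ _ ENNReal.ofReal_ne_top, aux_int_s6 c p hc hcp, mul_one]
end

section
/- On the probability space ((0,1), Borel sets, Lebesgue measure), define Y(x) = x^{-1}(log(e/x))^{-2} for x ∈ (0,1). For each n ∈ ℕ let E_n = {x ∈ (0,1) : e^{−n²} ≤ x < e^{−(n−1)²}}, let 𝒯 be the sigma algebra generated by {E_n : n ∈ ℕ}, and let X = 𝔼(Y | 𝒯). Then 𝔼|Y| < ∞, for every convex φ: ℝ → ℝ one has 𝔼 φ(X) ≤ 𝔼 φ(Y), and yet limsup_{x→1⁻} H_X(x)/H_Y(x) = ∞, where H_X and H_Y are the quantile functions of X and Y respectively. -/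
open MeasureTheory Set Filter

lemma convex_affine (φ : ℝ → ℝ) (h : ConvexOn ℝ Set.univ φ) : ∃ c d : ℝ, ∀ x, c * x + d ≤ φ x := by
  obtain ⟨c, d, h1, -⟩ := h.exists_affine_le_of_lt_real (mem_univ (0:ℝ)) (sub_one_lt (φ 0)) isClosed_univ
    (h.continuousOn isOpen_univ).lowerSemicontinuousOn
  exact ⟨c, d, fun x => by simpa using h1 x (mem_univ x)⟩

lemma neg_fin {μ : Measure ℝ} [IsFiniteMeasure μ] (φ : ℝ → ℝ) (h : ConvexOn ℝ Set.univ φ) {X : ℝ → ℝ}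
    (hX : Integrable X μ) : (∫⁻ x, ENNReal.ofReal (-(φ (X x))) ∂μ) ≠ ⊤ := by
  obtain ⟨c, d, hcd⟩ := convex_affine φ h
  have hi : Integrable (fun x => -(c * X x + d)) μ := ((hX.const_mul c).add (integrable_const d)).neg
  refine ne_top_of_le_ne_top hi.lintegral_lt_top.ne (lintegral_mono fun x => ?_)
  exact ENNReal.ofReal_le_ofReal (neg_le_neg (hcd _))

lemma int_of_parts {μ : Measure ℝ} {f : ℝ → ℝ} (hf : AEStronglyMeasurable f μ)
    (hp : (∫⁻ x, ENNReal.ofReal (f x) ∂μ) ≠ ⊤) (hn : (∫⁻ x, ENNReal.ofReal (-(f x)) ∂μ) ≠ ⊤) :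
    Integrable f μ := by
  refine ⟨hf, ?_⟩
  rw [hasFiniteIntegral_iff_norm]
  calc _ ≤ ∫⁻ x, (ENNReal.ofReal (f x) + ENNReal.ofReal (-(f x))) ∂μ := by
        refine lintegral_mono fun x => ?_
        rcases le_total 0 (f x) with hp | hp
        · simp [abs_of_nonneg hp]
        · simp [abs_of_nonpos hp]
    _ = _ := lintegral_add_left' hf.aemeasurable.ennreal_ofReal _
    _ < ⊤ := ENNReal.add_lt_top.2 ⟨lt_top_iff_ne_top.2 hp, lt_top_iff_ne_top.2 hn⟩

lemma jensen_ext {μ : Measure ℝ} [IsFiniteMeasure μ] (m : MeasurableSpace ℝ) (hm' : m ≤ Real.measurableSpace)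
    (φ : ℝ → ℝ) (h : ConvexOn ℝ Set.univ φ) {Y : ℝ → ℝ} (hY : Integrable Y μ) :
    (∫⁻ x, ENNReal.ofReal (φ (μ[Y|m] x)) ∂μ) + (∫⁻ x, ENNReal.ofReal (-(φ (Y x))) ∂μ) ≤
        (∫⁻ x, ENNReal.ofReal (φ (Y x)) ∂μ) + (∫⁻ x, ENNReal.ofReal (-(φ (μ[Y|m] x))) ∂μ) := by
  have hcont : Continuous φ := continuousOn_univ.1 (h.continuousOn isOpen_univ)
  have nX := neg_fin φ h (integrable_condExp (μ := μ) (m := m) (f := Y))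
  have nY := neg_fin φ h hY
  by_cases hI : Integrable (φ ∘ Y) μ
  · have hJ := h.map_condExp_le_of_finiteDimensional hm' hY hI
    obtain ⟨c, d, hcd⟩ := convex_affine φ h
    have hXI : Integrable (fun x => φ (μ[Y|m] x)) μ := by
      refine integrable_of_le_of_le (hcont.comp_aestronglyMeasurable integrable_condExp.1)
        (Eventually.of_forall fun x => hcd _) hJ
        ((integrable_condExp.const_mul c).add (integrable_const d)) integrable_condExp
    have h1 : ∫ x, φ (μ[Y|m] x) ∂μ ≤ ∫ x, φ (Y x) ∂μ := by
      refine (integral_mono_ae hXI integrable_condExp hJ).trans ?_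
      rw [integral_condExp hm']; rfl
    rw [integral_eq_lintegral_pos_part_sub_lintegral_neg_part hXI,
      integral_eq_lintegral_pos_part_sub_lintegral_neg_part (f := fun x => φ (Y x)) hI] at h1
    have pX := hXI.lintegral_lt_top.ne
    have pY := Integrable.lintegral_lt_top (f := fun x => φ (Y x)) hI |>.ne
    rw [← ENNReal.toReal_le_toReal (ENNReal.add_ne_top.2 ⟨pX, nY⟩) (ENNReal.add_ne_top.2 ⟨pY, nX⟩),
      ENNReal.toReal_add pX nY, ENNReal.toReal_add pY nX]
    linarith
  · have : (∫⁻ x, ENNReal.ofReal (φ (Y x)) ∂μ) = ⊤ := by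
      by_contra hne
      apply hI
      exact int_of_parts (f := φ ∘ Y) (hcont.comp_aestronglyMeasurable hY.1) hne nY
    rw [this]; simp

noncomputable def Yf : ℝ → ℝ := fun x => x⁻¹ * (Real.log (Real.exp 1 / x) ^ 2)⁻¹

lemma Yf_eq {x : ℝ} (hx : 0 < x) : Yf x = x⁻¹ * ((1 - Real.log x) ^ 2)⁻¹ := by
  unfold Yf; rw [Real.log_div (Real.exp_pos 1).ne' hx.ne', Real.log_exp]

lemma Yf_meas : Measurable Yf := by unfold Yf; fun_prop

lemma Yf_nonneg {x : ℝ} (hx : 0 ≤ x) : 0 ≤ Yf x := by unfold Yf; positivity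

lemma Yf_le {u x : ℝ} (hu : 0 < u) (hux : u ≤ x) (hx : x ≤ 1) : Yf x ≤ 4 * Yf u := by
  have hx0 : 0 < x := hu.trans_le hux
  rw [Yf_eq hu, Yf_eq hx0]
  have hlx : Real.log x ≤ 0 := Real.log_nonpos hx0.le hx
  have hll : Real.log u ≤ Real.log x := Real.log_le_log hu hux
  set p := Real.log x with hp
  set P := Real.log u with hP
  have e1 : x = Real.exp p := (Real.exp_log hx0).symm
  have e2 : u = Real.exp P := (Real.exp_log hu).symm
  have h1 : 1 + (p - P) / 2 ≤ Real.exp ((p - P) / 2) := by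
    linarith [Real.add_one_le_exp ((p - P) / 2)]
  have h2 : (1 - P) / 2 ≤ Real.exp ((p - P) / 2) * (1 - p) := by nlinarith
  have h3 : ((1 - P) / 2) ^ 2 ≤ (Real.exp ((p - P) / 2) * (1 - p)) ^ 2 :=
    pow_le_pow_left₀ (by linarith) h2 2
  have h4 : (Real.exp ((p - P) / 2)) ^ 2 = x * u⁻¹ := by
    rw [← Real.exp_nat_mul, e1, e2, ← Real.exp_neg, ← Real.exp_add]; congr 1; push_cast; ring
  rw [mul_pow, h4] at h3
  have q1 : 0 < 1 - p := by linarith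
  have q2 : 0 < 1 - P := by linarith
  have h5 : u * (1 - P) ^ 2 ≤ 4 * (x * (1 - p) ^ 2) := by
    have := mul_le_mul_of_nonneg_left h3 hu.le
    have e : u * (x * u⁻¹ * (1 - p) ^ 2) = x * (1 - p) ^ 2 := by field_simp
    rw [e] at this; nlinarith
  rw [← mul_inv, ← mul_inv, ← div_eq_mul_inv, inv_eq_one_div, div_le_div_iff₀ (by positivity) (by positivity)]
  linarith

lemma Yf_ge {x : ℝ} (hx : 0 < x) (hx1 : x ≤ 1) : 1 / 4 ≤ Yf x := by
  have := Yf_le hx hx1 le_rfl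
  have h1 : Yf 1 = 1 := by rw [Yf_eq one_pos]; simp
  linarith

lemma Yf_deriv {x : ℝ} (hx : 0 < x) (hx1 : x ≤ 1) :
    HasDerivAt (fun x => (1 - Real.log x)⁻¹) (Yf x) x := by
  have hl := Real.log_nonpos hx.le hx1
  have := ((Real.hasDerivAt_log hx.ne').const_sub 1).fun_inv (by linarith)
  have e : Yf x = - -x⁻¹ / (1 - Real.log x) ^ 2 := by
    rw [Yf_eq hx, neg_neg, div_eq_mul_inv]
  rw [e]; exact this

lemma Yf_int {a b : ℝ} (ha : 0 < a) (hab : a ≤ b) (hb : b ≤ 1) :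
    IntervalIntegrable Yf volume a b ∧
    ∫ x in a..b, Yf x = (1 - Real.log b)⁻¹ - (1 - Real.log a)⁻¹ := by
  have hsub : ∀ x ∈ uIcc a b, 0 < x ∧ x ≤ 1 := by
    intro x hx; rw [uIcc_of_le hab] at hx; exact ⟨ha.trans_le hx.1, hx.2.trans hb⟩
  have hI : IntervalIntegrable Yf volume a b := by
    apply ContinuousOn.intervalIntegrable
    have : ContinuousOn (fun x => x⁻¹ * ((1 - Real.log x) ^ 2)⁻¹) (uIcc a b) := by
      intro x hx
      obtain ⟨h0, h1⟩ := hsub x hx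
      have hl := Real.log_nonpos h0.le h1
      have hl2 : (1 - Real.log x) ^ 2 ≠ 0 := by
        have : 0 < 1 - Real.log x := by linarith
        positivity
      apply ContinuousAt.continuousWithinAt
      have := Real.continuousAt_log h0.ne'
      exact (continuousAt_inv₀ h0.ne').mul (((continuousAt_const.sub this).pow 2).inv₀ hl2)
    exact this.congr fun x hx => Yf_eq (hsub x hx).1
  exact ⟨hI, intervalIntegral.integral_eq_sub_of_hasDerivAt
    (fun x hx => Yf_deriv (hsub x hx).1 (hsub x hx).2) hI⟩

lemma Yf_integrable : Integrable Yf (volume.restrict (Ioo (0:ℝ) 1)) := by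
  have : IntegrableOn Yf (Ioc 0 1) := by
    have key : ∀ n : ℕ, (0:ℝ) < 1 / ((n:ℝ) + 1) ∧ 1 / ((n:ℝ) + 1) ≤ 1 := fun n =>
      ⟨by positivity, by rw [div_le_one (by positivity)]; linarith [n.cast_nonneg (α := ℝ)]⟩
    refine integrableOn_Ioc_of_intervalIntegral_norm_bounded_left (I := 1) (l := atTop)
      (a := fun n : ℕ => 1 / ((n:ℝ) + 1)) (fun n => ?_) tendsto_one_div_add_atTop_nhds_zero_nat
      (Eventually.of_forall fun n => ?_)
    · exact (intervalIntegrable_iff_integrableOn_Ioc_of_le (key n).2).1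
        (Yf_int (key n).1 (key n).2 le_rfl).1
    · have : ∫ x in Ioc (1 / ((n:ℝ) + 1)) 1, ‖Yf x‖ = ∫ x in Ioc (1 / ((n:ℝ) + 1)) 1, Yf x := by
        refine setIntegral_congr_fun measurableSet_Ioc fun x hx => ?_
        exact Real.norm_of_nonneg (Yf_nonneg ((key n).1.trans hx.1).le)
      rw [this, ← intervalIntegral.integral_of_le (key n).2, (Yf_int (key n).1 (key n).2 le_rfl).2]
      have hl := Real.log_nonpos (key n).1.le (key n).2
      have : 0 ≤ (1 - Real.log (1 / ((n:ℝ) + 1)))⁻¹ := inv_nonneg.2 (by linarith)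
      simp only [Real.log_one, sub_zero, inv_one]; linarith
  exact this.mono_set Ioo_subset_Ioc_self

abbrev TT : MeasurableSpace ℝ := MeasurableSpace.generateFrom
      {s : Set ℝ | ∃ n : ℕ, 1 ≤ n ∧
        s = Set.Ico (Real.exp (-(n : ℝ) ^ 2)) (Real.exp (-((n : ℝ) - 1) ^ 2))}

abbrev EE (k : ℕ) : Set ℝ := Ico (Real.exp (-((k:ℝ) + 1) ^ 2)) (Real.exp (-(k:ℝ) ^ 2))

lemma TT_le : TT ≤ Real.measurableSpace := by
  apply MeasurableSpace.generateFrom_le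
  rintro s ⟨n, -, rfl⟩
  exact measurableSet_Ico

lemma EE_meas (k : ℕ) : MeasurableSet[TT] (EE k) := by
  apply MeasurableSpace.measurableSet_generateFrom
  exact ⟨k + 1, by omega, by push_cast; simp [EE]⟩

lemma EE_disj {j k : ℕ} {x : ℝ} (hj : x ∈ EE j) (hk : x ∈ EE k) : j = k := by
  by_contra hne
  wlog h : j < k generalizing j k
  · exact this hk hj (Ne.symm hne) (by omega)
  have h1 : (j:ℝ) + 1 ≤ k := by exact_mod_cast h
  have h2 := hj.1.trans_lt hk.2
  rw [Real.exp_lt_exp] at h2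
  nlinarith [j.cast_nonneg (α := ℝ)]

lemma TT_atom (k : ℕ) (s : Set ℝ) (hs : MeasurableSet[TT] s) : EE k ⊆ s ∨ Disjoint (EE k) s := by
  induction s, hs using MeasurableSpace.generateFrom_induction with
  | hC t ht _ =>
    obtain ⟨n, hn, rfl⟩ := ht
    obtain ⟨j, rfl⟩ := Nat.exists_eq_add_of_le' hn
    have e : Set.Ico (Real.exp (-((j + 1 : ℕ) : ℝ) ^ 2)) (Real.exp (-(((j + 1 : ℕ) : ℝ) - 1) ^ 2)) = EE j := by
      push_cast; simp [EE]
    rw [e]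
    by_cases h : k = j
    · left; rw [h]
    · right; exact Set.disjoint_left.2 fun x hx hx' => h (EE_disj hx hx')
  | empty => right; simp
  | compl t _ ih =>
    rcases ih with h | h
    · right; exact disjoint_compl_right_iff_subset.2 h
    · left; exact h.subset_compl_right
  | iUnion f _ ih =>
    by_cases h : ∃ i, EE k ⊆ f i
    · obtain ⟨i, hi⟩ := h
      left; exact hi.trans (subset_iUnion f i)
    · push Not at h
      right; exact disjoint_iUnion_right.2 fun i => (ih i).resolve_left (h i)

noncomputable def BB (k : ℕ) : ℝ :=
  Real.exp ((k:ℝ) ^ 2) * ((2 * k + 1) / ((1 + (k:ℝ) ^ 2) * (1 + ((k:ℝ) + 1) ^ 2)))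

lemma BB_pos (k : ℕ) : 0 < BB k := by unfold BB; positivity

lemma BB_succ (k : ℕ) (hk : 1 ≤ k) : BB k ≤ BB (k + 1) := by
  unfold BB
  have h1 : (1:ℝ) ≤ k := by exact_mod_cast hk
  have e : Real.exp (((k + 1 : ℕ):ℝ) ^ 2) = Real.exp ((k:ℝ) ^ 2) * Real.exp (2 * k + 1) := by
    rw [← Real.exp_add]; congr 1; push_cast; ring
  have h5 : 5 ≤ Real.exp (2 * (k:ℝ) + 1) := by
    have := Real.quadratic_le_exp_of_nonneg (x := 2 * (k:ℝ) + 1) (by linarith)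
    nlinarith
  rw [e, mul_assoc]
  apply mul_le_mul_of_nonneg_left _ (Real.exp_pos _).le
  calc (2 * (k:ℝ) + 1) / ((1 + (k:ℝ) ^ 2) * (1 + ((k:ℝ) + 1) ^ 2))
      ≤ 5 * ((2 * ((k + 1 : ℕ):ℝ) + 1) / ((1 + ((k + 1 : ℕ):ℝ) ^ 2) * (1 + (((k + 1 : ℕ):ℝ) + 1) ^ 2))) := by
        push_cast
        rw [← mul_div_assoc, div_le_div_iff₀ (by positivity) (by positivity)]
        have : 1 + ((k:ℝ) + 1 + 1) ^ 2 ≤ 5 * (1 + (k:ℝ) ^ 2) := by nlinarith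
        have h6 : (2 * (k:ℝ) + 1) * (1 + ((k:ℝ) + 1 + 1) ^ 2) ≤ (2 * ((k:ℝ) + 1) + 1) * (5 * (1 + (k:ℝ) ^ 2)) := by
          apply mul_le_mul _ this (by positivity) (by positivity); linarith
        have := mul_le_mul_of_nonneg_right h6 (show 0 ≤ 1 + ((k:ℝ) + 1) ^ 2 by positivity)
        linarith
    _ ≤ _ := mul_le_mul_of_nonneg_right h5 (by positivity)

lemma BB_mono {j k : ℕ} (hj : 1 ≤ j) (hjk : j ≤ k) : BB j ≤ BB k := by
  induction k, hjk using Nat.le_induction with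
  | base => exact le_rfl
  | succ n hn ih => exact ih.trans (BB_succ n (hj.trans hn))

lemma EE_sub (k : ℕ) : EE k ⊆ Ioo 0 1 := by
  intro x hx
  refine ⟨(Real.exp_pos _).trans_le hx.1, hx.2.trans_le ?_⟩
  rw [Real.exp_le_one_iff]; nlinarith [sq_nonneg (k:ℝ)]

lemma EE_lt (k : ℕ) : Real.exp (-((k:ℝ) + 1) ^ 2) < Real.exp (-(k:ℝ) ^ 2) := by
  rw [Real.exp_lt_exp]; nlinarith [k.cast_nonneg (α := ℝ)]

lemma EE_Y (k : ℕ) : ∫ x in EE k, Yf x ∂(volume.restrict (Ioo (0:ℝ) 1)) =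
    (2 * k + 1) / ((1 + (k:ℝ) ^ 2) * (1 + ((k:ℝ) + 1) ^ 2)) := by
  rw [Measure.restrict_restrict measurableSet_Ico, inter_eq_left.2 (EE_sub k),
    integral_Ico_eq_integral_Ioo, ← integral_Ioc_eq_integral_Ioo,
    ← intervalIntegral.integral_of_le (EE_lt k).le,
    (Yf_int (Real.exp_pos _) (EE_lt k).le ?_).2, Real.log_exp, Real.log_exp]
  · have : (1:ℝ) + (k:ℝ)^2 ≠ 0 := by positivity
    have : (1:ℝ) + ((k:ℝ) + 1)^2 ≠ 0 := by positivity
    rw [sub_neg_eq_add, sub_neg_eq_add]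
    field_simp; ring
  · rw [Real.exp_le_one_iff]; nlinarith [sq_nonneg (k:ℝ)]

noncomputable abbrev XX : ℝ → ℝ := (volume.restrict (Ioo (0:ℝ) 1))[Yf | TT]

lemma XX_meas_TT : Measurable[TT] XX := stronglyMeasurable_condExp.measurable

lemma XX_meas : Measurable XX := XX_meas_TT.mono TT_le le_rfl

lemma XX_ge (k : ℕ) {x : ℝ} (hx : x ∈ EE k) : BB k ≤ XX x := by
  by_contra hlt
  push Not at hlt
  have hS : MeasurableSet[TT] (XX ⁻¹' Iio (BB k)) := XX_meas_TT measurableSet_Iio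
  have hsub : EE k ⊆ XX ⁻¹' Iio (BB k) := (TT_atom k _ hS).resolve_right
    fun h => Set.disjoint_left.1 h hx hlt
  have h1 : ∫ x in EE k, XX x ∂(volume.restrict (Ioo (0:ℝ) 1)) = _ :=
    (setIntegral_condExp TT_le Yf_integrable (EE_meas k)).trans (EE_Y k)
  have hv : (volume.restrict (Ioo (0:ℝ) 1)) (EE k) = ENNReal.ofReal
      (Real.exp (-(k:ℝ) ^ 2) - Real.exp (-((k:ℝ) + 1) ^ 2)) := by
    rw [Measure.restrict_apply measurableSet_Ico, inter_eq_left.2 (EE_sub k), Real.volume_Ico]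
  have hpos : 0 < ∫ x in EE k, (BB k - XX x) ∂(volume.restrict (Ioo (0:ℝ) 1)) := by
    rw [setIntegral_pos_iff_support_of_nonneg_ae]
    · have : Function.support (fun x => BB k - XX x) ∩ EE k = EE k := by
        rw [inter_eq_right]
        intro y hy
        exact (sub_pos.2 (hsub hy)).ne'
      rw [this, hv, ENNReal.ofReal_pos]
      linarith [EE_lt k]
    · refine (ae_restrict_iff' measurableSet_Ico).2 (Eventually.of_forall fun y hy => ?_)
      exact (sub_pos.2 (hsub hy)).le
    · exact ((integrable_const _).sub integrable_condExp).integrableOn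
  rw [integral_sub (integrable_const _) integrable_condExp.integrableOn, h1, setIntegral_const,
    measureReal_def, hv, ENNReal.toReal_ofReal (by linarith [EE_lt k]), smul_eq_mul] at hpos
  have h2 : Real.exp (-(k:ℝ) ^ 2) * BB k = (2 * k + 1) / ((1 + (k:ℝ) ^ 2) * (1 + ((k:ℝ) + 1) ^ 2)) := by
    unfold BB
    rw [← mul_assoc, ← Real.exp_add]; simp
  have h3 := mul_pos (Real.exp_pos (-((k:ℝ) + 1) ^ 2)) (BB_pos k)
  linarith

lemma XX_ge' {m : ℕ} (hm : 1 ≤ m) {x : ℝ} (hx0 : 0 < x) (hx : x < Real.exp (-(m:ℝ) ^ 2)) :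
    BB m ≤ XX x := by
  have hex : ∃ k : ℕ, Real.exp (-((k:ℝ) + 1) ^ 2) ≤ x := by
    obtain ⟨k, hk⟩ := exists_nat_ge (-Real.log x)
    refine ⟨k, ?_⟩
    rw [← Real.le_log_iff_exp_le hx0]
    nlinarith [k.cast_nonneg (α := ℝ)]
  classical
  have h1 := Nat.find_spec hex
  have h2 : ∀ j, j < Nat.find hex → _ := fun j hj => Nat.find_min hex hj
  generalize Nat.find hex = k at h1 h2
  have hmk : m ≤ k := by
    by_contra hlt
    have h3 : (k:ℝ) + 1 ≤ m := by exact_mod_cast (not_le.1 hlt)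
    have h4 := h1.trans_lt hx
    rw [Real.exp_lt_exp] at h4
    nlinarith [k.cast_nonneg (α := ℝ)]
  refine (BB_mono hm hmk).trans (XX_ge k ⟨h1, ?_⟩)
  obtain ⟨j, rfl⟩ := Nat.exists_eq_add_of_le' (hm.trans hmk)
  have := h2 j (by omega)
  push_cast
  exact not_le.1 this

lemma qX {m : ℕ} (hm : 1 ≤ m) :
    BB m ≤ quantile ((volume.restrict (Ioo (0:ℝ) 1)).map XX) (1 - Real.exp (-(m:ℝ) ^ 2) / 2) := by
  have he := Real.exp_pos (-(m:ℝ) ^ 2)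
  have hprob : IsProbabilityMeasure (volume.restrict (Ioo (0:ℝ) 1)) := ⟨by simp⟩
  have hprob2 : IsProbabilityMeasure ((volume.restrict (Ioo (0:ℝ) 1)).map XX) :=
    Measure.isProbabilityMeasure_map XX_meas.aemeasurable
  unfold quantile
  apply le_csInf
  · have h1 := tendsto_measure_Iic_atTop ((volume.restrict (Ioo (0:ℝ) 1)).map XX)
    rw [measure_univ] at h1
    have h2 := (ENNReal.tendsto_toReal ENNReal.one_ne_top).comp h1
    have h3 := h2.eventually_const_le (u := 1 - Real.exp (-(m:ℝ) ^ 2) / 2) (by simp; positivity)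
    obtain ⟨t, ht⟩ := h3.exists
    exact ⟨t, ht⟩
  · intro t ht
    by_contra hlt
    push Not at hlt
    simp only [mem_setOf_eq] at ht
    rw [Measure.map_apply XX_meas measurableSet_Iic,
      Measure.restrict_apply (XX_meas measurableSet_Iic)] at ht
    have hsub : XX ⁻¹' Iic t ∩ Ioo 0 1 ⊆ Ico (Real.exp (-(m:ℝ) ^ 2)) 1 := by
      rintro x ⟨hx, hx0, hx1⟩
      refine ⟨?_, hx1⟩
      by_contra hc
      have := XX_ge' hm hx0 (not_le.1 hc)
      simp only [mem_preimage, mem_Iic] at hx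
      linarith
    have h1 := ENNReal.toReal_mono (by simp) (measure_mono (μ := volume) hsub)
    have hle : Real.exp (-(m:ℝ) ^ 2) ≤ 1 := by
      rw [Real.exp_le_one_iff]; nlinarith [sq_nonneg (m:ℝ)]
    rw [Real.volume_Ico, ENNReal.toReal_ofReal (by linarith)] at h1
    linarith

lemma qY {u : ℝ} (hu : 0 < u) (hu1 : u < 1) :
    1 / 4 ≤ quantile ((volume.restrict (Ioo (0:ℝ) 1)).map Yf) (1 - u) ∧
    quantile ((volume.restrict (Ioo (0:ℝ) 1)).map Yf) (1 - u) ≤ 4 * Yf u := by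
  have hlow : ∀ t ∈ {t : ℝ | 1 - u ≤ (((volume.restrict (Ioo (0:ℝ) 1)).map Yf) (Iic t)).toReal},
      1 / 4 ≤ t := by
    intro t ht
    by_contra hlt
    push Not at hlt
    simp only [mem_setOf_eq] at ht
    rw [Measure.map_apply Yf_meas measurableSet_Iic,
      Measure.restrict_apply (Yf_meas measurableSet_Iic)] at ht
    have : Yf ⁻¹' Iic t ∩ Ioo 0 1 = ∅ := by
      rw [eq_empty_iff_forall_notMem]
      rintro x ⟨hx, hx0, hx1⟩
      have := Yf_ge hx0 hx1.le
      simp only [mem_preimage, mem_Iic] at hx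
      linarith
    rw [this] at ht
    simp at ht
    linarith
  have hmem : 4 * Yf u ∈
      {t : ℝ | 1 - u ≤ (((volume.restrict (Ioo (0:ℝ) 1)).map Yf) (Iic t)).toReal} := by
    simp only [mem_setOf_eq]
    rw [Measure.map_apply Yf_meas measurableSet_Iic,
      Measure.restrict_apply (Yf_meas measurableSet_Iic)]
    have hsub : Ico u 1 ⊆ Yf ⁻¹' Iic (4 * Yf u) ∩ Ioo 0 1 := fun x hx =>
      ⟨Yf_le hu hx.1 hx.2.le, hu.trans_le hx.1, hx.2⟩
    have hfin : volume (Yf ⁻¹' Iic (4 * Yf u) ∩ Ioo 0 1) ≠ ⊤ :=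
      ne_top_of_le_ne_top (by simp) (measure_mono (inter_subset_right (t := Ioo (0:ℝ) 1)))
    have h1 := ENNReal.toReal_mono hfin (measure_mono (μ := volume) hsub)
    rwa [Real.volume_Ico, ENNReal.toReal_ofReal (by linarith)] at h1
  exact ⟨le_csInf ⟨_, hmem⟩ hlow, csInf_le ⟨_, hlow⟩ hmem⟩

lemma ratio_ge {m : ℕ} (hm : 1 ≤ m) : (2 * (m:ℝ) + 1) / 24 ≤
    quantile ((volume.restrict (Ioo (0:ℝ) 1)).map XX) (1 - Real.exp (-(m:ℝ) ^ 2) / 2) /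
    quantile ((volume.restrict (Ioo (0:ℝ) 1)).map Yf) (1 - Real.exp (-(m:ℝ) ^ 2) / 2) := by
  have he := Real.exp_pos (-(m:ℝ) ^ 2)
  have hle : Real.exp (-(m:ℝ) ^ 2) ≤ 1 := by
    rw [Real.exp_le_one_iff]; nlinarith [sq_nonneg (m:ℝ)]
  obtain ⟨h1, h2⟩ := qY (u := Real.exp (-(m:ℝ) ^ 2) / 2) (by positivity) (by linarith)
  have h3 := qX hm
  set qx := quantile ((volume.restrict (Ioo (0:ℝ) 1)).map XX) (1 - Real.exp (-(m:ℝ) ^ 2) / 2)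
  set qy := quantile ((volume.restrict (Ioo (0:ℝ) 1)).map Yf) (1 - Real.exp (-(m:ℝ) ^ 2) / 2)
  rw [le_div_iff₀ (by linarith)]
  refine le_trans ?_ h3
  have h4 : Yf (Real.exp (-(m:ℝ) ^ 2) / 2) ≤ 2 * Real.exp ((m:ℝ) ^ 2) / (1 + (m:ℝ) ^ 2) ^ 2 := by
    rw [Yf_eq (by positivity), Real.log_div he.ne' two_ne_zero, Real.log_exp]
    have hl : 0 ≤ Real.log 2 := Real.log_nonneg one_le_two
    have e : (Real.exp (-(m:ℝ) ^ 2) / 2)⁻¹ = 2 * Real.exp ((m:ℝ) ^ 2) := by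
      rw [Real.exp_neg]; field_simp
    rw [e, div_eq_mul_inv]
    gcongr
    linarith
  have h5 : qy ≤ 8 * (Real.exp ((m:ℝ) ^ 2) / (1 + (m:ℝ) ^ 2) ^ 2) := by
    refine h2.trans ((mul_le_mul_of_nonneg_left h4 (by norm_num)).trans (le_of_eq ?_)); ring
  refine (mul_le_mul_of_nonneg_left h5 (by positivity)).trans ?_
  unfold BB
  have e : (2 * (m:ℝ) + 1) / 24 * (8 * (Real.exp ((m:ℝ) ^ 2) / (1 + (m:ℝ) ^ 2) ^ 2)) =
      Real.exp ((m:ℝ) ^ 2) * ((2 * m + 1) / ((1 + (m:ℝ) ^ 2) * (3 * (1 + (m:ℝ) ^ 2)))) := by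
    field_simp; norm_num
  rw [e]
  gcongr
  nlinarith [sq_nonneg ((m:ℝ) - 1)]

lemma final (M : ℝ) : ∃ᶠ x in nhdsWithin (1 : ℝ) (Set.Iio 1),
      M < quantile ((volume.restrict (Ioo (0:ℝ) 1)).map XX) x /
        quantile ((volume.restrict (Ioo (0:ℝ) 1)).map Yf) x := by
  have ht : Tendsto (fun m : ℕ => 1 - Real.exp (-(m:ℝ) ^ 2) / 2) atTop (nhdsWithin (1 : ℝ) (Set.Iio 1)) := by
    rw [tendsto_nhdsWithin_iff]
    constructor
    · have h1 : Tendsto (fun m : ℕ => -(m:ℝ) ^ 2) atTop atBot :=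
        tendsto_neg_atTop_atBot.comp ((tendsto_pow_atTop two_ne_zero).comp tendsto_natCast_atTop_atTop)
      have h2 := ((Real.tendsto_exp_atBot.comp h1).div_const 2).const_sub 1
      simpa using h2
    · refine Eventually.of_forall fun m => ?_
      have := Real.exp_pos (-(m:ℝ) ^ 2)
      simp only [mem_Iio]; linarith
  refine ht.frequently (Eventually.frequently ?_)
  obtain ⟨N, hN⟩ := exists_nat_gt (12 * M)
  filter_upwards [eventually_ge_atTop (max N 1)] with m hm
  refine lt_of_lt_of_le ?_ (ratio_ge ((le_max_right _ _).trans hm))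
  have : (N:ℝ) ≤ m := by exact_mod_cast (le_max_left _ _).trans hm
  linarith

/-- On `((0,1), Borel, Lebesgue)` let `Y(x) = x⁻¹ (log(e/x))⁻²`,
`E_n = {x : e^{−n²} ≤ x < e^{−(n−1)²}}` for `n ≥ 1`, `𝒯 = σ({E_n})`, `X = 𝔼(Y | 𝒯)`.
Then `𝔼|Y| < ∞`, `𝔼 φ(X) ≤ 𝔼 φ(Y)` for all convex `φ` (the `(−∞,∞]`-valued inequality
being encoded via positive/negative parts), yet `limsup_{x→1⁻} H_X(x)/H_Y(x) = ∞`
(i.e. the ratio is frequently larger than any `M` as `x → 1⁻`). -/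
theorem stmt_7 :
    letI μ : Measure ℝ := volume.restrict (Set.Ioo (0 : ℝ) 1)
    let Y : ℝ → ℝ := fun x => x⁻¹ * (Real.log (Real.exp 1 / x) ^ 2)⁻¹
    let X : ℝ → ℝ := μ[Y| MeasurableSpace.generateFrom
      {s : Set ℝ | ∃ n : ℕ, 1 ≤ n ∧
        s = Set.Ico (Real.exp (-(n : ℝ) ^ 2)) (Real.exp (-((n : ℝ) - 1) ^ 2))}]
    Integrable Y μ ∧
    (∀ φ : ℝ → ℝ, ConvexOn ℝ Set.univ φ →
      (∫⁻ x, ENNReal.ofReal (φ (X x)) ∂μ) + (∫⁻ x, ENNReal.ofReal (-(φ (Y x))) ∂μ) ≤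
        (∫⁻ x, ENNReal.ofReal (φ (Y x)) ∂μ) + (∫⁻ x, ENNReal.ofReal (-(φ (X x))) ∂μ)) ∧
    (∀ M : ℝ, ∃ᶠ x in nhdsWithin (1 : ℝ) (Set.Iio 1),
      M < quantile (μ.map X) x / quantile (μ.map Y) x) := by
  intro Y X
  have hprob : IsProbabilityMeasure (volume.restrict (Ioo (0:ℝ) 1)) := ⟨by simp⟩
  exact ⟨Yf_integrable, fun φ hφ => jensen_ext TT TT_le φ hφ Yf_integrable, final⟩
end

section
/- Let X and Y be real valued random variables such that 𝔼|Y| < ∞ and 𝔼 φ(X) ≤ 𝔼 φ(Y) for all non-decreasing convex φ: ℝ → ℝ. Let x ∈ (0,1) and R > 1, and assume H_Y^*(x/R) ≥ (1/x) ∫_0^x H_Y^*(u) du. Then, with t = (1/x) ∫_0^x H_Y^*(u) du, one has ℙ{X > t} ≤ R·ℙ{Y ≥ t}. -/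
open MeasureTheory Set

lemma quantile_le_iff_aux (ν : Measure ℝ) [IsProbabilityMeasure ν] {s : ℝ} (h0 : 0 < s) (h1 : s < 1)
    (a : ℝ) : quantile ν s ≤ a ↔ s ≤ (ν (Set.Iic a)).toReal := by
  have hF : ∀ t, (ν (Set.Iic t)).toReal = ProbabilityTheory.cdf ν t := fun t => by
    rw [ProbabilityTheory.cdf_eq_real]; rfl
  unfold quantile
  simp only [hF]
  have hbdd : BddBelow {t : ℝ | s ≤ ProbabilityTheory.cdf ν t} := by
    have := (ProbabilityTheory.tendsto_cdf_atBot ν).eventually (gt_mem_nhds h0)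
    obtain ⟨b, hb⟩ := this.exists
    refine ⟨b, fun t ht => ?_⟩
    by_contra hlt
    push Not at hlt
    have := ProbabilityTheory.monotone_cdf ν hlt.le
    have ht' : s ≤ ProbabilityTheory.cdf ν t := ht
    linarith
  have hne : {t : ℝ | s ≤ ProbabilityTheory.cdf ν t}.Nonempty := by
    have := (ProbabilityTheory.tendsto_cdf_atTop ν).eventually (lt_mem_nhds h1)
    obtain ⟨b, hb⟩ := this.exists
    exact ⟨b, le_of_lt hb⟩
  constructor
  · intro h
    have hc := (ProbabilityTheory.cdf ν).right_continuous a
    have hc' : Filter.Tendsto (ProbabilityTheory.cdf ν) (nhdsWithin a (Ioi a))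
        (nhds (ProbabilityTheory.cdf ν a)) := hc.mono_left (nhdsWithin_mono _ Ioi_subset_Ici_self)
    refine ge_of_tendsto hc' ?_
    filter_upwards [self_mem_nhdsWithin] with b hb
    obtain ⟨t, ht, htb⟩ := (csInf_lt_iff hbdd hne).1 (lt_of_le_of_lt h hb)
    exact le_trans ht (ProbabilityTheory.monotone_cdf ν htb.le)
  · intro h
    exact csInf_le hbdd h

lemma quantile_mono_aux (ν : Measure ℝ) [IsProbabilityMeasure ν] {s r : ℝ} (h0 : 0 < s) (h : s ≤ r)
    (h1 : r < 1) : quantile ν s ≤ quantile ν r := by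
  rw [quantile_le_iff_aux ν h0 (h.trans_lt h1)]
  exact h.trans ((quantile_le_iff_aux ν (h0.trans_le h) h1 _).1 le_rfl)

lemma quantile_aemeas_aux (ν : Measure ℝ) [IsProbabilityMeasure ν] :
    AEMeasurable (fun u => quantile ν (1 - u)) (volume.restrict (Ioo (0:ℝ) 1)) := by
  apply aemeasurable_restrict_of_antitoneOn measurableSet_Ioo
  intro a ha b hb hab
  exact quantile_mono_aux ν (by linarith [hb.2]) (by linarith) (by linarith [ha.1])

lemma quantile_map_aux (ν : Measure ℝ) [IsProbabilityMeasure ν] :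
    (volume.restrict (Ioo (0:ℝ) 1)).map (fun u => quantile ν (1 - u)) = ν := by
  haveI : IsFiniteMeasure ((volume.restrict (Ioo (0:ℝ) 1)).map (fun u => quantile ν (1 - u))) :=
    inferInstance
  refine Measure.ext_of_Iic _ _ fun a => ?_
  rw [Measure.map_apply_of_aemeasurable (quantile_aemeas_aux ν) measurableSet_Iic,
    Measure.restrict_apply' measurableSet_Ioo]
  set p := (ν (Iic a)).toReal with hp
  have hp0 : 0 ≤ p := ENNReal.toReal_nonneg
  have hp1 : p ≤ 1 := prob_le_one (μ := ν) (s := Iic a) |> ENNReal.toReal_mono ENNReal.one_ne_top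
    |>.trans (by simp)
  have hset : (fun u => quantile ν (1 - u)) ⁻¹' Iic a ∩ Ioo 0 1 = Ico (1 - p) 1 ∩ Ioo 0 1 := by
    ext u
    simp only [mem_inter_iff, mem_preimage, mem_Iic, mem_Ico, mem_Ioo]
    constructor
    · rintro ⟨h, hu⟩
      rw [quantile_le_iff_aux ν (by linarith [hu.2]) (by linarith [hu.1])] at h
      exact ⟨⟨by linarith, hu.2⟩, hu⟩
    · rintro ⟨h, hu⟩
      rw [quantile_le_iff_aux ν (by linarith [hu.2]) (by linarith [hu.1])]
      exact ⟨by linarith [h.1], hu⟩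
  rw [hset]
  have h2 : volume (Ico (1 - p) 1 ∩ Ioo 0 1) = volume (Ico (1 - p) 1) := by
    apply measure_congr
    have : (Ioo (0:ℝ) 1 : Set ℝ) =ᵐ[volume] Ico 0 1 := Ioo_ae_eq_Ico
    have h3 := (Filter.EventuallyEq.refl (ae volume) (Ico (1 - p) 1)).inter this
    refine h3.trans ?_
    rw [inter_eq_left.2 (Ico_subset_Ico_left (by linarith) : Ico (1 - p) 1 ⊆ Ico 0 1)]
    exact Filter.EventuallyEq.rfl
  rw [h2, Real.volume_Ico, hp]
  simp

lemma tail_aux (ν : Measure ℝ) [IsProbabilityMeasure ν] (hi : Integrable (fun y => y) ν) {x : ℝ}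
    (hx : x ∈ Ioo (0:ℝ) 1) :
    ∫ y, max (y - quantile ν (1 - x)) 0 ∂ν
      = (∫ u in (0:ℝ)..x, quantile ν (1 - u)) - x * quantile ν (1 - x) := by
  set q := quantile ν (1 - x) with hq
  have hm := quantile_aemeas_aux ν
  have hiG : Integrable (fun u => quantile ν (1 - u)) (volume.restrict (Ioo (0:ℝ) 1)) := by
    have := hi
    rw [← quantile_map_aux ν] at this
    exact this.comp_aemeasurable hm
  have h1 : ∫ y, max (y - q) 0 ∂ν = ∫ u in Ioo (0:ℝ) 1, max (quantile ν (1 - u) - q) 0 := by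
    conv_lhs => rw [← quantile_map_aux ν]
    rw [integral_map hm]
    exact (by fun_prop : Continuous fun y : ℝ => max (y - q) 0).aestronglyMeasurable
  have hsub : Ioc 0 x ⊆ Ioo (0:ℝ) 1 := fun u hu => ⟨hu.1, hu.2.trans_lt hx.2⟩
  have h2 : ∫ u in Ioo (0:ℝ) 1, max (quantile ν (1 - u) - q) 0
      = ∫ u in Ioo (0:ℝ) 1, (Ioc 0 x).indicator (fun u => quantile ν (1 - u) - q) u := by
    apply setIntegral_congr_fun measurableSet_Ioo
    intro u hu
    by_cases hux : u ∈ Ioc 0 x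
    · have : q ≤ quantile ν (1 - u) :=
        quantile_mono_aux ν (by linarith [hx.2]) (by linarith [hux.2]) (by linarith [hu.1])
      simp only [indicator_of_mem hux]
      exact max_eq_left (by linarith)
    · have hlt : x < u := by
        by_contra hc
        exact hux ⟨hu.1, not_lt.1 hc⟩
      have : quantile ν (1 - u) ≤ q :=
        quantile_mono_aux ν (by linarith [hu.2]) (by linarith) (by linarith [hx.1])
      simp only [indicator_of_notMem hux]
      exact max_eq_right (by linarith)
  have hiG' : IntegrableOn (fun u => quantile ν (1 - u)) (Ioc 0 x) :=
    IntegrableOn.mono_set hiG hsub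
  rw [h1, h2, setIntegral_indicator measurableSet_Ioc, inter_eq_right.2 hsub,
    intervalIntegral.integral_of_le hx.1.le, integral_sub hiG' (by simp)]
  simp [hx.1.le]

/-- Let `𝔼|Y| < ∞` and `𝔼 φ(X) ≤ 𝔼 φ(Y)` for all non-decreasing convex `φ`
(the `(−∞,∞]`-valued inequality encoded via positive/negative parts). Let `x ∈ (0,1)`,
`R > 1` and assume `H_Y^*(x/R) ≥ (1/x) ∫₀ˣ H_Y^*(u) du` where `H_Y^*(u) = H_Y(1−u)`.
Then with `t = (1/x) ∫₀ˣ H_Y^*(u) du` one has `ℙ{X > t} ≤ R·ℙ{Y ≥ t}`. -/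
theorem stmt_8 {Ω : Type*} [MeasurableSpace Ω] (μ : Measure Ω) [IsProbabilityMeasure μ]
    (X Y : Ω → ℝ) (hX : Measurable X) (hY : Measurable Y)
    (hYint : Integrable Y μ)
    (hmaj : ∀ φ : ℝ → ℝ, Monotone φ → ConvexOn ℝ Set.univ φ →
      (∫⁻ ω, ENNReal.ofReal (φ (X ω)) ∂μ) + (∫⁻ ω, ENNReal.ofReal (-(φ (Y ω))) ∂μ) ≤
        (∫⁻ ω, ENNReal.ofReal (φ (Y ω)) ∂μ) + (∫⁻ ω, ENNReal.ofReal (-(φ (X ω))) ∂μ))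
    (x R : ℝ) (hx : x ∈ Set.Ioo (0 : ℝ) 1) (hR : 1 < R)
    (hquant : (1 / x) * ∫ u in (0 : ℝ)..x, quantile (μ.map Y) (1 - u) ≤
      quantile (μ.map Y) (1 - x / R)) :
    μ {ω | (1 / x) * ∫ u in (0 : ℝ)..x, quantile (μ.map Y) (1 - u) < X ω} ≤
      ENNReal.ofReal R *
        μ {ω | (1 / x) * ∫ u in (0 : ℝ)..x, quantile (μ.map Y) (1 - u) ≤ Y ω} := by
  set ν := μ.map Y with hν
  haveI : IsProbabilityMeasure ν := Measure.isProbabilityMeasure_map hY.aemeasurable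
  set t := (1 / x) * ∫ u in (0 : ℝ)..x, quantile ν (1 - u) with ht
  have hx0 : 0 < x := hx.1
  have hx1 : x < 1 := hx.2
  have hiν : Integrable (fun y : ℝ => y) ν :=
    (integrable_map_measure (by fun_prop) hY.aemeasurable).2 hYint
  have htail := tail_aux ν hiν hx
  set q := quantile ν (1 - x) with hq
  have hxt : ∫ u in (0 : ℝ)..x, quantile ν (1 - u) = x * t := by
    rw [ht]; field_simp
  rw [hxt] at htail
  have hcont : Continuous fun y : ℝ => max (y - q) 0 := by fun_prop
  have hmapint : ∫ ω, max (Y ω - q) 0 ∂μ = x * t - x * q := by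
    rw [← htail, hν, integral_map hY.aemeasurable hcont.aestronglyMeasurable]
  have hm := hmaj (fun y => max (y - q) 0)
    (fun a b hab => max_le_max (by linarith) le_rfl)
    (((convexOn_id convex_univ).sub (concaveOn_const q convex_univ)).sup
      (convexOn_const 0 convex_univ))
  have hneg : ∀ y : ℝ, ENNReal.ofReal (-(max (y - q) 0)) = 0 := fun y =>
    ENNReal.ofReal_eq_zero.2 (by linarith [le_max_right (y - q) 0])
  simp only [hneg, lintegral_zero, add_zero] at hm
  have hYi : Integrable (fun ω => max (Y ω - q) 0) μ :=
    (hYint.sub (integrable_const q)).pos_part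
  rw [← ofReal_integral_eq_lintegral_ofReal hYi
    (Filter.Eventually.of_forall fun ω => le_max_right _ _), hmapint] at hm
  have hqt : q ≤ t := by
    have : 0 ≤ x * t - x * q := by
      rw [← hmapint]
      exact integral_nonneg fun ω => le_max_right _ _
    nlinarith
  have hXle : μ {ω | t < X ω} ≤ ENNReal.ofReal x := by
    have hmeas : Measurable fun ω => ENNReal.ofReal (max (X ω - q) 0) := by fun_prop
    rcases hqt.eq_or_lt with h | h
    · rw [← h, sub_self, ENNReal.ofReal_zero] at hm
      have h0 := (lintegral_eq_zero_iff hmeas).1 (le_antisymm hm (zero_le))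
      have : μ {ω | t < X ω} = 0 := by
        have h0' : ∀ᵐ ω ∂μ, ¬ (t < X ω) := by
          filter_upwards [h0] with ω hω
          have h5 : max (X ω - q) 0 ≤ 0 := ENNReal.ofReal_eq_zero.1 hω
          have := le_max_left (X ω - q) 0
          linarith
        rw [ae_iff] at h0'
        simpa using h0'
      rw [this]; exact zero_le
    · have hpos : 0 < t - q := sub_pos.2 h
      have hmk := mul_meas_ge_le_lintegral (μ := μ) hmeas (ENNReal.ofReal (t - q))
      have hss : μ {ω | t < X ω} ≤
          μ {ω | ENNReal.ofReal (t - q) ≤ ENNReal.ofReal (max (X ω - q) 0)} := by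
        apply measure_mono
        intro ω hω
        have hω' : t < X ω := hω
        exact ENNReal.ofReal_le_ofReal (le_trans (by linarith) (le_max_left _ _))
      have h6 : ENNReal.ofReal (t - q) * μ {ω | t < X ω} ≤
          ENNReal.ofReal (t - q) * ENNReal.ofReal x := by
        rw [← ENNReal.ofReal_mul hpos.le]
        refine (mul_le_mul_right hss _).trans (hmk.trans (hm.trans (le_of_eq ?_)))
        congr 1; ring
      exact (ENNReal.mul_le_mul_iff_right (ENNReal.ofReal_pos.2 hpos).ne'
        ENNReal.ofReal_ne_top).1 h6
  refine hXle.trans ?_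
  have hR0 : 0 < R := by linarith
  have hxR0 : 0 < x / R := by positivity
  have hxR1 : x / R < 1 := by rw [div_lt_one hR0]; linarith
  have hlt : ∀ s < t, (ν (Iic s)).toReal ≤ 1 - x / R := by
    intro s hs
    by_contra hc
    push Not at hc
    have := (quantile_le_iff_aux ν (by linarith) (by linarith) s).2 hc.le
    linarith
  have hIio : (ν (Iio t)) ≤ ENNReal.ofReal (1 - x / R) := by
    obtain ⟨u, hu, hut, hul⟩ := exists_seq_strictMono_tendsto t
    have hU : Iio t = ⋃ n, Iic (u n) := by
      ext y
      simp only [mem_Iio, mem_iUnion, mem_Iic]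
      constructor
      · intro hy
        obtain ⟨n, hn⟩ := (hul.eventually (lt_mem_nhds hy)).exists
        exact ⟨n, hn.le⟩
      · rintro ⟨n, hn⟩
        exact hn.trans_lt (hut n)
    rw [hU, Monotone.measure_iUnion (fun a b hab => Iic_subset_Iic.2 (hu.monotone hab))]
    refine iSup_le fun n => ?_
    rw [← ENNReal.ofReal_toReal (measure_ne_top ν (Iic (u n)))]
    exact ENNReal.ofReal_le_ofReal (hlt _ (hut n))
  have hYge : ENNReal.ofReal (x / R) ≤ μ {ω | t ≤ Y ω} := by
    have h7 : μ {ω | t ≤ Y ω} = ν (Ici t) := by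
      rw [hν, Measure.map_apply hY measurableSet_Ici]; rfl
    rw [h7, ← compl_Iio, prob_compl_eq_one_sub measurableSet_Iio]
    calc ENNReal.ofReal (x / R) = 1 - ENNReal.ofReal (1 - x / R) := by
          rw [← ENNReal.ofReal_one, ← ENNReal.ofReal_sub _ (by linarith)]
          congr 1; ring
      _ ≤ _ := tsub_le_tsub_left hIio _
  calc ENNReal.ofReal x = ENNReal.ofReal R * ENNReal.ofReal (x / R) := by
        rw [← ENNReal.ofReal_mul hR0.le]; congr 1; field_simp
    _ ≤ _ := by gcongr
end

section
/- Let Y be a real valued random variable with cumulative distribution function G and quantile function H_Y, and let p > 1. Then the following two statements are equivalent: (I) G is continuous on ℝ, twice differentiable on G^{-1}((0,1)), and for all x ∈ G^{-1}((0,1)) one has G'(x) ≠ 0 and (d/dx)[(1−G(x))/G'(x)] ≤ 1/p; (II) H_Y is twice differentiable on (0,1) with non-vanishing derivative, and for all t ∈ (0,1), H_Y''(t)/H_Y'(t) ≤ (1 + 1/p)(1−t)^{-1}. -/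
open MeasureTheory Set

open Filter Topology in
lemma inv2 {f g : ℝ → ℝ} {U V : Set ℝ} (hV : IsOpen V)
    (hf : ∀ x ∈ U, DifferentiableAt ℝ f x) (hf0 : ∀ x ∈ U, deriv f x ≠ 0)
    (hm : ∀ y ∈ V, g y ∈ U) (hfg : ∀ y ∈ V, f (g y) = y)
    (hc : ∀ y ∈ V, ContinuousAt g y) :
    (∀ y ∈ V, HasDerivAt g (deriv f (g y))⁻¹ y) ∧
    ∀ y ∈ V, DifferentiableAt ℝ (deriv f) (g y) →
      HasDerivAt (deriv g)
        (-(deriv (deriv f) (g y) * (deriv f (g y))⁻¹) / (deriv f (g y)) ^ 2) y := by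
  have h1 : ∀ y ∈ V, HasDerivAt g (deriv f (g y))⁻¹ y := by
    intro y hy
    refine HasDerivAt.of_local_left_inverse (hc y hy) (hf _ (hm y hy)).hasDerivAt
      (hf0 _ (hm y hy)) ?_
    filter_upwards [hV.mem_nhds hy] with z hz using hfg z hz
  refine ⟨h1, fun y hy hd => ?_⟩
  have h2 : HasDerivAt (fun z => (deriv f (g z))⁻¹)
      (-(deriv (deriv f) (g y) * (deriv f (g y))⁻¹) / (deriv f (g y)) ^ 2) y :=
    (HasDerivAt.comp y hd.hasDerivAt (h1 y hy)).inv (hf0 _ (hm y hy))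
  refine h2.congr_of_eventuallyEq ?_
  filter_upwards [hV.mem_nhds hy] with z hz using (h1 z hz).deriv

lemma alg {a b t p : ℝ} (ha : a ≠ 0) (ht : t < 1) :
    ((-a) * a - (1 - t) * b) / a ^ 2 ≤ 1 / p ↔
    (-(b * a⁻¹) / a ^ 2) / a⁻¹ ≤ (1 + 1 / p) * (1 - t)⁻¹ := by
  have h : 0 < 1 - t := by linarith
  have e1 : (-(b * a⁻¹) / a ^ 2) / a⁻¹ = - b / a ^ 2 := by field_simp
  have e2 : ((-a) * a - (1 - t) * b) / a ^ 2 = -1 + (- b / a ^ 2) * (1 - t) := by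
    field_simp; ring
  rw [e1, e2, ← div_eq_mul_inv, le_div_iff₀ h]
  constructor <;> intro h <;> linarith

open Filter Topology in
lemma core {G H : ℝ → ℝ} {p : ℝ} (hG : Monotone G) (h0 : ∀ x, 0 ≤ G x)
    (hr : ∀ x, ContinuousWithinAt G (Ici x) x)
    (gal : ∀ t ∈ Ioo (0 : ℝ) 1, ∀ y, H t ≤ y ↔ t ≤ G y) (h1 : ∀ x, G x ≤ 1) :
    (Continuous G ∧
      ∀ x : ℝ, G x ∈ Set.Ioo (0 : ℝ) 1 →
        DifferentiableAt ℝ G x ∧ DifferentiableAt ℝ (deriv G) x ∧ deriv G x ≠ 0 ∧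
        deriv (fun y : ℝ => (1 - G y) / deriv G y) x ≤ 1 / p)
    ↔
    (∀ t ∈ Set.Ioo (0 : ℝ) 1,
      DifferentiableAt ℝ H t ∧ DifferentiableAt ℝ (deriv H) t ∧ deriv H t ≠ 0 ∧
      deriv (deriv H) t / deriv H t ≤ (1 + 1 / p) * (1 - t)⁻¹) := by
  have hGH : Continuous G → ∀ t ∈ Ioo (0 : ℝ) 1, G (H t) = t := by
    intro hc t ht
    refine le_antisymm ?_ ((gal t ht _).1 le_rfl)
    by_contra! hlt
    have : ∀ᶠ y in 𝓝[<] (H t), t < G y :=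
      (hc.continuousAt.eventually (lt_mem_nhds hlt)).filter_mono nhdsWithin_le_nhds
    obtain ⟨y, hy, hy'⟩ := (this.and self_mem_nhdsWithin).exists
    exact absurd ((gal t ht y).2 hy.le) (not_le.2 hy')
  have key : Continuous G → (∀ x, G x ∈ Ioo (0 : ℝ) 1 → H (G x) = x) →
      (∀ x, G x ∈ Ioo (0 : ℝ) 1 → DifferentiableAt ℝ G x ∧ DifferentiableAt ℝ (deriv G) x ∧
        deriv G x ≠ 0) →
      ∀ t ∈ Ioo (0 : ℝ) 1, DifferentiableAt ℝ H t ∧ DifferentiableAt ℝ (deriv H) t ∧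
        deriv H t ≠ 0 ∧ (deriv (fun y : ℝ => (1 - G y) / deriv G y) (H t) ≤ 1 / p ↔
          deriv (deriv H) t / deriv H t ≤ (1 + 1 / p) * (1 - t)⁻¹) := by
    intro hc hHG hd
    have hcH : ∀ t ∈ Ioo (0 : ℝ) 1, ContinuousAt H t := by
      intro t ht
      have hx := hGH hc t ht
      refine tendsto_order.2 ⟨fun a ha => ?_, fun a ha => ?_⟩
      · have : G a < t := by
          by_contra! h
          exact absurd ((gal t ht a).2 h) (not_le.2 ha)
        filter_upwards [lt_mem_nhds this, isOpen_Ioo.mem_nhds ht] with s hs hs'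
        by_contra! h
        exact absurd ((gal s hs' a).1 h) (not_le.2 hs)
      · obtain ⟨b, hb, hba⟩ := exists_between ha
        have : t < G b := by
          refine lt_of_le_of_ne ((gal t ht b).1 hb.le) fun h => ?_
          have := hHG b (h ▸ ht)
          rw [← h] at this
          exact hb.ne this
        filter_upwards [gt_mem_nhds this, isOpen_Ioo.mem_nhds ht] with s hs hs'
        exact ((gal s hs' b).2 hs.le).trans_lt hba
    obtain ⟨k1, k2⟩ := inv2 (f := G) (g := H) (U := G ⁻¹' Ioo 0 1) (V := Ioo (0 : ℝ) 1)
      isOpen_Ioo (fun x hx => (hd x hx).1) (fun x hx => (hd x hx).2.2)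
      (fun t ht => by simpa [hGH hc t ht] using ht) (hGH hc) hcH
    intro t ht
    have hU : G (H t) ∈ Ioo (0 : ℝ) 1 := by rw [hGH hc t ht]; exact ht
    obtain ⟨d1, d2, d3⟩ := hd _ hU
    have k2 := k2 t ht d2
    have k1 := k1 t ht
    refine ⟨k1.differentiableAt, k2.differentiableAt, ?_, ?_⟩
    · rw [k1.deriv]; exact inv_ne_zero d3
    · have hq : HasDerivAt (fun y : ℝ => (1 - G y) / deriv G y) _ (H t) :=
        (d1.hasDerivAt.const_sub 1).div d2.hasDerivAt d3
      rw [hq.deriv, k1.deriv, k2.deriv, hGH hc t ht]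
      exact alg d3 ht.2
  constructor
  · rintro ⟨hc, hd⟩
    have hHG : ∀ x, G x ∈ Ioo (0 : ℝ) 1 → H (G x) = x := by
      intro x hx
      refine le_antisymm ((gal _ hx x).2 le_rfl) ?_
      by_contra! hlt
      obtain ⟨m, hm1, hm2⟩ := exists_between hlt
      have hcon : ∀ z ∈ Ioo (H (G x)) x, G z = G x := fun z hz =>
        le_antisymm (hG hz.2.le) ((gal _ hx z).1 hz.1.le)
      have hm := hcon m ⟨hm1, hm2⟩
      refine (hd m (hm ▸ hx)).2.2.1 ?_
      have : G =ᶠ[𝓝 m] fun _ => G x := by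
        filter_upwards [isOpen_Ioo.mem_nhds (show m ∈ Ioo (H (G x)) x from ⟨hm1, hm2⟩)] with z hz
        exact hcon z hz
      rw [this.deriv_eq]; simp
    intro t ht
    obtain ⟨a, b, c, d⟩ := key hc hHG (fun x hx => ⟨(hd x hx).1, (hd x hx).2.1, (hd x hx).2.2.1⟩) t ht
    exact ⟨a, b, c, d.1 (hd _ (by rw [hGH hc t ht]; exact ht)).2.2.2⟩
  · intro hd
    have hHm : ∀ s ∈ Ioo (0 : ℝ) 1, ∀ t ∈ Ioo (0 : ℝ) 1, s ≤ t → H s ≤ H t := fun s hs t ht hst =>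
      (gal s hs _).2 (hst.trans ((gal t ht _).1 le_rfl))
    have hHs : ∀ s ∈ Ioo (0 : ℝ) 1, ∀ t ∈ Ioo (0 : ℝ) 1, s < t → H s < H t := by
      intro s hs t ht hst
      refine lt_of_le_of_ne (hHm s hs t ht hst.le) fun he => ?_
      obtain ⟨m, hm1, hm2⟩ := exists_between hst
      refine (hd m ⟨hs.1.trans hm1, hm2.trans ht.2⟩).2.2.1 ?_
      have : H =ᶠ[𝓝 m] fun _ => H s := by
        filter_upwards [isOpen_Ioo.mem_nhds (show m ∈ Ioo s t from ⟨hm1, hm2⟩)] with z hz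
        have hz' : z ∈ Ioo (0 : ℝ) 1 := ⟨hs.1.trans hz.1, hz.2.trans ht.2⟩
        exact le_antisymm (he ▸ hHm z hz' t ht hz.2.le) (hHm s hs z hz' hz.1.le)
      rw [this.deriv_eq]; simp
    have hc : Continuous G := by
      refine continuous_iff_continuousAt.2 fun x => tendsto_order.2 ⟨fun c hcx => ?_, fun c hcx => ?_⟩
      · rcases lt_or_ge c 0 with h | h
        · exact Eventually.of_forall fun y => h.trans_le (h0 y)
        obtain ⟨t2, ha, hb⟩ := exists_between hcx
        obtain ⟨t1, ha', hb'⟩ := exists_between ha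
        have m2 : t2 ∈ Ioo (0 : ℝ) 1 := ⟨by linarith, by linarith [h1 x]⟩
        have m1 : t1 ∈ Ioo (0 : ℝ) 1 := ⟨by linarith, by linarith [h1 x]⟩
        have : H t1 < x := (hHs t1 m1 t2 m2 hb').trans_le ((gal t2 m2 x).2 hb.le)
        filter_upwards [lt_mem_nhds this] with y hy
        exact ha'.trans_le ((gal t1 m1 y).1 hy.le)
      · have := (hr x).eventually (gt_mem_nhds hcx)
        rw [eventually_nhdsWithin_iff] at this
        filter_upwards [this] with y hy
        rcases le_total x y with h | h
        · exact hy h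
        · exact (hG h).trans_lt hcx
    have hHG : ∀ x, G x ∈ Ioo (0 : ℝ) 1 → H (G x) = x := by
      intro x hx
      refine le_antisymm ((gal _ hx x).2 le_rfl) ?_
      by_contra! hlt
      have : ∀ᶠ s in 𝓝[>] (G x), H s < x ∧ s ∈ Ioo (0 : ℝ) 1 :=
        (((hd _ hx).1.continuousAt.eventually (gt_mem_nhds hlt)).and
          (isOpen_Ioo.mem_nhds hx)).filter_mono nhdsWithin_le_nhds
      obtain ⟨s, ⟨hs, hs'⟩, hs2⟩ := (this.and self_mem_nhdsWithin).exists
      exact absurd ((gal s hs' x).1 hs.le) (not_le.2 hs2)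
    obtain ⟨k1, k2⟩ := inv2 (f := H) (g := G) (V := G ⁻¹' Ioo 0 1) (U := Ioo (0 : ℝ) 1)
      (isOpen_Ioo.preimage hc) (fun x hx => (hd x hx).1) (fun x hx => (hd x hx).2.2.1)
      (fun t ht => ht) hHG (fun _ _ => hc.continuousAt)
    have hd' : ∀ x, G x ∈ Ioo (0 : ℝ) 1 → DifferentiableAt ℝ G x ∧
        DifferentiableAt ℝ (deriv G) x ∧ deriv G x ≠ 0 := fun x hx =>
      ⟨(k1 x hx).differentiableAt, (k2 x hx (hd _ hx).2.1).differentiableAt, by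
        rw [(k1 x hx).deriv]; exact inv_ne_zero (hd _ hx).2.2.1⟩
    refine ⟨hc, fun x hx => ⟨(hd' x hx).1, (hd' x hx).2.1, (hd' x hx).2.2, ?_⟩⟩
    have := (key hc hHG hd' (G x) hx).2.2.2.2 (hd _ hx).2.2.2
    rwa [hHG x hx] at this

open Filter Topology ProbabilityTheory in
lemma gal_quantile (ν : Measure ℝ) [IsProbabilityMeasure ν] :
    ∀ t ∈ Ioo (0 : ℝ) 1, ∀ y, quantile ν t ≤ y ↔ t ≤ cdf ν y := by
  intro t ht y
  have e : quantile ν t = sInf {x | t ≤ cdf ν x} := by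
    simp only [quantile, cdf_eq_real]; rfl
  have hne : {x | t ≤ cdf ν x}.Nonempty := by
    obtain ⟨x, hx⟩ := ((tendsto_cdf_atTop ν).eventually (lt_mem_nhds ht.2)).exists
    exact ⟨x, hx.le⟩
  have hbd : BddBelow {x | t ≤ cdf ν x} := by
    obtain ⟨x, hx⟩ := ((tendsto_cdf_atBot ν).eventually (gt_mem_nhds ht.1)).exists
    refine ⟨x, fun z hz => ?_⟩
    by_contra! h
    exact absurd ((monotone_cdf ν h.le).trans_lt hx) (not_lt.2 hz)
  rw [e]
  refine ⟨fun h => ?_, fun h => csInf_le hbd h⟩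
  by_contra! hlt
  have := ((cdf ν).right_continuous y).eventually (gt_mem_nhds hlt)
  have : ∀ᶠ z in 𝓝[>] y, cdf ν z < t := this.filter_mono (nhdsWithin_mono _ Ioi_subset_Ici_self)
  obtain ⟨z, hz, hz2⟩ := (this.and self_mem_nhdsWithin).exists
  obtain ⟨w, hw, hw2⟩ := exists_lt_of_csInf_lt hne (h.trans_lt hz2)
  exact absurd (hw.trans (monotone_cdf ν hw2.le)) (not_le.2 hz)

/-- For a real random variable with cdf `G` and quantile function `H_Y`,
and `p > 1`, the following are equivalent.
(I) `G` is continuous on `ℝ`, twice differentiable on `G⁻¹((0,1))`, and for every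
`x ∈ G⁻¹((0,1))`, `G'(x) ≠ 0` and `(d/dx)[(1−G(x))/G'(x)] ≤ 1/p`.
(II) `H_Y` is twice differentiable on `(0,1)` with non-vanishing derivative, and for all
`t ∈ (0,1)`, `H_Y''(t)/H_Y'(t) ≤ (1 + 1/p)(1−t)⁻¹`. -/
theorem stmt_9 (ν : Measure ℝ) [IsProbabilityMeasure ν] (p : ℝ) (hp : 1 < p) :
    (Continuous (fun t : ℝ => (ν (Set.Iic t)).toReal) ∧
      ∀ x : ℝ, (ν (Set.Iic x)).toReal ∈ Set.Ioo (0 : ℝ) 1 →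
        DifferentiableAt ℝ (fun t : ℝ => (ν (Set.Iic t)).toReal) x ∧
        DifferentiableAt ℝ (deriv (fun t : ℝ => (ν (Set.Iic t)).toReal)) x ∧
        deriv (fun t : ℝ => (ν (Set.Iic t)).toReal) x ≠ 0 ∧
        deriv (fun y : ℝ =>
          (1 - (ν (Set.Iic y)).toReal) / deriv (fun t : ℝ => (ν (Set.Iic t)).toReal) y) x
          ≤ 1 / p)
    ↔
    (∀ t ∈ Set.Ioo (0 : ℝ) 1,
      DifferentiableAt ℝ (quantile ν) t ∧
      DifferentiableAt ℝ (deriv (quantile ν)) t ∧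
      deriv (quantile ν) t ≠ 0 ∧
      deriv (deriv (quantile ν)) t / deriv (quantile ν) t ≤ (1 + 1 / p) * (1 - t)⁻¹) := by
  have e : (fun t : ℝ => (ν (Set.Iic t)).toReal) = ProbabilityTheory.cdf ν := by
    funext t; rw [ProbabilityTheory.cdf_eq_real]; rfl
  have e' : ∀ t : ℝ, (ν (Set.Iic t)).toReal = ProbabilityTheory.cdf ν t := congrFun e
  have h := core (G := fun t : ℝ => (ν (Set.Iic t)).toReal) (H := quantile ν) (p := p)
    (by rw [e]; exact ProbabilityTheory.monotone_cdf ν)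
    (by simp only [e']; exact ProbabilityTheory.cdf_nonneg ν)
    (by rw [e]; exact (ProbabilityTheory.cdf ν).right_continuous)
    (by simp only [e']; exact gal_quantile ν)
    (by simp only [e']; exact ProbabilityTheory.cdf_le_one ν)
  exact h
end

section
/- Let Y be a real valued random variable with quantile function H_Y, let p > 1 and T ≥ 1, and suppose H_Y is C¹ on (0,1) with non-vanishing derivative and satisfies H_Y'(1 − δ(1−x)) ≤ T·δ^{−1−1/p}·H_Y'(x) for all δ, x ∈ (0,1). Then for all δ, x, y ∈ (0,1), |H_Y^*(δx) − H_Y^*(δy)| ≤ T·δ^{−1/p}·|H_Y^*(x) − H_Y^*(y)|, where H_Y^*(x) = H_Y(1−x). -/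
open MeasureTheory Set

theorem quantile_mono_aux_s10 (ν : Measure ℝ) [IsProbabilityMeasure ν] {s t : ℝ} (hs : 0 < s)
    (hst : s ≤ t) (ht : t < 1) : quantile ν s ≤ quantile ν t := by
  have e : ∀ r, (ν (Set.Iic r)).toReal = ProbabilityTheory.cdf ν r := fun r =>
    (ProbabilityTheory.cdf_eq_real ν r).symm
  unfold quantile
  simp only [e]
  apply csInf_le_csInf
  · obtain ⟨a, ha⟩ := ((ProbabilityTheory.tendsto_cdf_atBot ν).eventually (gt_mem_nhds hs)).exists
    refine ⟨a, fun r hr => ?_⟩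
    by_contra hlt
    have h1 := ProbabilityTheory.monotone_cdf ν (not_le.mp hlt).le
    have h2 : s ≤ ProbabilityTheory.cdf ν r := hr
    linarith
  · obtain ⟨a, ha⟩ := ((ProbabilityTheory.tendsto_cdf_atTop ν).eventually (lt_mem_nhds ht)).exists
    exact ⟨a, le_of_lt ha⟩
  · intro r hr
    exact le_trans hst hr

/-- If the quantile function `H_Y` of `Y` is `C¹` on `(0,1)` with
non-vanishing derivative, `p > 1`, `T ≥ 1`, and
`H_Y'(1 − δ(1−x)) ≤ T δ^{−1−1/p} H_Y'(x)` for all `δ, x ∈ (0,1)`, then for all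
`δ, x, y ∈ (0,1)`, `|H_Y^*(δx) − H_Y^*(δy)| ≤ T δ^{−1/p} |H_Y^*(x) − H_Y^*(y)|`,
where `H_Y^*(u) = H_Y(1−u)`. -/
theorem stmt_10 (ν : Measure ℝ) [IsProbabilityMeasure ν] (p T : ℝ) (hp : 1 < p) (hT : 1 ≤ T)
    (hdiff : ∀ x ∈ Set.Ioo (0 : ℝ) 1, DifferentiableAt ℝ (quantile ν) x)
    (hcont : ContinuousOn (deriv (quantile ν)) (Set.Ioo (0 : ℝ) 1))
    (hne : ∀ x ∈ Set.Ioo (0 : ℝ) 1, deriv (quantile ν) x ≠ 0)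
    (hgrow : ∀ δ ∈ Set.Ioo (0 : ℝ) 1, ∀ x ∈ Set.Ioo (0 : ℝ) 1,
      deriv (quantile ν) (1 - δ * (1 - x)) ≤
        T * δ ^ (-(1 + 1 / p)) * deriv (quantile ν) x) :
    ∀ δ ∈ Set.Ioo (0 : ℝ) 1, ∀ x ∈ Set.Ioo (0 : ℝ) 1, ∀ y ∈ Set.Ioo (0 : ℝ) 1,
      |quantile ν (1 - δ * x) - quantile ν (1 - δ * y)| ≤
        T * δ ^ (-(1 / p)) * |quantile ν (1 - x) - quantile ν (1 - y)| := by
  intro δ hδ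
  have hδ0 : 0 < δ := hδ.1
  have hmem : ∀ u ∈ Set.Ioo (0 : ℝ) 1, 1 - u ∈ Set.Ioo (0 : ℝ) 1 := fun u hu =>
    ⟨by linarith [hu.2], by linarith [hu.1]⟩
  have hmul : ∀ u ∈ Set.Ioo (0 : ℝ) 1, δ * u ∈ Set.Ioo (0 : ℝ) 1 := fun u hu =>
    ⟨mul_pos hδ.1 hu.1, mul_lt_one_of_nonneg_of_lt_one_left hδ.1.le hδ.2 hu.2.le⟩
  have hD : ∀ u ∈ Set.Ioo (0 : ℝ) 1, HasDerivAt
      (fun u => T * δ ^ (-(1 / p)) * quantile ν (1 - u) - quantile ν (1 - δ * u))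
      (T * δ ^ (-(1 / p)) * (deriv (quantile ν) (1 - u) * (-1))
        - deriv (quantile ν) (1 - δ * u) * (-(δ * 1))) u := by
    intro u hu
    have h1 := (hdiff _ (hmem u hu)).hasDerivAt
    have h2 := (hdiff _ (hmem _ (hmul u hu))).hasDerivAt
    have g1 : HasDerivAt (fun u : ℝ => 1 - u) (-1) u := (hasDerivAt_id u).const_sub 1
    have g2 : HasDerivAt (fun u : ℝ => 1 - δ * u) (-(δ * 1)) u :=
      ((hasDerivAt_id u).const_mul δ).const_sub 1
    have k1 := HasDerivAt.comp (h₂ := quantile ν) u h1 g1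
    have k2 := HasDerivAt.comp (h₂ := quantile ν) u h2 g2
    exact (k1.const_mul (T * δ ^ (-(1 / p)))).sub k2
  have hanti : AntitoneOn
      (fun u => T * δ ^ (-(1 / p)) * quantile ν (1 - u) - quantile ν (1 - δ * u))
      (Set.Ioo (0 : ℝ) 1) := by
    apply antitoneOn_of_deriv_nonpos (convex_Ioo 0 1)
    · exact fun u hu => (hD u hu).continuousAt.continuousWithinAt
    · rw [interior_Ioo]
      exact fun u hu => (hD u hu).differentiableAt.differentiableWithinAt
    · rw [interior_Ioo]
      intro u hu
      rw [(hD u hu).deriv]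
      have h := hgrow δ hδ _ (hmem u hu)
      rw [sub_sub_cancel] at h
      have h3 := mul_le_mul_of_nonneg_left h hδ0.le
      have h4 : δ ^ (-(1 / p)) = δ * δ ^ (-(1 + 1 / p)) := by
        nth_rewrite 2 [← Real.rpow_one δ]
        rw [← Real.rpow_add hδ0]
        congr 1
        ring
      rw [h4]
      linarith
  have key : ∀ x ∈ Set.Ioo (0 : ℝ) 1, ∀ y ∈ Set.Ioo (0 : ℝ) 1, x ≤ y →
      |quantile ν (1 - δ * x) - quantile ν (1 - δ * y)| ≤
        T * δ ^ (-(1 / p)) * |quantile ν (1 - x) - quantile ν (1 - y)| := by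
    intro x hx y hy hxy
    have h := hanti hx hy hxy
    have m1 : quantile ν (1 - y) ≤ quantile ν (1 - x) :=
      quantile_mono_aux_s10 ν (hmem y hy).1 (by linarith) (hmem x hx).2
    have m2 : quantile ν (1 - δ * y) ≤ quantile ν (1 - δ * x) :=
      quantile_mono_aux_s10 ν (hmem _ (hmul y hy)).1
        (by linarith [mul_le_mul_of_nonneg_left hxy hδ0.le]) (hmem _ (hmul x hx)).2
    rw [abs_of_nonneg (sub_nonneg.2 m1), abs_of_nonneg (sub_nonneg.2 m2)]
    simp only at h
    linarith
  intro x hx y hy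
  rcases le_total x y with hxy | hxy
  · exact key x hx y hy hxy
  · rw [abs_sub_comm, abs_sub_comm (quantile ν (1 - x))]
    exact key y hy x hx hxy
end

section
/- Let Y be a real valued random variable with 𝔼|Y| < ∞ such that its quantile function H_Y is convex on (0,1) and satisfies |H_Y^*(δx) − H_Y^*(δy)| ≤ T·δ^{−1/p}·|H_Y^*(x) − H_Y^*(y)| for some p ∈ (1,∞), T ∈ [1,∞), and all δ, x, y ∈ (0,1), where H_Y^*(x) = H_Y(1−x). Let R > 1 satisfy T ≤ ((R−1)/2)·R^{−1/p}. Then for all x ∈ (0,1), H_Y^*(x/R) ≥ (1/x) ∫_0^x H_Y^*(u) du. -/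
open MeasureTheory Set

theorem aux_key (g : ℝ → ℝ) (R x ε : ℝ) (hR : 1 < R) (hx : x ∈ Ioo (0:ℝ) 1)
    (hanti : AntitoneOn g (Ioo 0 1)) (hconv : ConvexOn ℝ (Ioo (0:ℝ) 1) g)
    (hK : ∀ u ∈ Ioo (0:ℝ) 1, ∀ v ∈ Ioo (0:ℝ) 1,
      |g (u / R) - g (v / R)| ≤ (R - 1) / 2 * |g u - g v|)
    (hε : 0 < ε) (hεx : ε ≤ x / R) :
    ∫ u in ε..x, (g u - g x) ≤ x * (g (x / R) - g x) := by
  obtain ⟨hx0, hx1⟩ := hx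
  have hR0 : 0 < R := by linarith
  have hcont : ContinuousOn g (Ioo 0 1) := hconv.continuousOn isOpen_Ioo
  have ha0 : 0 < x / R := by positivity
  have hax : x / R < x := div_lt_self hx0 hR
  have hRε : R * ε ≤ x := by rw [le_div_iff₀ hR0] at hεx; linarith
  have hεR : ε ≤ R * ε := by nlinarith
  have hii : ∀ c a b, 0 < a → a ≤ b → b < 1 →
      IntervalIntegrable (fun u => g u - c) volume a b := by
    intro c a b h0 hab h1
    apply ContinuousOn.intervalIntegrable
    rw [uIcc_of_le hab]
    exact (hcont.mono (fun u hu => ⟨by linarith [hu.1], by linarith [hu.2]⟩)).sub continuousOn_const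
  set a := x / R with ha
  have hxa : x = R * a := by rw [ha]; field_simp
  -- first part
  have hA : R * ∫ u in ε..a, (g u - g a) ≤ (R - 1) / 2 * ∫ u in (R * ε)..x, (g u - g x) := by
    have h1 := intervalIntegral.integral_comp_div (a := R * ε) (b := x)
      (fun u => g u - g a) hR0.ne'
    have h2 : R * ε / R = ε := by field_simp
    rw [h2, ← ha, smul_eq_mul] at h1
    rw [← h1, ← intervalIntegral.integral_const_mul]
    apply intervalIntegral.integral_mono_on hRε
    · apply ContinuousOn.intervalIntegrable
      rw [uIcc_of_le hRε]
      refine ContinuousOn.sub (hcont.comp (by fun_prop) ?_) continuousOn_const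
      intro u hu
      have hu0 : 0 < u := by linarith [hu.1]
      refine ⟨by positivity, ?_⟩
      have : u / R < u := div_lt_self hu0 hR
      linarith [hu.2]
    · exact (hii _ _ _ (by linarith) hRε hx1).const_mul _
    · intro u hu
      have hu0 : u ∈ Ioo (0:ℝ) 1 := ⟨by linarith [hu.1], by linarith [hu.2]⟩
      have h3 := hK u hu0 x ⟨hx0, hx1⟩
      have h4 := hanti hu0 ⟨hx0, hx1⟩ hu.2
      rw [abs_of_nonneg (by linarith : 0 ≤ g u - g x)] at h3
      exact (le_abs_self _).trans h3
  have hnn : 0 ≤ ∫ u in ε..(R * ε), (g u - g x) := by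
    apply intervalIntegral.integral_nonneg hεR
    intro u hu
    have h4 := hanti (a := u) (b := x) ⟨by linarith [hu.1], by linarith [hu.2]⟩ ⟨hx0, hx1⟩
      (by linarith [hu.2])
    linarith
  have hs1 := intervalIntegral.integral_add_adjacent_intervals
    (hii (g x) ε (R * ε) hε hεR (by linarith)) (hii (g x) (R * ε) x (by linarith) hRε hx1)
  have hs2 := intervalIntegral.integral_add_adjacent_intervals
    (hii (g x) ε a hε hεx (by linarith)) (hii (g x) a x ha0 hax.le hx1)
  have hs3 : ∫ u in ε..a, (g u - g x) = (∫ u in ε..a, (g u - g a)) + (a - ε) * (g a - g x) := by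
    rw [← smul_eq_mul (a := a - ε), ← intervalIntegral.integral_const,
      ← intervalIntegral.integral_add (hii _ _ _ hε hεx (by linarith)) (by simp)]
    congr 1
    ext u
    ring
  have hC : ∫ u in a..x, (g u - g x) ≤ (x - a) / 2 * (g a - g x) := by
    have h5 : ∫ u in a..x, (x - u) * ((g a - g x) / (x - a)) = (x - a) / 2 * (g a - g x) := by
      rw [intervalIntegral.integral_mul_const, intervalIntegral.integral_sub (by simp) (by simp)]
      simp only [intervalIntegral.integral_const, integral_id, smul_eq_mul]
      have : x - a ≠ 0 := by linarith
      field_simp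
      ring
    rw [← h5]
    apply intervalIntegral.integral_mono_on hax.le (hii _ _ _ ha0 hax.le hx1)
    · exact Continuous.intervalIntegrable (by fun_prop) _ _
    · intro u hu
      have hd : 0 < x - a := by linarith
      have h6 := hconv.2 (show a ∈ Ioo (0:ℝ) 1 from ⟨ha0, by linarith⟩)
        (show x ∈ Ioo (0:ℝ) 1 from ⟨hx0, hx1⟩)
        (show 0 ≤ (x - u) / (x - a) from div_nonneg (by linarith [hu.2]) hd.le)
        (show 0 ≤ (u - a) / (x - a) from div_nonneg (by linarith [hu.1]) hd.le)
        (by field_simp; ring)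
      simp only [smul_eq_mul] at h6
      have h7 : (x - u) / (x - a) * a + (u - a) / (x - a) * x = u := by field_simp; ring
      rw [h7] at h6
      have h8 : (x - u) / (x - a) * g a + (u - a) / (x - a) * g x
        = (x - u) * ((g a - g x) / (x - a)) + g x := by field_simp; ring
      linarith
  have hD : 0 ≤ g a - g x := by
    have := hanti (a := a) (b := x) ⟨ha0, by linarith⟩ ⟨hx0, hx1⟩ hax.le
    linarith
  set J := ∫ u in ε..x, (g u - g x)
  set A := ∫ u in ε..a, (g u - g a)
  set D := g a - g x
  have hA2 : R * A ≤ (R - 1) / 2 * J :=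
    hA.trans (mul_le_mul_of_nonneg_left (by linarith) (by linarith))
  have hJ : J ≤ A + (a - ε) * D + (x - a) / 2 * D := by linarith
  have hJ2 : J ≤ A + (x + a) / 2 * D := by nlinarith
  have hJ3 : R * J ≤ R * (A + (x + a) / 2 * D) := mul_le_mul_of_nonneg_left hJ2 hR0.le
  have hJ4 : (R + 1) / 2 * J ≤ (R + 1) / 2 * (x * D) := by
    have : R * ((x + a) / 2 * D) = (R + 1) / 2 * (x * D) := by rw [hxa]; ring
    linarith
  exact le_of_mul_le_mul_left hJ4 (by linarith)

theorem aux_main (g : ℝ → ℝ) (R x : ℝ) (hR : 1 < R) (hx : x ∈ Ioo (0:ℝ) 1)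
    (hanti : AntitoneOn g (Ioo 0 1)) (hconv : ConvexOn ℝ (Ioo (0:ℝ) 1) g)
    (hK : ∀ u ∈ Ioo (0:ℝ) 1, ∀ v ∈ Ioo (0:ℝ) 1,
      |g (u / R) - g (v / R)| ≤ (R - 1) / 2 * |g u - g v|) :
    (1 / x) * ∫ u in (0:ℝ)..x, g u ≤ g (x / R) := by
  have hkey := fun ε => aux_key g R x ε hR hx hanti hconv hK
  have hx' := hx
  obtain ⟨hx0, hx1⟩ := hx
  have hR0 : 0 < R := by linarith
  have hcont : ContinuousOn g (Ioo 0 1) := hconv.continuousOn isOpen_Ioo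
  have ha0 : 0 < x / R := by positivity
  have hax : x / R < x := div_lt_self hx0 hR
  have hseq0 : ∀ n : ℕ, 0 < x / R / ((n:ℝ) + 1) := fun n => by positivity
  have hseq1 : ∀ n : ℕ, x / R / ((n:ℝ) + 1) ≤ x / R := fun n =>
    div_le_self ha0.le (by linarith [(Nat.cast_nonneg n : (0:ℝ) ≤ n)])
  have hlim : Filter.Tendsto (fun n : ℕ => x / R / ((n:ℝ) + 1)) Filter.atTop (nhds 0) := by
    have := (tendsto_one_div_add_atTop_nhds_zero_nat (𝕜 := ℝ)).const_mul (x / R)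
    simpa [div_eq_mul_inv] using this
  have hI : IntegrableOn (fun u => g u - g x) (Ioc 0 x) := by
    refine integrableOn_Ioc_of_intervalIntegral_norm_bounded_left
      (I := x * (g (x / R) - g x)) (a := fun n : ℕ => x / R / ((n:ℝ) + 1)) (l := Filter.atTop)
      ?_ hlim ?_
    · intro n
      refine IntegrableOn.mono_set (ContinuousOn.integrableOn_Icc ?_) Ioc_subset_Icc_self
      exact (hcont.mono (fun u hu => ⟨by linarith [hu.1, hseq0 n], by linarith [hu.2]⟩)).sub
        continuousOn_const
    · refine Filter.Eventually.of_forall (fun n => ?_)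
      refine le_trans (le_of_eq ?_) (hkey _ (hseq0 n) (hseq1 n))
      rw [intervalIntegral.integral_of_le (by linarith [hseq1 n])]
      refine setIntegral_congr_fun measurableSet_Ioc (fun u hu => ?_)
      have := hanti (a := u) (b := x) ⟨by linarith [hu.1, hseq0 n], by linarith [hu.2]⟩ hx' hu.2
      exact Real.norm_of_nonneg (by linarith)
  have hI2 : IntervalIntegrable (fun u => g u - g x) volume 0 x :=
    (intervalIntegrable_iff_integrableOn_Ioc_of_le hx0.le).2 hI
  have hI3 : IntegrableOn (fun u => g u - g x) (uIcc 0 x) := by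
    rw [uIcc_of_le hx0.le, integrableOn_Icc_iff_integrableOn_Ioc]; exact hI
  have hc := intervalIntegral.continuousOn_primitive_interval_left hI3 0 left_mem_uIcc
  have hbound : ∫ u in (0:ℝ)..x, (g u - g x) ≤ x * (g (x / R) - g x) := by
    refine le_of_tendsto (hc.tendsto.comp (tendsto_nhdsWithin_iff.2 ⟨hlim, ?_⟩)) ?_
    · refine Filter.Eventually.of_forall (fun n => ?_)
      rw [uIcc_of_le hx0.le]
      exact ⟨(hseq0 n).le, by linarith [hseq1 n]⟩
    · exact Filter.Eventually.of_forall (fun n => hkey _ (hseq0 n) (hseq1 n))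
  have hg : ∫ u in (0:ℝ)..x, g u = (∫ u in (0:ℝ)..x, (g u - g x)) + x * g x := by
    have h := intervalIntegral.integral_add hI2
      (intervalIntegrable_const (c := g x) (μ := volume) (a := 0) (b := x))
    simpa using h
  rw [hg, one_div, inv_mul_le_iff₀ hx0]
  linarith

theorem aux_mono (ν : Measure ℝ) [IsProbabilityMeasure ν] :
    MonotoneOn (quantile ν) (Ioo 0 1) := by
  intro s hs t ht hst
  have hF : ∀ y, (ν (Iic y)).toReal = ProbabilityTheory.cdf ν y := fun y => by
    rw [ProbabilityTheory.cdf_eq_real]; rfl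
  unfold quantile
  simp only [hF]
  apply csInf_le_csInf
  · obtain ⟨b, hb⟩ := ((ProbabilityTheory.tendsto_cdf_atBot ν).eventually_lt_const hs.1).exists
    refine ⟨b, fun y hy => ?_⟩
    by_contra! hlt
    have := ProbabilityTheory.monotone_cdf ν hlt.le
    simp only [mem_setOf_eq] at hy
    linarith
  · obtain ⟨b, hb⟩ := ((ProbabilityTheory.tendsto_cdf_atTop ν).eventually_const_lt ht.2).exists
    exact ⟨b, hb.le⟩
  · intro y hy
    exact hst.trans hy

/-- Suppose `𝔼|Y| < ∞`, the quantile function `H_Y` is convex on `(0,1)`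
and satisfies `|H_Y^*(δx) − H_Y^*(δy)| ≤ T δ^{−1/p} |H_Y^*(x) − H_Y^*(y)|` for some
`p ∈ (1,∞)`, `T ∈ [1,∞)` and all `δ, x, y ∈ (0,1)`, where `H_Y^*(u) = H_Y(1−u)`.
If `R > 1` satisfies `T ≤ ((R−1)/2)·R^{−1/p}`, then for all `x ∈ (0,1)`,
`H_Y^*(x/R) ≥ (1/x) ∫₀ˣ H_Y^*(u) du`. -/
theorem stmt_11 (ν : Measure ℝ) [IsProbabilityMeasure ν]
    (hint : ∫⁻ x, ENNReal.ofReal |x| ∂ν < ⊤)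
    (hconv : ConvexOn ℝ (Set.Ioo (0 : ℝ) 1) (quantile ν))
    (p T R : ℝ) (hp : 1 < p) (hT : 1 ≤ T) (hR : 1 < R)
    (hTR : T ≤ (R - 1) / 2 * R ^ (-(1 / p)))
    (hlip : ∀ δ ∈ Set.Ioo (0 : ℝ) 1, ∀ x ∈ Set.Ioo (0 : ℝ) 1, ∀ y ∈ Set.Ioo (0 : ℝ) 1,
      |quantile ν (1 - δ * x) - quantile ν (1 - δ * y)| ≤
        T * δ ^ (-(1 / p)) * |quantile ν (1 - x) - quantile ν (1 - y)|) :
    ∀ x ∈ Set.Ioo (0 : ℝ) 1,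
      (1 / x) * ∫ u in (0 : ℝ)..x, quantile ν (1 - u) ≤ quantile ν (1 - x / R) := by
  intro x hx
  have hR0 : 0 < R := by linarith
  have hm : ∀ u ∈ Ioo (0:ℝ) 1, 1 - u ∈ Ioo (0:ℝ) 1 := fun u hu =>
    ⟨by linarith [hu.2], by linarith [hu.1]⟩
  refine aux_main (fun u => quantile ν (1 - u)) R x hR hx ?_ ?_ ?_
  · intro u hu v hv huv
    exact aux_mono ν (hm v hv) (hm u hu) (by linarith)
  · refine ⟨convex_Ioo 0 1, fun u hu v hv a b ha hb hab => ?_⟩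
    have h := hconv.2 (hm u hu) (hm v hv) ha hb hab
    have e : 1 - (a • u + b • v) = a • (1 - u) + b • (1 - v) := by
      simp only [smul_eq_mul]
      linear_combination -hab
    simp only [e]
    exact h
  · intro u hu v hv
    have h := hlip R⁻¹ ⟨by positivity, inv_lt_one_of_one_lt₀ hR⟩ u hu v hv
    have e : T * R⁻¹ ^ (-(1 / p)) ≤ (R - 1) / 2 := by
      have hpos : 0 < R ^ (-(1 / p)) := Real.rpow_pos_of_pos hR0 _
      rw [Real.inv_rpow hR0.le, ← div_eq_mul_inv, div_le_iff₀ hpos]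
      exact hTR
    simp only [div_eq_inv_mul u, div_eq_inv_mul v]
    exact h.trans (mul_le_mul_of_nonneg_right e (abs_nonneg _))
end

section
/- Define ξ₁: [0,1] → [0,1] by ξ₁(t) = e^t(1−t) and ξ₂: [0,∞) → (0,1] by ξ₂(t) = e^{−t}(1+t). Then their inverse functions satisfy: ξ₁^{-1}(t) ≤ min{√(2(1−t)), 1 − e^{-1}t} for all 0 ≤ t ≤ 1; ξ₂^{-1}(t) ≤ log(1/t) + log(1 + 4 log(1/t)) for all 0 < t ≤ 2e^{-1}; and ξ₂^{-1}(t) ≤ √(2 log(1/t) + 10 (log(1/t))^{3/2}) for all 2e^{-1} ≤ t ≤ 1. -/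
open Real

/-- With `ξ₁(s) = eˢ(1−s)` on `[0,1]` and `ξ₂(s) = e^{−s}(1+s)` on `[0,∞)`
(both strictly decreasing bijections), the inverse functions satisfy:
`ξ₁⁻¹(t) ≤ min{√(2(1−t)), 1 − e⁻¹ t}` for `0 ≤ t ≤ 1`;
`ξ₂⁻¹(t) ≤ log(1/t) + log(1 + 4 log(1/t))` for `0 < t ≤ 2e⁻¹`; and
`ξ₂⁻¹(t) ≤ √(2 log(1/t) + 10 (log(1/t))^{3/2})` for `2e⁻¹ ≤ t ≤ 1`.
(The inverse value is expressed through the unique solution `s` of the defining equation.) -/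
theorem stmt_12 :
    (∀ t s : ℝ, t ∈ Set.Icc (0 : ℝ) 1 → s ∈ Set.Icc (0 : ℝ) 1 →
      Real.exp s * (1 - s) = t →
      s ≤ min (Real.sqrt (2 * (1 - t))) (1 - (Real.exp 1)⁻¹ * t)) ∧
    (∀ t s : ℝ, 0 < t → t ≤ 2 * (Real.exp 1)⁻¹ → 0 ≤ s →
      Real.exp (-s) * (1 + s) = t →
      s ≤ Real.log (1 / t) + Real.log (1 + 4 * Real.log (1 / t))) ∧
    (∀ t s : ℝ, 2 * (Real.exp 1)⁻¹ ≤ t → t ≤ 1 → 0 ≤ s →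
      Real.exp (-s) * (1 + s) = t →
      s ≤ Real.sqrt (2 * Real.log (1 / t) + 10 * Real.log (1 / t) ^ ((3 : ℝ) / 2))) := by
  refine ⟨?_, ?_, ?_⟩
  · rintro t s ⟨ht0, ht1⟩ ⟨hs0, hs1⟩ h
    apply le_min
    · apply Real.le_sqrt_of_sq_le
      have hb := Real.exp_bound (x := -s) (by rw [abs_neg, abs_of_nonneg hs0]; exact hs1)
        (n := 4) (by norm_num)
      rw [abs_neg, abs_of_nonneg hs0] at hb
      have hb2 := (abs_le.mp hb).1
      norm_num [Finset.sum_range_succ, Nat.factorial] at hb2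
      have h3 : 0 ≤ s ^ 3 := by positivity
      have h5 : 0 ≤ s ^ 3 * (1 - s) := mul_nonneg h3 (by linarith)
      have hE : 1 - s + s ^ 2 / 2 - s ^ 3 / 6 - 5 / 96 * s ^ 4 ≤ Real.exp (-s) := by
        nlinarith
      have hq : 0 ≤ 1 - s ^ 2 / 2 := by nlinarith
      have h6 : 1 - s ≤ (1 - s ^ 2 / 2) * Real.exp (-s) := by
        have := mul_le_mul_of_nonneg_left hE hq
        have h7 : 0 ≤ s ^ 5 := by positivity
        have h8 : 0 ≤ s ^ 6 := by positivity
        nlinarith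
      have h9 : Real.exp s * (1 - s) ≤ 1 - s ^ 2 / 2 := by
        have := mul_le_mul_of_nonneg_left h6 (Real.exp_pos s).le
        have e : Real.exp s * Real.exp (-s) = 1 := by rw [← Real.exp_add]; simp
        calc _ ≤ _ := this
          _ = (1 - s ^ 2 / 2) * (Real.exp s * Real.exp (-s)) := by ring
          _ = _ := by rw [e, mul_one]
      linarith
    · have : (Real.exp 1)⁻¹ * t ≤ 1 - s := by
        rw [← h, ← mul_assoc, ← Real.exp_neg, ← Real.exp_add]
        have : Real.exp (-1 + s) ≤ 1 := Real.exp_le_one_iff.mpr (by linarith)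
        nlinarith
      linarith
  · intro t s ht0 ht hs h
    have hL : Real.log (1 / t) = s - Real.log (1 + s) := by
      rw [← h, one_div, Real.log_inv, Real.log_mul (Real.exp_pos _).ne' (by linarith), Real.log_exp]
      ring
    have hs1 : 1 ≤ s := by
      by_contra hc
      push Not at hc
      have h1 : Real.exp 1 * t ≤ 2 := by
        have := mul_le_mul_of_nonneg_left ht (Real.exp_pos 1).le
        have e : Real.exp 1 * (2 * (Real.exp 1)⁻¹) = 2 := by
          field_simp
        linarith
      rw [← h, ← mul_assoc, ← Real.exp_add] at h1
      have h2 : 1 + -s + 1 < Real.exp (1 + -s) := Real.add_one_lt_exp (by linarith)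
      nlinarith
    have hlog : Real.log (1 + s) ≤ 3 / 4 * s := by
      have e : 1 + s = 2 * ((1 + s) / 2) := by ring
      rw [e, Real.log_mul (by norm_num) (by linarith)]
      have := Real.log_le_sub_one_of_pos (x := (1 + s) / 2) (by linarith)
      have := Real.log_two_lt_d9
      linarith
    have : Real.log (1 + s) ≤ Real.log (1 + 4 * Real.log (1 / t)) :=
      Real.log_le_log (by linarith) (by rw [hL]; linarith)
    linarith
  · intro t s ht ht1 hs h
    have hL : Real.log (1 / t) = s - Real.log (1 + s) := by
      rw [← h, one_div, Real.log_inv, Real.log_mul (Real.exp_pos _).ne' (by linarith), Real.log_exp]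
      ring
    have hs1 : s ≤ 1 := by
      by_contra hc
      push Not at hc
      have h1 : 2 * Real.exp (s - 1) ≤ 1 + s := by
        have := mul_le_mul_of_nonneg_left ht (Real.exp_pos s).le
        rw [← h, ← mul_assoc (Real.exp s) (Real.exp (-s)), ← Real.exp_add, ← Real.exp_neg] at this
        rw [sub_eq_add_neg, Real.exp_add]
        simp only [add_neg_cancel, Real.exp_zero] at this
        linarith
      have h2 : s - 1 + 1 < Real.exp (s - 1) := Real.add_one_lt_exp (by linarith)
      linarith
    have hl : Real.log (1 + s) ≤ ((1 + s) - (1 + s)⁻¹) / 2 := by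
      rw [← Real.sinh_log (by linarith)]
      exact Real.self_le_sinh_iff.mpr (Real.log_nonneg (by linarith))
    have hL2 : s ^ 2 / (2 * (1 + s)) ≤ Real.log (1 / t) := by
      rw [hL]
      have e : s ^ 2 / (2 * (1 + s)) = s - ((1 + s) - (1 + s)⁻¹) / 2 := by
        have : 1 + s ≠ 0 := by linarith
        field_simp
        ring
      linarith
    have hL4 : (s / 2) ^ 2 ≤ Real.log (1 / t) := by
      refine le_trans ?_ hL2
      rw [le_div_iff₀ (by linarith)]
      nlinarith [mul_nonneg (sq_nonneg s) (sub_nonneg.mpr hs1)]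
    have hp : (s / 2) ^ 3 ≤ Real.log (1 / t) ^ ((3 : ℝ) / 2) := by
      have := Real.rpow_le_rpow (sq_nonneg _) hL4 (show (0 : ℝ) ≤ 3 / 2 by norm_num)
      refine le_trans (le_of_eq ?_) this
      rw [← Real.rpow_natCast (s / 2) 2, ← Real.rpow_mul (by linarith),
        ← Real.rpow_natCast (s / 2) 3]
      norm_num
    apply Real.le_sqrt_of_sq_le
    have h5 : s ^ 2 ≤ 2 * (s ^ 2 / (2 * (1 + s))) + s ^ 3 := by
      have e : 2 * (s ^ 2 / (2 * (1 + s))) + s ^ 3 - s ^ 2 = s ^ 4 / (1 + s) := by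
        have : 1 + s ≠ 0 := by linarith
        field_simp
        ring
      have : 0 ≤ s ^ 4 / (1 + s) := by positivity
      linarith
    have h6 : 0 ≤ s ^ 3 := by positivity
    nlinarith
end

section
/- Let (γ_i)_{i=1}^n be an i.i.d. sample from the uniform distribution on (0,1) with order statistics γ_{(1)} ≤ … ≤ γ_{(n)}, and let t > 0. Then with probability at least 1 − (π²/3)·exp(−t²/2), the following event occurs: for all 1 ≤ k ≤ n, γ_{(k)} is bounded above by both (k/(n+1))·(1 + ξ₂^{-1}(exp((−t² − 4 log k)/(2k)))) and 1 − ((n−k+1)/(n+1))·(1 − ξ₁^{-1}(exp((−t² − 4 log(n−k+1))/(2(n−k+1))))). -/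
open MeasureTheory Set

/-- The `k`-th order statistic (`0`-indexed: `orderStat v k` is the `(k+1)`-th smallest
value) of a tuple `v : Fin n → ℝ`. -/
noncomputable def orderStat {n : ℕ} (v : Fin n → ℝ) (k : Fin n) : ℝ :=
  v (Tuple.sort v k)

/-- The inverse of the strictly decreasing bijection `ξ₁ : [0,1] → [0,1]`,
`ξ₁(s) = eˢ(1−s)`. -/
noncomputable def xi1inv (y : ℝ) : ℝ :=
  sInf {s : ℝ | 0 ≤ s ∧ Real.exp s * (1 - s) ≤ y}

/-- The inverse of the strictly decreasing bijection `ξ₂ : [0,∞) → (0,1]`,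
`ξ₂(s) = e^{−s}(1+s)`. -/
noncomputable def xi2inv (y : ℝ) : ℝ :=
  sInf {s : ℝ | 0 ≤ s ∧ Real.exp (-s) * (1 + s) ≤ y}

lemma int_aux (x a b : ℝ) (hx0 : 0 ≤ x) (hx1 : x ≤ 1) :
    ∫ u in Set.Ioo (0:ℝ) 1, (if x < u then a else b) = (1 - x) * a + x * b := by
  have h : ∀ u : ℝ, (if x < u then a else b) = (Set.Ioi x).indicator (fun _ => a - b) u + b := by
    intro u
    by_cases hu : x < u <;> simp [hu]
  simp_rw [h]
  rw [integral_add]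
  · rw [integral_indicator measurableSet_Ioi, Measure.restrict_restrict measurableSet_Ioi]
    have : Set.Ioi x ∩ Set.Ioo (0:ℝ) 1 = Set.Ioo x 1 := by
      ext u
      simp only [mem_inter_iff, mem_Ioi, mem_Ioo]
      constructor
      · rintro ⟨h1, h2, h3⟩; exact ⟨h1, h3⟩
      · rintro ⟨h1, h2⟩; exact ⟨h1, by linarith, h2⟩
    rw [this]
    simp [hx1]
    ring
  · exact (integrable_const _).indicator measurableSet_Ioi
  · exact integrable_const _

lemma card_lt_aux {n : ℕ} (i : Fin n) (a b : ℝ) :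
    ∏ l : Fin n, (if i ≤ l then a else b) = a ^ (n - (i:ℕ)) * b ^ (i:ℕ) := by
  rw [Finset.prod_ite, Finset.prod_const, Finset.prod_const]
  congr 2
  · rw [← Fin.card_Ici]; congr 1; ext l; simp
  · rw [← Fin.card_Iio]; congr 1; ext l; simp

lemma prod_aux {n : ℕ} (v : Fin n → ℝ) (i : Fin n) (x a b : ℝ) (hb : 0 ≤ b) (hab : b ≤ a)
    (h : x < orderStat v i) :
    a ^ (n - (i:ℕ)) * b ^ (i:ℕ) ≤ ∏ l, (if x < v l then a else b) := by
  rw [← card_lt_aux, ← Equiv.prod_comp (Tuple.sort v) (fun l => if x < v l then a else b)]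
  apply Finset.prod_le_prod
  · intro l _
    split_ifs
    · exact hb.trans hab
    · exact hb
  · intro l _
    by_cases hl : i ≤ l
    · have hm := Tuple.monotone_sort v hl
      have : x < v (Tuple.sort v l) := lt_of_lt_of_le h hm
      simp [hl, this]
    · simp only [hl, if_false]
      split_ifs
      · exact hab
      · exact le_rfl

lemma chernoff {Ω : Type*} [MeasurableSpace Ω] (μ : Measure Ω) [IsProbabilityMeasure μ]
    (n : ℕ) (γ : Fin n → Ω → ℝ) (hmeas : ∀ i, Measurable (γ i))
    (hiid : μ.map (fun ω i => γ i ω) =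
      Measure.pi (fun _ : Fin n => volume.restrict (Set.Ioo (0 : ℝ) 1)))
    (i : Fin n) (x a b : ℝ) (hx0 : 0 ≤ x) (hx1 : x ≤ 1) (hb : 0 ≤ b) (hab : b ≤ a) :
    μ.real {ω | x < orderStat (fun i' => γ i' ω) i} * (a ^ (n - (i:ℕ)) * b ^ (i:ℕ)) ≤
      ((1 - x) * a + x * b) ^ n := by
  set f : ℝ → ℝ := fun u => if x < u then a else b with hf
  have hfm : Measurable f := Measurable.ite measurableSet_Ioi measurable_const measurable_const
  have hf0 : ∀ u, 0 ≤ f u := by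
    intro u; simp only [hf]; split_ifs
    · exact hb.trans hab
    · exact hb
  have hfa : ∀ u, f u ≤ a := by
    intro u; simp only [hf]; split_ifs
    · exact le_rfl
    · exact hab
  have hint : Integrable (fun ω => ∏ l, f (γ l ω)) μ := by
    refine Integrable.of_bound (C := a ^ n) ?_ ?_
    · apply Measurable.aestronglyMeasurable
      exact Finset.measurable_prod _ (fun l _ => hfm.comp (hmeas l))
    · refine ae_of_all _ fun ω => ?_
      rw [Real.norm_of_nonneg (Finset.prod_nonneg fun l _ => hf0 _)]
      calc ∏ l, f (γ l ω) ≤ ∏ l : Fin n, a :=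
            Finset.prod_le_prod (fun l _ => hf0 _) (fun l _ => hfa _)
        _ = a ^ n := by simp
  have hI : ∫ ω, ∏ l, f (γ l ω) ∂μ = ((1 - x) * a + x * b) ^ n := by
    have hg : AEStronglyMeasurable (fun v : Fin n → ℝ => ∏ l, f (v l))
        (μ.map (fun ω i => γ i ω)) := by
      apply Measurable.aestronglyMeasurable
      exact Finset.measurable_prod _ (fun l _ => hfm.comp (measurable_pi_apply l))
    have h1 := integral_map (measurable_pi_lambda _ hmeas).aemeasurable hg
    rw [← h1, hiid, integral_fintype_prod_eq_pow f, int_aux x a b hx0 hx1]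
    simp
  have hM := mul_meas_ge_le_integral_of_nonneg
    (ae_of_all μ fun ω => Finset.prod_nonneg fun l _ => hf0 (γ l ω)) hint
    (a ^ (n - (i:ℕ)) * b ^ (i:ℕ))
  rw [hI, mul_comm] at hM
  refine le_trans (mul_le_mul_of_nonneg_right ?_ ?_) hM
  · refine measureReal_mono (fun ω hω => ?_)
    exact prod_aux _ i x a b hb hab hω
  · have : 0 ≤ a := hb.trans hab
    positivity

lemma tail_one {Ω : Type*} [MeasurableSpace Ω] (μ : Measure Ω) [IsProbabilityMeasure μ]
    (n : ℕ) (γ : Fin n → Ω → ℝ) (hmeas : ∀ i, Measurable (γ i))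
    (hiid : μ.map (fun ω i => γ i ω) =
      Measure.pi (fun _ : Fin n => volume.restrict (Set.Ioo (0 : ℝ) 1)))
    (i : Fin n) (x : ℝ) (hx : 1 ≤ x) :
    μ.real {ω | x < orderStat (fun i' => γ i' ω) i} = 0 := by
  have hle : μ.real {ω | x < orderStat (fun i' => γ i' ω) i} ≤
      μ.real {ω | 1 < orderStat (fun i' => γ i' ω) i} :=
    measureReal_mono fun ω hω => lt_of_le_of_lt hx hω
  set P := μ.real {ω | 1 < orderStat (fun i' => γ i' ω) i} with hP
  have hP0 : 0 ≤ P := measureReal_nonneg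
  have hP1 : P ≤ 1 := measureReal_le_one
  rcases hP0.eq_or_lt with h | h
  · exact le_antisymm (hle.trans h.symm.le) measureReal_nonneg
  exfalso
  have h2 : 1 ≤ 2 / P := by rw [le_div_iff₀ h]; linarith
  have hc := chernoff μ n γ hmeas hiid i 1 (2 / P) 1 zero_le_one le_rfl zero_le_one h2
  rw [← hP] at hc
  have hpow : 2 / P ≤ (2 / P) ^ (n - (i:ℕ)) := le_self_pow₀ h2 (by have := i.2; omega)
  have : P * (2 / P) = 2 := by field_simp
  have h3 := mul_le_mul_of_nonneg_left hpow hP0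
  simp at hc
  linarith

lemma tailA {Ω : Type*} [MeasurableSpace Ω] (μ : Measure Ω) [IsProbabilityMeasure μ]
    (n : ℕ) (γ : Fin n → Ω → ℝ) (hmeas : ∀ i, Measurable (γ i))
    (hiid : μ.map (fun ω i => γ i ω) =
      Measure.pi (fun _ : Fin n => volume.restrict (Set.Ioo (0 : ℝ) 1)))
    (i : Fin n) (s : ℝ) (hs : 0 ≤ s) :
    μ.real {ω | ((i : ℝ) + 1) / ((n : ℝ) + 1) * (1 + s) < orderStat (fun i' => γ i' ω) i} ≤
      (Real.exp (-s) * (1 + s)) ^ ((i:ℕ) + 1) := by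
  have hs1 : 0 < 1 + s := by linarith
  rcases le_total 1 (((i : ℝ) + 1) / ((n : ℝ) + 1) * (1 + s)) with hx | hx
  · rw [tail_one μ n γ hmeas hiid i _ hx]; positivity
  set x := ((i : ℝ) + 1) / ((n : ℝ) + 1) * (1 + s) with hxd
  have hx0 : 0 ≤ x := by positivity
  have hz1 : 1 / (1 + s) ≤ 1 := by rw [div_le_one hs1]; linarith
  have hc := chernoff μ n γ hmeas hiid i x 1 (1 / (1 + s)) hx0 hx (by positivity) hz1
  set P := μ.real {ω | x < orderStat (fun i' => γ i' ω) i} with hP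
  set z := 1 / (1 + s) with hz
  have hz0 : 0 < z := by positivity
  set w := (1 - x) * 1 + x * z with hw
  have hzw : z ≤ w := by nlinarith
  have hw0 : 0 ≤ w := hz0.le.trans hzw
  have hwe : w ≤ Real.exp (-(((i:ℝ) + 1) * s / (n + 1))) := by
    have : w = -(((i:ℝ) + 1) * s / (n + 1)) + 1 := by
      rw [hw, hz, hxd]; field_simp; ring
    rw [this]; exact Real.add_one_le_exp _
  have hfin : P * z ^ ((i:ℕ) + 1) ≤ Real.exp (-s) ^ ((i:ℕ) + 1) := by
    calc P * z ^ ((i:ℕ) + 1) = (P * (1 ^ (n - (i:ℕ)) * z ^ (i:ℕ))) * z := by rw [pow_succ]; ring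
      _ ≤ w ^ n * w := mul_le_mul hc hzw hz0.le (by positivity)
      _ = w ^ (n + 1) := by rw [pow_succ]
      _ ≤ Real.exp (-(((i:ℝ) + 1) * s / (n + 1))) ^ (n + 1) := pow_le_pow_left₀ hw0 hwe _
      _ = Real.exp (-s) ^ ((i:ℕ) + 1) := by
        rw [← Real.exp_nat_mul, ← Real.exp_nat_mul]; congr 1; push_cast; field_simp
  have hzs : z * (1 + s) = 1 := by rw [hz]; field_simp
  calc P = P * z ^ ((i:ℕ) + 1) * (1 + s) ^ ((i:ℕ) + 1) := by
        rw [mul_assoc, ← mul_pow, hzs]; simp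
    _ ≤ Real.exp (-s) ^ ((i:ℕ) + 1) * (1 + s) ^ ((i:ℕ) + 1) := by gcongr
    _ = _ := by rw [mul_pow]

lemma tailB {Ω : Type*} [MeasurableSpace Ω] (μ : Measure Ω) [IsProbabilityMeasure μ]
    (n : ℕ) (γ : Fin n → Ω → ℝ) (hmeas : ∀ i, Measurable (γ i))
    (hiid : μ.map (fun ω i => γ i ω) =
      Measure.pi (fun _ : Fin n => volume.restrict (Set.Ioo (0 : ℝ) 1)))
    (i : Fin n) (j : ℕ) (hj : j = n - (i:ℕ)) (s : ℝ) (hs : 0 ≤ s) (hs1 : s ≤ 1) :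
    μ.real {ω | 1 - (j : ℝ) / ((n : ℝ) + 1) * (1 - s) < orderStat (fun i' => γ i' ω) i} ≤
      (Real.exp s * (1 - s)) ^ j := by
  rcases hs1.eq_or_lt with h | h
  · rw [tail_one μ n γ hmeas hiid i _ (by rw [h]; simp)]
    have : 0 ≤ 1 - s := by linarith
    positivity
  have hs1 : 0 < 1 - s := by linarith
  have hjn : (j:ℝ) / ((n:ℝ) + 1) ≤ 1 := by
    rw [div_le_one (by positivity)]
    have : j ≤ n := by omega
    have : (j:ℝ) ≤ n := by exact_mod_cast this
    linarith
  have hj0 : 0 ≤ (j:ℝ) / ((n:ℝ) + 1) := by positivity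
  set x := 1 - (j : ℝ) / ((n : ℝ) + 1) * (1 - s) with hxd
  have hx0 : 0 ≤ x := by rw [hxd]; nlinarith
  have hx1 : x ≤ 1 := by rw [hxd]; nlinarith
  have hz1 : 1 ≤ 1 / (1 - s) := by rw [le_div_iff₀ hs1]; linarith
  have hc := chernoff μ n γ hmeas hiid i x (1 / (1 - s)) 1 hx0 hx1 zero_le_one hz1
  rw [← hj] at hc
  set P := μ.real {ω | x < orderStat (fun i' => γ i' ω) i} with hP
  set z := 1 / (1 - s) with hz
  set w := (1 - x) * z + x * 1 with hw
  have hweq : w = (j:ℝ) * s / (n + 1) + 1 := by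
    rw [hw, hz, hxd]; field_simp; ring
  have hw1 : 1 ≤ w := by
    rw [hweq]
    have : 0 ≤ (j:ℝ) * s / (n + 1) := by positivity
    linarith
  have hwe : w ≤ Real.exp ((j:ℝ) * s / (n + 1)) := by
    rw [hweq]; exact Real.add_one_le_exp _
  have hfin : P * z ^ j ≤ Real.exp s ^ j := by
    calc P * z ^ j = P * (z ^ j * 1 ^ (i:ℕ)) := by simp
      _ ≤ w ^ n := hc
      _ ≤ w ^ (n + 1) := pow_le_pow_right₀ hw1 (by omega)
      _ ≤ Real.exp ((j:ℝ) * s / (n + 1)) ^ (n + 1) := pow_le_pow_left₀ (by linarith) hwe _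
      _ = Real.exp s ^ j := by
        rw [← Real.exp_nat_mul, ← Real.exp_nat_mul]; congr 1; push_cast; field_simp
  have hzs : z * (1 - s) = 1 := by rw [hz]; field_simp
  calc P = P * z ^ j * (1 - s) ^ j := by
        rw [mul_assoc, ← mul_pow, hzs]; simp
    _ ≤ Real.exp s ^ j * (1 - s) ^ j := by gcongr
    _ = _ := by rw [mul_pow]

lemma xi1_spec (y : ℝ) (hy : 0 < y) :
    0 ≤ xi1inv y ∧ xi1inv y ≤ 1 ∧ Real.exp (xi1inv y) * (1 - xi1inv y) ≤ y := by
  have hbdd : BddBelow {s : ℝ | 0 ≤ s ∧ Real.exp s * (1 - s) ≤ y} := ⟨0, fun s hs => hs.1⟩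
  have h1 : (1:ℝ) ∈ {s : ℝ | 0 ≤ s ∧ Real.exp s * (1 - s) ≤ y} := by simp [hy.le]
  have hcont : Continuous fun s : ℝ => Real.exp s * (1 - s) := by fun_prop
  have hcl : IsClosed {s : ℝ | 0 ≤ s ∧ Real.exp s * (1 - s) ≤ y} :=
    (isClosed_le continuous_const continuous_id).inter
      (isClosed_le hcont continuous_const)
  have hm := hcl.csInf_mem ⟨1, h1⟩ hbdd
  exact ⟨hm.1, csInf_le hbdd h1, hm.2⟩

lemma xi2_spec (y : ℝ) (hy : 0 < y) :
    0 ≤ xi2inv y ∧ Real.exp (-xi2inv y) * (1 + xi2inv y) ≤ y := by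
  have hbdd : BddBelow {s : ℝ | 0 ≤ s ∧ Real.exp (-s) * (1 + s) ≤ y} := ⟨0, fun s hs => hs.1⟩
  have hne : {s : ℝ | 0 ≤ s ∧ Real.exp (-s) * (1 + s) ≤ y}.Nonempty := by
    refine ⟨2 / y, by positivity, ?_⟩
    have hu : 0 < 2 / y := by positivity
    have hq := Real.quadratic_le_exp_of_nonneg hu.le
    rw [Real.exp_neg, inv_mul_le_iff₀ (Real.exp_pos _)]
    have hyu : y * (2 / y) = 2 := by field_simp
    have : (1 + 2 / y + (2 / y) ^ 2 / 2) * y ≤ Real.exp (2 / y) * y := by gcongr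
    refine le_trans ?_ this
    have e : (1 + 2 / y + (2 / y) ^ 2 / 2) * y = y + 2 + 2 / y := by
      field_simp
    rw [e]; linarith
  have hcont : Continuous fun s : ℝ => Real.exp (-s) * (1 + s) := by fun_prop
  have hcl : IsClosed {s : ℝ | 0 ≤ s ∧ Real.exp (-s) * (1 + s) ≤ y} :=
    (isClosed_le continuous_const continuous_id).inter
      (isClosed_le hcont continuous_const)
  exact hcl.csInf_mem hne hbdd

lemma exp_aux (t : ℝ) (k : ℕ) (hk : 0 < k) :
    Real.exp ((-t ^ 2 - 4 * Real.log (k:ℝ)) / (2 * (k:ℝ))) ^ k =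
      Real.exp (-t ^ 2 / 2) * (1 / (k:ℝ) ^ 2) := by
  have hk' : (0:ℝ) < k := by exact_mod_cast hk
  rw [← Real.exp_nat_mul]
  have : (k:ℝ) * ((-t ^ 2 - 4 * Real.log (k:ℝ)) / (2 * (k:ℝ))) =
      -t ^ 2 / 2 + -(Real.log k + Real.log k) := by field_simp; ring
  rw [this, Real.exp_add, Real.exp_neg, Real.exp_add, Real.exp_log hk', one_div, sq (k:ℝ)]

lemma zeta_aux (n : ℕ) : ∑ i : Fin n, 1 / (((i:ℕ) + 1 : ℕ) : ℝ) ^ 2 ≤ Real.pi ^ 2 / 6 := by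
  rw [Fin.sum_univ_eq_sum_range (fun i => 1 / ((i + 1 : ℕ) : ℝ) ^ 2) n]
  have h := hasSum_zeta_two.summable.sum_le_tsum (Finset.range (n + 1))
    (fun i _ => by positivity)
  rw [hasSum_zeta_two.tsum_eq, Finset.sum_range_succ'] at h
  simpa using h

lemma zeta_aux' (n : ℕ) : ∑ i : Fin n, 1 / ((n - (i:ℕ) : ℕ) : ℝ) ^ 2 ≤ Real.pi ^ 2 / 6 := by
  refine le_trans (le_of_eq ?_) (zeta_aux n)
  rw [← Equiv.sum_comp Fin.revPerm]
  refine Finset.sum_congr rfl fun i _ => ?_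
  have : n - ((Fin.revPerm i : Fin n) : ℕ) = (i:ℕ) + 1 := by
    simp [Fin.val_rev]; omega
  rw [this]

/-- For an i.i.d. sample `(γ_i)₁ⁿ` from the uniform distribution on `(0,1)`
with order statistics `γ_{(1)} ≤ … ≤ γ_{(n)}` and any `t > 0`: with probability at least
`1 − (π²/3)·exp(−t²/2)`, simultaneously for all `1 ≤ k ≤ n` (here `k = (i:ℕ)+1` for
`i : Fin n`), `γ_{(k)}` is bounded above by both
`(k/(n+1))(1 + ξ₂⁻¹(exp((−t² − 4 log k)/(2k))))` and
`1 − ((n−k+1)/(n+1))(1 − ξ₁⁻¹(exp((−t² − 4 log(n−k+1))/(2(n−k+1)))))`. -/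
theorem stmt_13 {Ω : Type*} [MeasurableSpace Ω] (μ : Measure Ω) [IsProbabilityMeasure μ]
    (n : ℕ) (γ : Fin n → Ω → ℝ) (hmeas : ∀ i, Measurable (γ i))
    (hiid : μ.map (fun ω i => γ i ω) =
      Measure.pi (fun _ : Fin n => volume.restrict (Set.Ioo (0 : ℝ) 1)))
    (t : ℝ) (ht : 0 < t) :
    ENNReal.ofReal (1 - Real.pi ^ 2 / 3 * Real.exp (-t ^ 2 / 2)) ≤
      μ {ω | ∀ i : Fin n,
        orderStat (fun i' => γ i' ω) i ≤
          ((i : ℝ) + 1) / ((n : ℝ) + 1) *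
            (1 + xi2inv (Real.exp ((-t ^ 2 - 4 * Real.log ((i : ℝ) + 1)) /
              (2 * ((i : ℝ) + 1))))) ∧
        orderStat (fun i' => γ i' ω) i ≤
          1 - ((n : ℝ) - ((i : ℝ) + 1) + 1) / ((n : ℝ) + 1) *
            (1 - xi1inv (Real.exp ((-t ^ 2 - 4 * Real.log ((n : ℝ) - ((i : ℝ) + 1) + 1)) /
              (2 * ((n : ℝ) - ((i : ℝ) + 1) + 1)))))} := by
  classical
  set S := {ω | ∀ i : Fin n,
        orderStat (fun i' => γ i' ω) i ≤
          ((i : ℝ) + 1) / ((n : ℝ) + 1) *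
            (1 + xi2inv (Real.exp ((-t ^ 2 - 4 * Real.log ((i : ℝ) + 1)) /
              (2 * ((i : ℝ) + 1))))) ∧
        orderStat (fun i' => γ i' ω) i ≤
          1 - ((n : ℝ) - ((i : ℝ) + 1) + 1) / ((n : ℝ) + 1) *
            (1 - xi1inv (Real.exp ((-t ^ 2 - 4 * Real.log ((n : ℝ) - ((i : ℝ) + 1) + 1)) /
              (2 * ((n : ℝ) - ((i : ℝ) + 1) + 1)))))} with hS
  set A : Fin n → Set Ω := fun i => {ω | ((i : ℝ) + 1) / ((n : ℝ) + 1) *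
            (1 + xi2inv (Real.exp ((-t ^ 2 - 4 * Real.log ((i : ℝ) + 1)) /
              (2 * ((i : ℝ) + 1))))) < orderStat (fun i' => γ i' ω) i} with hA
  set B : Fin n → Set Ω := fun i => {ω | 1 - ((n : ℝ) - ((i : ℝ) + 1) + 1) / ((n : ℝ) + 1) *
            (1 - xi1inv (Real.exp ((-t ^ 2 - 4 * Real.log ((n : ℝ) - ((i : ℝ) + 1) + 1)) /
              (2 * ((n : ℝ) - ((i : ℝ) + 1) + 1))))) < orderStat (fun i' => γ i' ω) i} with hB
  have hAi : ∀ i, μ.real (A i) ≤ Real.exp (-t ^ 2 / 2) * (1 / (((i:ℕ) + 1 : ℕ) : ℝ) ^ 2) := by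
    intro i
    have hsp := xi2_spec (Real.exp ((-t ^ 2 - 4 * Real.log ((i : ℝ) + 1)) /
              (2 * ((i : ℝ) + 1)))) (Real.exp_pos _)
    refine (tailA μ n γ hmeas hiid i _ hsp.1).trans ?_
    rw [← exp_aux t ((i:ℕ) + 1) (by omega)]
    push_cast
    refine pow_le_pow_left₀ ?_ hsp.2 _
    have := hsp.1
    positivity
  have hBi : ∀ i : Fin n,
      μ.real (B i) ≤ Real.exp (-t ^ 2 / 2) * (1 / ((n - (i:ℕ) : ℕ) : ℝ) ^ 2) := by
    intro i
    have hj : (n : ℝ) - ((i : ℝ) + 1) + 1 = ((n - (i:ℕ) : ℕ) : ℝ) := by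
      rw [Nat.cast_sub i.2.le]; ring
    simp only [hB]
    rw [hj]
    have hsp := xi1_spec (Real.exp ((-t ^ 2 - 4 * Real.log ((n - (i:ℕ) : ℕ) : ℝ)) /
              (2 * ((n - (i:ℕ) : ℕ) : ℝ)))) (Real.exp_pos _)
    refine (tailB μ n γ hmeas hiid i _ rfl _ hsp.1 hsp.2.1).trans ?_
    rw [← exp_aux t (n - (i:ℕ)) (by have := i.2; omega)]
    refine pow_le_pow_left₀ ?_ hsp.2.2 _
    exact mul_nonneg (Real.exp_pos _).le (by linarith [hsp.2.1])
  have hcov : (Set.univ : Set Ω) ⊆ S ∪ ((⋃ i, A i) ∪ (⋃ i, B i)) := by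
    intro ω _
    by_cases h : ω ∈ S
    · exact Or.inl h
    · right
      rw [hS, mem_ofPred_eq, not_forall] at h
      obtain ⟨i, hi⟩ := h
      rw [not_and_or, not_le, not_le] at hi
      rcases hi with hi | hi
      · exact Or.inl (mem_iUnion.2 ⟨i, hi⟩)
      · exact Or.inr (mem_iUnion.2 ⟨i, hi⟩)
  have h1 : 1 ≤ μ.real S + (μ.real (⋃ i, A i) + μ.real (⋃ i, B i)) := by
    calc (1:ℝ) = μ.real Set.univ := by simp
      _ ≤ μ.real (S ∪ ((⋃ i, A i) ∪ (⋃ i, B i))) := measureReal_mono hcov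
      _ ≤ μ.real S + μ.real ((⋃ i, A i) ∪ (⋃ i, B i)) := measureReal_union_le _ _
      _ ≤ _ := by gcongr; exact measureReal_union_le _ _
  have hAs : μ.real (⋃ i, A i) ≤ Real.exp (-t ^ 2 / 2) * (Real.pi ^ 2 / 6) := by
    refine (measureReal_iUnion_fintype_le _).trans ?_
    refine (Finset.sum_le_sum fun i _ => hAi i).trans ?_
    rw [← Finset.mul_sum]
    exact mul_le_mul_of_nonneg_left (zeta_aux n) (Real.exp_pos _).le
  have hBs : μ.real (⋃ i, B i) ≤ Real.exp (-t ^ 2 / 2) * (Real.pi ^ 2 / 6) := by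
    refine (measureReal_iUnion_fintype_le _).trans ?_
    refine (Finset.sum_le_sum fun i _ => hBi i).trans ?_
    rw [← Finset.mul_sum]
    exact mul_le_mul_of_nonneg_left (zeta_aux' n) (Real.exp_pos _).le
  apply ENNReal.ofReal_le_of_le_toReal
  change _ ≤ μ.real S
  linarith
end

section
/- Let n ∈ ℕ, λ ∈ [2,∞), and let (Y_i)_{i=1}^n be an i.i.d. sequence of non-negative random variables, each with cumulative distribution function F and quantile function F^{-1}, with order statistics Y_{(1)} ≤ … ≤ Y_{(n)}. Then with probability at least 1 − (π²/3)·exp(−λ²/2), the following event holds: for all integers j, k with 0 ≤ j ≤ k < n, the sum ∑_{i=n−k}^{n−j} Y_{(i)} is at most F^{-1}(1 − ((j+1)/(n+1))·(1 − ξ₁^{-1}(exp((−λ² − 4 log(j+1))/(2(j+1)))))) + (n+1)·∫_{(j+1)/(n+1)}^{(k+1)/(n+1)} F^{-1}(1 − t·(1 − ξ₁^{-1}(exp((−λ² − 4 log((n+1)t))/(2(n+1)t))))) dt. -/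
open MeasureTheory Set

lemma xi_aux {y : ℝ} (h0 : 0 < y) (h1 : y < 1) :
    0 < xi1inv y ∧ xi1inv y < 1 ∧ Real.exp (xi1inv y) * (1 - xi1inv y) ≤ y := by
  have hbdd : BddBelow {s : ℝ | 0 ≤ s ∧ Real.exp s * (1 - s) ≤ y} := ⟨0, fun s hs => hs.1⟩
  have he := Real.exp_pos 1
  have he1 : (1:ℝ) < Real.exp 1 := by
    have := Real.add_one_lt_exp (x := 1) one_ne_zero
    linarith
  have hye : 0 < y / Real.exp 1 := by positivity
  have hye1 : y / Real.exp 1 < 1 := by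
    rw [div_lt_one he]; linarith
  have hmem : 1 - y / Real.exp 1 ∈ {s : ℝ | 0 ≤ s ∧ Real.exp s * (1 - s) ≤ y} := by
    refine ⟨by linarith, ?_⟩
    have : Real.exp (1 - y / Real.exp 1) ≤ Real.exp 1 := Real.exp_le_exp.2 (by linarith)
    calc Real.exp (1 - y / Real.exp 1) * (1 - (1 - y / Real.exp 1))
        ≤ Real.exp 1 * (y / Real.exp 1) := by
          rw [sub_sub_cancel]; exact mul_le_mul_of_nonneg_right this hye.le
      _ = y := by field_simp
  have hcl : IsClosed {s : ℝ | 0 ≤ s ∧ Real.exp s * (1 - s) ≤ y} :=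
    (isClosed_le continuous_const continuous_id).inter
      (isClosed_le (f := fun s : ℝ => Real.exp s * (1 - s)) (by fun_prop) continuous_const)
  have hin := hcl.csInf_mem ⟨_, hmem⟩ hbdd
  have hle := csInf_le hbdd hmem
  change xi1inv y ∈ _ at hin
  change xi1inv y ≤ _ at hle
  refine ⟨lt_of_le_of_ne hin.1 ?_, by linarith, hin.2⟩
  intro h
  have := hin.2
  rw [← h] at this
  norm_num at this
  linarith

lemma xi_anti {y z : ℝ} (h0 : 0 < y) (h : y ≤ z) : xi1inv z ≤ xi1inv y := by
  refine csInf_le_csInf ⟨0, fun s hs => hs.1⟩ ⟨1, by norm_num; exact h0.le⟩ ?_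
  intro s hs
  exact ⟨hs.1, hs.2.trans h⟩

noncomputable def expo (lam t : ℝ) : ℝ := (-lam ^ 2 - 4 * Real.log t) / (2 * t)

lemma expo_neg {lam t : ℝ} (hlam : 2 ≤ lam) (ht : 1 ≤ t) : expo lam t < 0 := by
  have := Real.log_nonneg ht
  apply div_neg_of_neg_of_pos <;> nlinarith

lemma expo_mono {lam s t : ℝ} (hlam : 2 ≤ lam) (hs : 1 ≤ s) (hst : s ≤ t) :
    expo lam s ≤ expo lam t := by
  unfold expo
  have hs0 : 0 < s := by linarith
  have ht0 : 0 < t := by linarith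
  rw [div_le_div_iff₀ (by linarith) (by linarith)]
  have hl := Real.log_nonneg hs
  have h1 : Real.log t - Real.log s ≤ t / s - 1 := by
    rw [← Real.log_div ht0.ne' hs0.ne']
    exact Real.log_le_sub_one_of_pos (by positivity)
  have h2 : s * (Real.log t - Real.log s) ≤ t - s := by
    have := mul_le_mul_of_nonneg_left h1 hs0.le
    have e : s * (t / s - 1) = t - s := by field_simp
    linarith
  have h3 : (4:ℝ) ≤ lam ^ 2 := by nlinarith
  nlinarith [mul_nonneg (sub_nonneg.2 hst) hl, mul_nonneg (sub_nonneg.2 hst) (sub_nonneg.2 h3)]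

noncomputable def aa (lam t : ℝ) : ℝ := 1 - xi1inv (Real.exp (expo lam t))

lemma aa_spec {lam t : ℝ} (hlam : 2 ≤ lam) (ht : 1 ≤ t) :
    0 < aa lam t ∧ aa lam t < 1 ∧ aa lam t * Real.exp (1 - aa lam t) ≤ Real.exp (expo lam t) := by
  obtain ⟨h1, h2, h3⟩ := xi_aux (Real.exp_pos (expo lam t))
    (by rw [Real.exp_lt_one_iff]; exact expo_neg hlam ht)
  unfold aa
  refine ⟨by linarith, by linarith, ?_⟩
  rw [sub_sub_cancel, mul_comm]; exact h3

lemma aa_mono {lam s t : ℝ} (hlam : 2 ≤ lam) (hs : 1 ≤ s) (hst : s ≤ t) :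
    aa lam s ≤ aa lam t := by
  unfold aa
  have := xi_anti (Real.exp_pos (expo lam s)) (Real.exp_le_exp.2 (expo_mono hlam hs hst))
  linarith

noncomputable def qarg (n : ℕ) (lam t : ℝ) : ℝ := 1 - t / ((n:ℝ) + 1) * aa lam t

lemma qarg_mem {n : ℕ} {lam t : ℝ} (hlam : 2 ≤ lam) (ht : 1 ≤ t) (htn : t ≤ n) :
    0 < qarg n lam t ∧ qarg n lam t < 1 := by
  obtain ⟨h1, h2, _⟩ := aa_spec hlam ht
  have hn : (0:ℝ) < (n:ℝ) + 1 := by positivity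
  have h3 : 0 < t / ((n:ℝ) + 1) := by positivity
  have h4 : t / ((n:ℝ) + 1) < 1 := by rw [div_lt_one hn]; linarith
  unfold qarg
  constructor <;> nlinarith [mul_pos h3 h1]

lemma qarg_anti {n : ℕ} {lam s t : ℝ} (hlam : 2 ≤ lam) (hs : 1 ≤ s) (hst : s ≤ t) :
    qarg n lam t ≤ qarg n lam s := by
  obtain ⟨h1, h2, _⟩ := aa_spec hlam hs
  unfold qarg
  have : s / ((n:ℝ) + 1) * aa lam s ≤ t / ((n:ℝ) + 1) * aa lam t := by
    have := aa_mono hlam hs hst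
    have h0 : 0 ≤ t := by linarith
    gcongr
  linarith

lemma cdf_set_bdd (ν : Measure ℝ) (hνpos : ν (Set.Iio 0) = 0) {s : ℝ} (hs : 0 < s) :
    BddBelow {t : ℝ | s ≤ (ν (Set.Iic t)).toReal} := by
  refine ⟨0, fun t ht => ?_⟩
  by_contra h
  have : ν (Set.Iic t) = 0 :=
    measure_mono_null (fun x hx => lt_of_le_of_lt hx (not_le.1 h)) hνpos
  simp only [mem_setOf_eq, this] at ht
  simp at ht
  linarith

lemma cdf_set_nonempty (ν : Measure ℝ) [IsProbabilityMeasure ν] {s : ℝ} (hs : s < 1) :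
    {t : ℝ | s ≤ (ν (Set.Iic t)).toReal}.Nonempty := by
  have h := ProbabilityTheory.tendsto_cdf_atTop ν
  obtain ⟨t, ht⟩ := (h.eventually (lt_mem_nhds hs)).exists
  refine ⟨t, ?_⟩
  rw [ProbabilityTheory.cdf_eq_real] at ht
  exact ht.le

lemma quantile_mono (ν : Measure ℝ) [IsProbabilityMeasure ν] (hνpos : ν (Set.Iio 0) = 0)
    {s t : ℝ} (hs : 0 < s) (hst : s ≤ t) (ht : t < 1) : quantile ν s ≤ quantile ν t :=
  csInf_le_csInf (cdf_set_bdd ν hνpos hs) (cdf_set_nonempty ν ht) fun _ hx => hst.trans hx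

lemma le_cdf_quantile (ν : Measure ℝ) [IsProbabilityMeasure ν]
    {s : ℝ} (ht : s < 1) : s ≤ ν.real (Set.Iic (quantile ν s)) := by
  have hrc := (ProbabilityTheory.cdf ν).right_continuous (quantile ν s)
  rw [← ProbabilityTheory.cdf_eq_real]
  have hrc' : Filter.Tendsto (ProbabilityTheory.cdf ν) (nhdsWithin (quantile ν s) (Ioi (quantile ν s)))
      (nhds (ProbabilityTheory.cdf ν (quantile ν s))) :=
    hrc.mono_left (nhdsWithin_mono _ Ioi_subset_Ici_self)
  refine ge_of_tendsto hrc' ?_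
  filter_upwards [self_mem_nhdsWithin] with x hx
  obtain ⟨y, hy, hyx⟩ := exists_lt_of_csInf_lt (cdf_set_nonempty ν ht) (show sInf _ < x from hx)
  have : s ≤ ProbabilityTheory.cdf ν y := by rw [ProbabilityTheory.cdf_eq_real]; exact hy
  exact this.trans (ProbabilityTheory.monotone_cdf ν hyx.le)

open Classical in
lemma chernoff_s14 (ν : Measure ℝ) [IsProbabilityMeasure ν] (n m : ℕ) (q a p : ℝ)
    (ha : 0 < a) (ha1 : a < 1) (hp : ν.real (Set.Ioi q) ≤ p) (hnp : n * p ≤ m * a) :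
    (Measure.pi (fun _ : Fin n => ν)).real {v | m ≤ (Finset.univ.filter (fun i => q < v i)).card}
      ≤ (a * Real.exp (1 - a)) ^ m := by
  set h : ℝ → ℝ := fun x => 1 + (Set.Ioi q).indicator (fun _ => a⁻¹ - 1) x with hh
  have hc : 1 ≤ a⁻¹ := (one_le_inv₀ ha).2 ha1.le
  have hint0 : Integrable ((Set.Ioi q).indicator (fun _ => a⁻¹ - 1)) ν :=
    (integrable_const _).indicator measurableSet_Ioi
  have hint : Integrable h ν := (integrable_const _).add hint0
  have hval : ∫ x, h x ∂ν = 1 + ν.real (Set.Ioi q) * (a⁻¹ - 1) := by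
    rw [hh, integral_add (integrable_const _) hint0, integral_indicator_const _ measurableSet_Ioi]
    simp
  have h1 : ∀ x, 1 ≤ h x := fun x => by
    by_cases hx : x ∈ Set.Ioi q <;> simp [hh, hx, hc]
  have hprod : Integrable (fun v : Fin n → ℝ => ∏ i, h (v i)) (Measure.pi (fun _ : Fin n => ν)) :=
    Integrable.fintype_prod (fun _ => hint)
  have hI : ∫ v : Fin n → ℝ, ∏ i, h (v i) ∂(Measure.pi (fun _ : Fin n => ν)) = (∫ x, h x ∂ν) ^ n := by
    rw [integral_fintype_prod_eq_prod (fun _ => h)]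
    simp
  have hM := mul_meas_ge_le_integral_of_nonneg (μ := Measure.pi (fun _ : Fin n => ν))
    (f := fun v : Fin n → ℝ => ∏ i, h (v i))
    (Filter.Eventually.of_forall fun v => Finset.prod_nonneg fun i _ => zero_le_one.trans (h1 _))
    hprod (a⁻¹ ^ m)
  rw [hI, hval] at hM
  have hsub : {v : Fin n → ℝ | m ≤ (Finset.univ.filter (fun i => q < v i)).card} ⊆
      {v | a⁻¹ ^ m ≤ ∏ i, h (v i)} := by
    intro v hv
    have hv : m ≤ (Finset.univ.filter (fun i => q < v i)).card := hv
    show a⁻¹ ^ m ≤ ∏ i, h (v i)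
    calc a⁻¹ ^ m ≤ a⁻¹ ^ (Finset.univ.filter (fun i => q < v i)).card :=
          pow_le_pow_right₀ hc hv
      _ = ∏ i ∈ Finset.univ.filter (fun i => q < v i), h (v i) := by
          rw [Finset.prod_congr rfl (g := fun _ => a⁻¹)]
          · simp
          · intro i hi
            have : q < v i := by simpa using hi
            simp [hh, this]
      _ ≤ ∏ i, h (v i) := by
          rw [← Finset.prod_filter_mul_prod_filter_not Finset.univ (fun i => q < v i)]
          apply le_mul_of_one_le_right
          · exact Finset.prod_nonneg fun i _ => zero_le_one.trans (h1 _)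
          · rw [← Finset.prod_const_one (s := Finset.univ.filter (fun i => ¬ q < v i))]
            exact Finset.prod_le_prod (fun _ _ => zero_le_one) fun i _ => h1 _
  have hmono : (Measure.pi (fun _ : Fin n => ν)).real
        {v | m ≤ (Finset.univ.filter (fun i => q < v i)).card} ≤
      (Measure.pi (fun _ : Fin n => ν)).real {v | a⁻¹ ^ m ≤ ∏ i, h (v i)} := measureReal_mono hsub
  have hexp : (1 + ν.real (Set.Ioi q) * (a⁻¹ - 1)) ^ n ≤ Real.exp (1 - a) ^ m := by
    have hν : 0 ≤ ν.real (Set.Ioi q) := measureReal_nonneg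
    calc (1 + ν.real (Set.Ioi q) * (a⁻¹ - 1)) ^ n ≤ (Real.exp (p * (a⁻¹ - 1))) ^ n := by
          apply pow_le_pow_left₀
          · nlinarith [mul_nonneg hν (sub_nonneg.2 hc)]
          · have := Real.add_one_le_exp (p * (a⁻¹ - 1))
            nlinarith [mul_le_mul_of_nonneg_right hp (sub_nonneg.2 hc)]
      _ ≤ Real.exp (1 - a) ^ m := by
          rw [← Real.exp_nat_mul, ← Real.exp_nat_mul, Real.exp_le_exp]
          have h2 := mul_le_mul_of_nonneg_right hnp (sub_nonneg.2 hc)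
          have h3 : m * a * (a⁻¹ - 1) = m * (1 - a) := by field_simp
          linarith
  calc _ ≤ _ := hmono
    _ = a ^ m * (a⁻¹ ^ m * (Measure.pi (fun _ : Fin n => ν)).real {v | a⁻¹ ^ m ≤ ∏ i, h (v i)}) := by
        rw [← mul_assoc, ← mul_pow, mul_inv_cancel₀ ha.ne', one_pow, one_mul]
    _ ≤ a ^ m * Real.exp (1 - a) ^ m :=
        mul_le_mul_of_nonneg_left (hM.trans hexp) (by positivity)
    _ = _ := (mul_pow _ _ _).symm

open Classical in
lemma orderStat_card {n : ℕ} (v : Fin n → ℝ) (i : Fin n) (q : ℝ) (h : q < orderStat v i) :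
    n - (i:ℕ) ≤ (Finset.univ.filter (fun i => q < v i)).card := by
  rw [← Fin.card_Ici, ← Finset.card_map (Tuple.sort v).toEmbedding]
  apply Finset.card_le_card
  intro x hx
  simp only [Finset.mem_map, Finset.mem_Ici] at hx
  obtain ⟨y, hy, rfl⟩ := hx
  simp only [Finset.mem_filter, Finset.mem_univ, true_and]
  exact h.trans_le (Tuple.monotone_sort v hy)

open Classical in
lemma meas_count {n : ℕ} (m : ℕ) (q : ℝ) :
    MeasurableSet {v : Fin n → ℝ | m ≤ (Finset.univ.filter (fun i => q < v i)).card} := by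
  have : Measurable (fun v : Fin n → ℝ => (Finset.univ.filter (fun i => q < v i)).card) := by
    simp only [Finset.card_filter]
    refine Finset.measurable_fun_sum _ fun i _ => ?_
    exact Measurable.ite (measurableSet_lt measurable_const (measurable_pi_apply i))
      measurable_const measurable_const
  exact measurableSet_le measurable_const this

lemma sum_bound {n : ℕ} (f : ℝ → ℝ) (o : Fin n → ℝ) (ho : ∀ i : Fin n, o i ≤ f ((n:ℝ) - i))
    (hf : AntitoneOn f (Set.Icc 1 (n:ℝ))) (j k : ℕ) (hjk : j ≤ k) (hk : k < n) :
    (∑ i : Fin n, if n - k ≤ (i : ℕ) + 1 ∧ (i : ℕ) + 1 ≤ n - j then o i else 0) ≤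
      f ((j:ℝ) + 1) + ∫ t in ((j:ℝ) + 1)..((k:ℝ) + 1), f t := by
  have h1 : (∑ i : Fin n, if n - k ≤ (i : ℕ) + 1 ∧ (i : ℕ) + 1 ≤ n - j then o i else 0) ≤
      ∑ i ∈ Finset.range n, if n - k ≤ i + 1 ∧ i + 1 ≤ n - j then f ((n:ℝ) - i) else 0 := by
    rw [Finset.sum_range (fun i => if n - k ≤ i + 1 ∧ i + 1 ≤ n - j then f ((n:ℝ) - i) else 0)]
    apply Finset.sum_le_sum
    intro i _
    split_ifs
    · exact ho i
    · exact le_rfl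
  have h2 : (∑ i ∈ Finset.range n, if n - k ≤ i + 1 ∧ i + 1 ≤ n - j then f ((n:ℝ) - i) else 0)
      = ∑ l ∈ Finset.range (k - j + 1), f ((j:ℝ) + 1 + l) := by
    rw [← Finset.sum_filter]
    refine Finset.sum_nbij' (fun i => n - 1 - j - i) (fun l => n - 1 - j - l) ?_ ?_ ?_ ?_ ?_
    · intro i hi; simp only [Finset.mem_filter, Finset.mem_range] at *; omega
    · intro i hi; simp only [Finset.mem_filter, Finset.mem_range] at *; omega
    · intro i hi; simp only [Finset.mem_filter, Finset.mem_range] at *; omega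
    · intro i hi; simp only [Finset.mem_filter, Finset.mem_range] at *; omega
    · intro i hi
      simp only [Finset.mem_filter, Finset.mem_range] at hi
      have : n = j + 1 + (n - 1 - j - i) + i := by omega
      have h' : (n:ℝ) = j + 1 + ((n - 1 - j - i : ℕ):ℝ) + i := by exact_mod_cast this
      congr 1
      linarith
  have hkj : ((k - j : ℕ):ℝ) = k - j := by push_cast [hjk]; ring
  have hkn : (k:ℝ) + 1 ≤ n := by exact_mod_cast hk
  have h3 := AntitoneOn.sum_le_integral (f := f) (x₀ := (j:ℝ) + 1) (a := k - j)
    (hf.mono (Set.Icc_subset_Icc (by linarith [Nat.cast_nonneg (α := ℝ) j]) (by rw [hkj]; linarith)))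
  rw [h2, Finset.sum_range_succ'] at h1
  have e : (j:ℝ) + 1 + ((k - j : ℕ):ℝ) = k + 1 := by rw [hkj]; ring
  rw [e] at h3
  simp only [Nat.cast_zero, add_zero] at h1
  linarith

lemma sum_sq (n : ℕ) : ∑ i : Fin n, (1:ℝ) / ((i:ℕ) + 1 : ℝ) ^ 2 ≤ Real.pi ^ 2 / 6 := by
  have h := (hasSum_nat_add_iff' 1).2 hasSum_zeta_two
  rw [← Finset.sum_range (fun i => (1:ℝ) / ((i:ℝ) + 1) ^ 2)]
  have := sum_le_hasSum (Finset.range n) (fun i _ => by positivity) h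
  simpa using this

/-- Let `λ ≥ 2` and let `(Y_i)₁ⁿ` be i.i.d. non-negative random variables
with common distribution `ν` (cdf `F`, quantile function `F⁻¹`) and order statistics
`Y_{(1)} ≤ … ≤ Y_{(n)}`. With probability at least `1 − (π²/3)·exp(−λ²/2)`:
for all integers `0 ≤ j ≤ k < n`,
`∑_{i=n−k}^{n−j} Y_{(i)} ≤ F⁻¹(1 − ((j+1)/(n+1))(1 − ξ₁⁻¹(exp((−λ²−4log(j+1))/(2(j+1))))))`
`+ (n+1)·∫_{(j+1)/(n+1)}^{(k+1)/(n+1)} F⁻¹(1 − s(1 − ξ₁⁻¹(exp((−λ²−4log((n+1)s))/(2(n+1)s))))) ds`.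
(Here `orderStat` is `0`-indexed, so `Y_{(m)} = orderStat _ i` with `m = (i:ℕ)+1`.) -/
theorem stmt_14 {Ω : Type*} [MeasurableSpace Ω] (μ : Measure Ω) [IsProbabilityMeasure μ]
    (n : ℕ) (lam : ℝ) (hlam : 2 ≤ lam)
    (ν : Measure ℝ) [IsProbabilityMeasure ν] (hνpos : ν (Set.Iio 0) = 0)
    (Y : Fin n → Ω → ℝ) (hmeas : ∀ i, Measurable (Y i)) (hnonneg : ∀ i ω, 0 ≤ Y i ω)
    (hiid : μ.map (fun ω i => Y i ω) = Measure.pi (fun _ : Fin n => ν)) :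
    ENNReal.ofReal (1 - Real.pi ^ 2 / 3 * Real.exp (-lam ^ 2 / 2)) ≤
      μ {ω | ∀ j k : ℕ, j ≤ k → k < n →
        (∑ i : Fin n, if n - k ≤ (i : ℕ) + 1 ∧ (i : ℕ) + 1 ≤ n - j then
            orderStat (fun i' => Y i' ω) i else 0) ≤
          quantile ν (1 - ((j : ℝ) + 1) / ((n : ℝ) + 1) *
            (1 - xi1inv (Real.exp ((-lam ^ 2 - 4 * Real.log ((j : ℝ) + 1)) /
              (2 * ((j : ℝ) + 1)))))) +
          ((n : ℝ) + 1) *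
            ∫ s in (((j : ℝ) + 1) / ((n : ℝ) + 1))..(((k : ℝ) + 1) / ((n : ℝ) + 1)),
              quantile ν (1 - s *
                (1 - xi1inv (Real.exp ((-lam ^ 2 - 4 * Real.log (((n : ℝ) + 1) * s)) /
                  (2 * ((n : ℝ) + 1) * s)))))} := by
  classical
  set A := {ω | ∀ j k : ℕ, j ≤ k → k < n → _} with hA
  let q : ℝ → ℝ := fun t => quantile ν (qarg n lam t)
  let B : Fin n → Set Ω := fun i => {ω | (i:ℕ) + 1 ≤
    (Finset.univ.filter (fun i' => q ((i:ℕ) + 1) < Y i' ω)).card}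
  have hqanti : AntitoneOn q (Set.Icc 1 (n:ℝ)) := by
    intro s hs t ht hst
    exact quantile_mono ν hνpos (qarg_mem hlam ht.1 ht.2).1 (qarg_anti hlam hs.1 hst)
      (qarg_mem hlam hs.1 hs.2).2
  have hB : ∀ i, μ.real (B i) ≤ Real.exp (-lam ^ 2 / 2) * (1 / ((i:ℕ) + 1 : ℝ) ^ 2) := by
    intro i
    have hi1 : (1:ℝ) ≤ (i:ℕ) + 1 := by linarith [Nat.cast_nonneg (α := ℝ) (i:ℕ)]
    have hin : ((i:ℕ) + 1 : ℝ) ≤ n := by exact_mod_cast i.2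
    obtain ⟨ha0, ha1, ha2⟩ := aa_spec hlam hi1
    have hmY : Measurable (fun ω i => Y i ω) := measurable_pi_lambda _ hmeas
    have e1 : μ.real (B i) = (Measure.pi (fun _ : Fin n => ν)).real
        {v | (i:ℕ) + 1 ≤ (Finset.univ.filter (fun i' => q ((i:ℕ) + 1) < v i')).card} := by
      rw [← hiid, map_measureReal_apply hmY (meas_count _ _)]
      rfl
    have hp : ν.real (Set.Ioi (q ((i:ℕ) + 1))) ≤
        ((i:ℕ) + 1 : ℝ) / ((n:ℝ) + 1) * aa lam ((i:ℕ) + 1) := by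
      have h1 := le_cdf_quantile ν (qarg_mem hlam hi1 hin).2
      have h2 := probReal_compl_eq_one_sub (μ := ν) (measurableSet_Iic (a := q ((i:ℕ) + 1)))
      rw [Set.compl_Iic] at h2
      rw [h2]
      change qarg n lam _ ≤ ν.real (Set.Iic (q ((i:ℕ) + 1))) at h1
      unfold qarg at h1
      linarith
    have hc := chernoff_s14 ν n ((i:ℕ) + 1) (q ((i:ℕ) + 1)) _ _ ha0 ha1 hp (by
      push_cast
      have : (n:ℝ) * (((i:ℕ) + 1 : ℝ) / ((n:ℝ) + 1) * aa lam ((i:ℕ) + 1)) =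
        (n:ℝ) / ((n:ℝ) + 1) * (((i:ℕ) + 1 : ℝ) * aa lam ((i:ℕ) + 1)) := by ring
      rw [this]
      apply mul_le_of_le_one_left (by positivity)
      rw [div_le_one (by positivity)]; linarith)
    rw [e1]
    refine hc.trans ((pow_le_pow_left₀ (by positivity) ha2 _).trans (le_of_eq ?_))
    rw [← Real.exp_nat_mul]
    have hpos : (0:ℝ) < (i:ℕ) + 1 := by linarith
    have e2 : (((i:ℕ) + 1 : ℕ):ℝ) * expo lam ((i:ℕ) + 1) =
        -lam ^ 2 / 2 + (-(Real.log ((i:ℕ) + 1) * (2:ℕ))) := by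
      unfold expo
      push_cast
      field_simp
      ring
    rw [e2, Real.exp_add, Real.exp_neg, mul_comm (Real.log _), Real.exp_nat_mul, Real.exp_log hpos,
      one_div]
  have hsub : Aᶜ ⊆ ⋃ i, B i := by
    intro ω hω
    by_contra hcon
    apply hω
    simp only [Set.mem_iUnion, not_exists] at hcon
    have ho : ∀ i : Fin n, orderStat (fun i' => Y i' ω) i ≤ q ((n:ℝ) - i) := by
      intro i
      by_contra hlt
      have hc := orderStat_card _ _ _ (not_le.1 hlt)
      refine hcon ⟨n - 1 - i, by omega⟩ ?_
      have e : (((n - 1 - i : ℕ) : ℝ) + 1) = n - i := by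
        have : (n - 1 - i) + 1 + (i:ℕ) = n := by omega
        have : (((n - 1 - i : ℕ) : ℝ) + 1) + (i:ℕ) = n := by exact_mod_cast this
        linarith
      show (n - 1 - i) + 1 ≤ (Finset.univ.filter
        (fun i' => q (((n - 1 - i : ℕ) : ℝ) + 1) < Y i' ω)).card
      rw [e]
      refine le_trans ?_ hc
      omega
    rw [hA]
    intro j k hjk hk
    refine (sum_bound q _ ho hqanti j k hjk hk).trans (le_of_eq ?_)
    have hn : (n:ℝ) + 1 ≠ 0 := by positivity
    congr 1
    have := intervalIntegral.mul_integral_comp_mul_left (a := ((j : ℝ) + 1) / ((n : ℝ) + 1))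
      (b := ((k : ℝ) + 1) / ((n : ℝ) + 1)) (f := q) ((n:ℝ) + 1)
    rw [mul_div_cancel₀ _ hn, mul_div_cancel₀ _ hn] at this
    rw [← this]
    congr 2
    ext s
    show quantile ν (1 - ((n:ℝ) + 1) * s / ((n:ℝ) + 1) * (1 - xi1inv (Real.exp
      ((-lam ^ 2 - 4 * Real.log (((n:ℝ) + 1) * s)) / (2 * (((n:ℝ) + 1) * s)))))) = _
    rw [mul_div_cancel_left₀ _ hn, mul_assoc 2]
  have hbad : μ.real Aᶜ ≤ Real.pi ^ 2 / 6 * Real.exp (-lam ^ 2 / 2) := by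
    calc μ.real Aᶜ ≤ μ.real (⋃ i, B i) := measureReal_mono hsub
      _ ≤ ∑ i, μ.real (B i) := measureReal_iUnion_fintype_le _
      _ ≤ ∑ i : Fin n, Real.exp (-lam ^ 2 / 2) * (1 / ((i:ℕ) + 1 : ℝ) ^ 2) :=
        Finset.sum_le_sum fun i _ => hB i
      _ ≤ _ := by
        rw [← Finset.mul_sum, mul_comm]
        exact mul_le_mul_of_nonneg_right (sum_sq n) (Real.exp_pos _).le
  have htot : 1 ≤ μ.real A + μ.real Aᶜ := by
    have := measureReal_union_le (μ := μ) A Aᶜ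
    rwa [Set.union_compl_self, probReal_univ] at this
  rw [ENNReal.ofReal_le_iff_le_toReal (measure_ne_top _ _)]
  change _ ≤ μ.real A
  have : 0 ≤ Real.pi ^ 2 / 6 * Real.exp (-lam ^ 2 / 2) := by positivity
  linarith
end
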